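/- For every d ≥ 1, k ≥ 1, and n ≥ 1, with m = ⌈k^{d/(d−1)}⌉ (for d ≥ 2), f(n,k,d) ≤ k^d · (d·m·C(m+1,k))^{d−1} · n^{d−1}. -/

import Mathlib

/-- `F ≺ M`: containment of `d`-dimensional 0-1 matrices via strictly increasing
coordinate injections. -/
def Contains {d : ℕ} {k n : Fin d → ℕ} (F : Finset (∀ i, Fin (k i)))
    (M : Finset (∀ i, Fin (n i))) : Prop :=
  ∃ f : ∀ i, Fin (k i) → Fin (n i), (∀ i, StrictMono (f i)) ∧
    ∀ e ∈ F, (fun i => f i (e i)) ∈ M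

/-- A `d`-dimensional permutation of `[k]`: for every coordinate `i` and value `x`
there is exactly one edge `e ∈ P` with `e i = x`. -/
def IsPerm {d k : ℕ} (P : Finset (Fin d → Fin k)) : Prop :=
  ∀ (i : Fin d) (x : Fin k), ∃! e, e ∈ P ∧ e i = x
/-- `f(n,P,d)`: maximum size of a `d`-dimensional `n × ⋯ × n` matrix avoiding `P`. -/
noncomputable def fP {d k : ℕ} (n : ℕ) (P : Finset (Fin d → Fin k)) : ℕ :=
  sSup {m | ∃ M : Finset (Fin d → Fin n), ¬ Contains P M ∧ M.card = m}
/-- `f(n,k,d) = max over d-dimensional permutations P of [k] of f(n,P,d)`. -/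
noncomputable def fK (n k d : ℕ) : ℕ :=
  sSup {m | ∃ P : Finset (Fin d → Fin k), IsPerm P ∧ m = fP n P}

/-- `M` contains the permutation `P` as soon as each edge of `P` can be sent to an edge of `M`
respecting all strict coordinate comparisons. -/
theorem IsPerm.contains_of_lt {d k n : ℕ} {P : Finset (Fin d → Fin k)} (hP : IsPerm P)
    {M : Finset (Fin d → Fin n)} (y : (Fin d → Fin k) → Fin d → Fin n)
    (hy : ∀ e ∈ P, y e ∈ M)
    (hlt : ∀ e ∈ P, ∀ e' ∈ P, ∀ i, e i < e' i → y e i < y e' i) : Contains P M := by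
  choose g hg hgu using fun i x => (hP i x)
  refine ⟨fun i x => y (g i x) i, fun i a b hab => ?_, fun e he => ?_⟩
  · refine hlt _ (hg i a).1 _ (hg i b).1 i ?_
    rw [(hg i a).2, (hg i b).2]; exact hab
  · have : (fun i => y (g i (e i)) i) = y e := by
      funext i
      rw [← hgu i (e i) e ⟨he, rfl⟩]
    simpa [this] using hy e he

/-- Deleting one coordinate of a permutation of positive remaining dimension. -/
theorem IsPerm.image_removeNth {d k : ℕ} {P : Finset (Fin (d + 1) → Fin k)}
    (hP : IsPerm P) (i : Fin (d + 1)) : IsPerm (P.image fun e => i.removeNth e) := by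
  intro j x
  obtain ⟨e, ⟨he, hex⟩, hu⟩ := hP (i.succAbove j) x
  refine ⟨i.removeNth e, ⟨Finset.mem_image_of_mem _ he, hex⟩, ?_⟩
  rintro f ⟨hf, hfx⟩
  obtain ⟨e', he', rfl⟩ := Finset.mem_image.1 hf
  rw [hu e' ⟨he', hfx⟩]

/-- Every `n × ⋯ × n` matrix of dimension `d` avoiding some permutation of `[k]` has at most
`G n ^ (d - 1)` edges. -/
def ExBound (d k : ℕ) (G : ℝ) : Prop :=
  ∀ P : Finset (Fin d → Fin k), IsPerm P → ∀ n (M : Finset (Fin d → Fin n)),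
    ¬ Contains P M → (M.card : ℝ) ≤ G * (n : ℝ) ^ (d - 1)

theorem ExBound.mono {d k : ℕ} {G H : ℝ} (h : ExBound d k G) (hGH : G ≤ H) : ExBound d k H :=
  fun P hP n M hM => (h P hP n M hM).trans (by gcongr)

open Classical in
theorem card_blocks_hit_le {D k : ℕ} {G' : ℝ} (hG' : ExBound D k G')
    {P : Finset (Fin (D + 1) → Fin k)} (hP : IsPerm P) {n t n0 : ℕ}
    {M : Finset (Fin (D + 1) → Fin n)} (hM : ¬ Contains P M)
    (J : Fin k → Set ℕ) (hJ : ∀ x y, x < y → ∀ a ∈ J x, ∀ b ∈ J y, a < b)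
    (i : Fin (D + 1)) (s : Fin n0) (Q : Finset (Fin (D + 1) → Fin n0))
    (hQs : ∀ b ∈ Q, b i = s)
    (hQ : ∀ b ∈ Q, ∀ x, ∃ y ∈ M, (∀ j, (y j : ℕ) / t = b j) ∧ (y i : ℕ) % t ∈ J x) :
    (Q.card : ℝ) ≤ G' * (n0 : ℝ) ^ (D - 1) := by
  have hinj : Set.InjOn (fun b : Fin (D + 1) → Fin n0 => i.removeNth b) Q := by
    intro b hb c hc h
    rw [← Fin.insertNth_self_removeNth i b, ← Fin.insertNth_self_removeNth i c, hQs b hb,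
      hQs c hc]
    simp only at h
    rw [h]
  rw [← Finset.card_image_of_injOn hinj]
  refine hG' _ (hP.image_removeNth i) n0 _ fun ⟨f, hf, hfm⟩ => hM ?_
  have key : ∀ e ∈ P, ∃ b ∈ Q, (∀ j, b (i.succAbove j) = f j (e (i.succAbove j))) := by
    intro e he
    obtain ⟨b, hb, hbe⟩ := Finset.mem_image.1 (hfm _ (Finset.mem_image_of_mem _ he))
    exact ⟨b, hb, fun j => congrFun hbe j⟩
  have key2 : ∀ e : Fin (D + 1) → Fin k, ∃ y : Fin (D + 1) → Fin n, e ∈ P → (y ∈ M ∧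
      (∀ j, (y (i.succAbove j) : ℕ) / t = f j (e (i.succAbove j))) ∧ (y i : ℕ) / t = s ∧
        (y i : ℕ) % t ∈ J (e i)) := by
    intro e
    by_cases he : e ∈ P
    · obtain ⟨b, hb, hbf⟩ := key e he
      obtain ⟨y, hy, hyb, hyJ⟩ := hQ b hb (e i)
      refine ⟨y, fun _ => ⟨hy, fun j => ?_, ?_, hyJ⟩⟩
      · rw [hyb, hbf]
      · rw [hyb, hQs b hb]
    · by_cases hne : P.Nonempty
      · obtain ⟨e', he'⟩ := hne
        obtain ⟨b, hb, -⟩ := key e' he'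
        obtain ⟨y, -⟩ := hQ b hb (e' i)
        exact ⟨y, fun h => absurd h he⟩
      · exact (hM ⟨fun _ x => absurd (hP i x) (by simp [Finset.not_nonempty_iff_eq_empty.1 hne]),
          fun _ x => absurd (hP i x) (by simp [Finset.not_nonempty_iff_eq_empty.1 hne]),
          fun e he => absurd ⟨e, he⟩ hne⟩).elim
  choose y hy using key2
  refine hP.contains_of_lt y (fun e he => (hy e he).1) fun e he e' he' j hj => ?_
  obtain ⟨-, h1, h2, h3⟩ := hy e he
  obtain ⟨-, h1', h2', h3'⟩ := hy e' he'
  rcases Fin.eq_self_or_eq_succAbove i j with rfl | ⟨j, rfl⟩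
  · have := hJ _ _ hj _ h3 _ h3'
    rw [Fin.lt_def, ← Nat.div_add_mod (y e j) t, ← Nat.div_add_mod (y e' j) t, h2, h2']
    omega
  · have := hf j hj
    rw [Fin.lt_def, ← h1, ← h1'] at this
    exact Fin.lt_def.2 (lt_of_not_ge fun h => absurd (Nat.div_le_div_right (c := t) h) (by omega))

open Classical in
/-- AM-GM for a finset of points: its size is controlled by the sizes of its projections. -/
theorem card_le_sum_projections {d : ℕ} (hd : 1 ≤ d) {α : Type*} (Q : Finset α)
    (p : α → Fin d → ℕ) (hp : Set.InjOn p Q) :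
    (Q.card : ℝ) ≤ (1 / d) * ∑ i, ((Q.image fun x => p x i).card : ℝ) ^ d := by
  have h1 : Q.card ≤ ∏ i, (Q.image fun x => p x i).card := by
    rw [← Fintype.card_piFinset, ← Finset.card_image_of_injOn hp]
    refine Finset.card_le_card fun f hf => ?_
    obtain ⟨x, hx, rfl⟩ := Finset.mem_image.1 hf
    exact Fintype.mem_piFinset.2 fun i => Finset.mem_image_of_mem _ hx
  have hd0 : (0 : ℝ) < d := by exact_mod_cast hd
  have h3 := Real.geom_mean_le_arith_mean_weighted (Finset.univ : Finset (Fin d))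
    (fun _ => 1 / (d : ℝ)) (fun i => ((Q.image fun x => p x i).card : ℝ) ^ d)
    (fun _ _ => by positivity) (by simp [hd0.ne']) (fun _ _ => by positivity)
  rw [Finset.mul_sum]
  refine le_trans ?_ h3
  have : ∀ i : Fin d, (((Q.image fun x => p x i).card : ℝ) ^ d) ^ (1 / (d : ℝ)) =
      ((Q.image fun x => p x i).card : ℝ) := by
    intro i
    rw [one_div]
    exact Real.pow_rpow_inv_natCast (by positivity) (by omega)
  simp only [this]
  exact_mod_cast h1

theorem card_not_lt_le {D n a t : ℕ} (M : Finset (Fin (D + 1) → Fin n))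
    (ha : n ≤ a + t) :
    ((M.filter fun x => ∃ i, a ≤ (x i : ℕ)).card : ℝ) ≤ (D + 1) * t * (n : ℝ) ^ D := by
  have h1 : (M.filter fun x => ∃ i, a ≤ (x i : ℕ)) ⊆
      Finset.univ.biUnion fun i : Fin (D + 1) =>
        (Finset.univ.filter fun x : Fin (D + 1) → Fin n => a ≤ (x i : ℕ)) := by
    intro x hx
    obtain ⟨i, hi⟩ := (Finset.mem_filter.1 hx).2
    exact Finset.mem_biUnion.2 ⟨i, Finset.mem_univ _, by simpa using hi⟩
  have h2 : ∀ i : Fin (D + 1),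
      (Finset.univ.filter fun x : Fin (D + 1) → Fin n => a ≤ (x i : ℕ)).card ≤ t * n ^ D := by
    intro i
    have hi : Set.InjOn (fun x : Fin (D + 1) → Fin n => ((x i : ℕ), i.removeNth x))
        (Finset.univ.filter fun x : Fin (D + 1) → Fin n => a ≤ (x i : ℕ)) := by
      intro x _ y _ h
      simp only [Prod.mk.injEq] at h
      rw [← Fin.insertNth_self_removeNth i x, ← Fin.insertNth_self_removeNth i y, h.2,
        Fin.ext h.1]
    have := Finset.card_le_card_of_injOn (t := Finset.Ico a (a + t) ×ˢ
      (Finset.univ : Finset (Fin D → Fin n))) _ (fun x hx => ?_) hi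
    · simpa using this
    · simp only [Finset.coe_filter, Set.mem_ofPred_eq] at hx
      have := (x i).2
      simp only [Finset.coe_product, Set.mem_prod, Finset.mem_coe, Finset.mem_Ico, Finset.mem_univ,
        and_true]
      omega
  have h3 := (Finset.card_le_card h1).trans (Finset.card_biUnion_le.trans
    (Finset.sum_le_sum fun i _ => h2 i))
  rw [Finset.sum_const, Finset.card_univ, Fintype.card_fin, smul_eq_mul] at h3
  have h4 : ((M.filter fun x => ∃ i, a ≤ (x i : ℕ)).card : ℝ) ≤
    (((D + 1) * (t * n ^ D) : ℕ) : ℝ) := by exact_mod_cast h3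
  push_cast at h4
  linarith

open Classical in
/-- The dimension step: a family `Λ` of divisions of a residue range `[0, t)`, such that every
nonempty set of residues is hit by many divisions, turns a bound in dimension `D` into a bound in
dimension `D + 1`. -/
theorem ExBound.succ {D k : ℕ} (hD : 1 ≤ D) {G' : ℝ} (hG'0 : 0 ≤ G') (hG' : ExBound D k G')
    {ι : Type*} (Λ : Finset ι) (hit : ι → Finset ℕ → Prop) {t : ℕ} (ht : 2 ≤ t)
    (hΛ : ∀ l ∈ Λ, ∃ J : Fin k → Set ℕ, (∀ x y, x < y → ∀ a ∈ J x, ∀ b ∈ J y, a < b) ∧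
      ∀ S, hit l S → ∀ x, ∃ a ∈ S, a ∈ J x)
    {B c G : ℝ} (hB : 0 ≤ B) (hc : 0 < c)
    (hcount : ∀ S : Finset ℕ, S.Nonempty → (∀ a ∈ S, a < t) →
      c * ((S.card : ℝ) ^ (D + 1) - B) ≤ (Λ.filter fun l => hit l S).card)
    (hG0 : 0 ≤ G)
    (hG : B / t ^ D * G + Λ.card * G' / (c * t ^ D) + (D + 1) * t ≤ G) :
    ExBound (D + 1) k G := by
  intro P hP n
  have ht0 : (0 : ℝ) < t := by exact_mod_cast (by omega : 0 < t)
  induction n using Nat.strong_induction_on with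
  | _ n ih =>
  intro M hM
  rcases Nat.eq_zero_or_pos n with rfl | hn
  · have : M = ∅ := by
      refine Finset.eq_empty_of_forall_notMem fun x _ => (x 0).elim0
    subst this
    simp; positivity
  set n0 := n / t with hn0
  have hn0lt : n0 < n := Nat.div_lt_self hn (by omega)
  have hmul : t * n0 ≤ n := Nat.mul_div_le n t
  have hres := card_not_lt_le (a := t * n0) (t := t) M
    (by rw [hn0]; have := Nat.div_add_mod n t; have := Nat.mod_lt n (y := t) (by omega); omega)
  set M1 := M.filter fun x => ¬ ∃ i, t * n0 ≤ (x i : ℕ) with hM1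
  have hcardM : (M.card : ℝ) = M1.card +
      (M.filter fun x => ∃ i, t * n0 ≤ (x i : ℕ)).card := by
    rw [← Finset.card_filter_add_card_filter_not (s := M) fun x => ∃ i, t * n0 ≤ (x i : ℕ)]
    push_cast; ring
  rcases Nat.eq_zero_or_pos n0 with h00 | h0pos
  · have hM1e : M1 = ∅ := by
      refine Finset.filter_eq_empty_iff.2 fun x _ => not_not.2 ⟨0, by simp [h00]⟩
    rw [hM1e] at hcardM
    rw [hcardM]
    simp only [Finset.card_empty, Nat.cast_zero, zero_add, Nat.add_sub_cancel]
    refine hres.trans ?_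
    have : ((D : ℝ) + 1) * t ≤ G := by
      refine le_trans ?_ hG
      have : 0 ≤ B / t ^ D * G + Λ.card * G' / (c * t ^ D) := by positivity
      linarith
    gcongr
  set blk : (Fin (D + 1) → Fin n) → Fin (D + 1) → Fin n0 :=
    fun x i => ⟨(x i / t) % n0, Nat.mod_lt _ h0pos⟩ with hblk
  have hblkM : ∀ x ∈ M1, ∀ i, (blk x i : ℕ) = x i / t := by
    intro x hx i
    have h := (Finset.mem_filter.1 hx).2
    simp only [not_exists, not_le] at h
    exact Nat.mod_eq_of_lt (Nat.div_lt_of_lt_mul (h i))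
  have hM1M : ∀ x ∈ M1, x ∈ M := fun x hx => (Finset.mem_filter.1 hx).1
  set Q := M1.image blk with hQ
  have hQcard : (Q.card : ℝ) ≤ G * (n0 : ℝ) ^ D := by
    refine ih n0 hn0lt Q fun ⟨f, hf, hfm⟩ => hM ?_
    have : ∀ e : Fin (D + 1) → Fin k, ∃ y : Fin (D + 1) → Fin n, e ∈ P →
        y ∈ M1 ∧ blk y = fun i => f i (e i) := by
      intro e
      by_cases he : e ∈ P
      · obtain ⟨y, hy, hye⟩ := Finset.mem_image.1 (hfm e he)
        exact ⟨y, fun _ => ⟨hy, hye⟩⟩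
      · exact ⟨fun _ => ⟨0, hn⟩, fun h => absurd h he⟩
    choose y hy using this
    refine hP.contains_of_lt y (fun e he => hM1M _ (hy e he).1) fun e he e' he' i hi => ?_
    have h := hf i hi
    rw [← congrFun (hy e he).2 i, ← congrFun (hy e' he').2 i, Fin.lt_def,
      hblkM _ (hy e he).1, hblkM _ (hy e' he').1] at h
    exact Fin.lt_def.2 (lt_of_not_ge fun h' => absurd (Nat.div_le_div_right (c := t) h') (by omega))
  set S : (Fin (D + 1) → Fin n0) → Fin (D + 1) → Finset ℕ :=
    fun b i => (M1.filter fun x => blk x = b).image fun x => (x i : ℕ) % t with hS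
  set h : (Fin (D + 1) → Fin n0) → Fin (D + 1) → ℝ :=
    fun b i => ((Λ.filter fun l => hit l (S b i)).card : ℝ) with hh
  have hblock : ∀ b ∈ Q, ((M1.filter fun x => blk x = b).card : ℝ) ≤
      (1 / (D + 1 : ℕ)) * ∑ i, (B + h b i / c) := by
    intro b hb
    refine (card_le_sum_projections (by omega) (M1.filter fun x => blk x = b)
      (fun x i => (x i : ℕ) % t) ?_).trans ?_
    · intro x hx y hy hxy
      simp only [Finset.coe_filter, Set.mem_ofPred_eq] at hx hy
      funext i
      have h1 := congrFun hxy i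
      have h2 : (x i : ℕ) / t = y i / t := by
        rw [← hblkM x hx.1, ← hblkM y hy.1, hx.2, hy.2]
      simp only at h1
      rw [Fin.ext_iff, ← Nat.div_add_mod (x i) t, ← Nat.div_add_mod (y i) t, h1, h2]
    · refine mul_le_mul_of_nonneg_left (Finset.sum_le_sum fun i _ => ?_) (by positivity)
      have hne : (S b i).Nonempty := by
        obtain ⟨x, hx, rfl⟩ := Finset.mem_image.1 hb
        exact ⟨_, Finset.mem_image_of_mem _ (Finset.mem_filter.2 ⟨hx, rfl⟩)⟩
      have h1 := hcount (S b i) hne fun a ha => by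
        obtain ⟨x, -, rfl⟩ := Finset.mem_image.1 ha
        exact Nat.mod_lt _ (by omega)
      have h2 : ((S b i).card : ℝ) ^ (D + 1) - B ≤ h b i / c := by
        rw [le_div_iff₀ hc]; linarith
      simp only [hS] at h2 ⊢
      linarith
  have hslab : ∀ i, ∑ b ∈ Q, h b i ≤ Λ.card * (G' * (n0 : ℝ) ^ D) := by
    intro i
    have e1 : ∑ b ∈ Q, h b i = ∑ l ∈ Λ, ∑ s : Fin n0,
        (((Q.filter fun b => b i = s).filter fun b => hit l (S b i)).card : ℝ) := by
      have : ∀ l, ∑ s : Fin n0, (((Q.filter fun b => b i = s).filter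
          fun b => hit l (S b i)).card : ℝ) = ∑ b ∈ Q, if hit l (S b i) then (1 : ℝ) else 0 := by
        intro l
        rw [← Finset.sum_fiberwise Q (fun b => b i)]
        refine Finset.sum_congr rfl fun s _ => ?_
        rw [Finset.sum_boole]
      simp only [this]
      rw [Finset.sum_comm]
      refine Finset.sum_congr rfl fun b _ => ?_
      simp only [hh]
      rw [Finset.sum_boole]
    rw [e1, ← nsmul_eq_mul]
    refine Finset.sum_le_card_nsmul _ _ _ fun l hl => ?_
    obtain ⟨J, hJ, hJhit⟩ := hΛ l hl
    have : G' * (n0 : ℝ) ^ D = (Finset.univ : Finset (Fin n0)).card • (G' * (n0 : ℝ) ^ (D - 1)) := by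
      rw [Finset.card_univ, Fintype.card_fin, nsmul_eq_mul]
      obtain ⟨D, rfl⟩ : ∃ E, D = E + 1 := ⟨D - 1, by omega⟩
      simp only [Nat.add_sub_cancel]
      ring
    rw [this]
    refine Finset.sum_le_card_nsmul _ _ _ fun s _ => ?_
    refine card_blocks_hit_le hG' hP (t := t) hM J hJ i s _
      (fun b hb => (Finset.mem_filter.1 (Finset.mem_filter.1 hb).1).2) fun b hb x => ?_
    obtain ⟨a, ha, haJ⟩ := hJhit _ (Finset.mem_filter.1 hb).2 x
    obtain ⟨y, hy, rfl⟩ := Finset.mem_image.1 ha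
    have hy' := Finset.mem_filter.1 hy
    refine ⟨y, hM1M _ hy'.1, fun j => ?_, haJ⟩
    rw [← hblkM _ hy'.1, hy'.2]
  have hM1card : (M1.card : ℝ) ≤ (B * G + Λ.card * G' / c) * (n0 : ℝ) ^ D := by
    have e1 : (M1.card : ℝ) = ∑ b ∈ Q, ((M1.filter fun x => blk x = b).card : ℝ) := by
      exact_mod_cast Finset.card_eq_sum_card_image blk M1
    have hD0 : (0 : ℝ) < (D + 1 : ℕ) := by positivity
    calc (M1.card : ℝ) ≤ ∑ b ∈ Q, (1 / (D + 1 : ℕ)) * ∑ i, (B + h b i / c) := by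
          rw [e1]; exact Finset.sum_le_sum hblock
      _ = B * Q.card + (1 / (D + 1 : ℕ)) * ∑ i, (∑ b ∈ Q, h b i) / c := by
          rw [← Finset.mul_sum, Finset.sum_comm]
          simp only [Finset.sum_add_distrib, Finset.sum_const, nsmul_eq_mul, Finset.sum_div,
            Finset.card_univ, Fintype.card_fin]
          field_simp
      _ ≤ B * (G * (n0 : ℝ) ^ D) + (1 / (D + 1 : ℕ)) *
          ∑ i : Fin (D + 1), (Λ.card * (G' * (n0 : ℝ) ^ D)) / c := by
          gcongr with i
          exact hslab i
      _ = _ := by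
          rw [Finset.sum_const, nsmul_eq_mul, Finset.card_univ, Fintype.card_fin]
          field_simp
  rw [hcardM]
  have hpow : (n0 : ℝ) ^ D ≤ (n : ℝ) ^ D / (t : ℝ) ^ D := by
    rw [← div_pow]
    gcongr
    rw [le_div_iff₀ ht0, mul_comm]
    exact_mod_cast hmul
  calc _ ≤ (B * G + Λ.card * G' / c) * ((n : ℝ) ^ D / (t : ℝ) ^ D) +
        (D + 1) * t * (n : ℝ) ^ D := by
        refine add_le_add (hM1card.trans ?_) hres
        gcongr
    _ = (B / t ^ D * G + Λ.card * G' / (c * t ^ D) + (D + 1) * t) * (n : ℝ) ^ D := by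
        field_simp
    _ ≤ G * (n : ℝ) ^ (D + 1 - 1) := by
        rw [Nat.add_sub_cancel]
        gcongr

/-- The siblings, at all levels `l < r` of the `N`-ary tree on `[0, N ^ r)`, of the path to `a`. -/
def siblings (N r a : ℕ) : Finset (ℕ × ℕ) :=
  (Finset.range r ×ˢ Finset.range (N ^ r)).filter fun p =>
    p.2 / N = a / N ^ (p.1 + 1) ∧ p.2 ≠ a / N ^ p.1

theorem card_siblings_le {N r a : ℕ} (hN : 2 ≤ N) : (siblings N r a).card ≤ r * (N - 1) := by
  have hsub : siblings N r a ⊆ (Finset.range r).biUnion fun l =>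
      (((Finset.range N).image fun c => N * (a / N ^ (l + 1)) + c).erase (a / N ^ l)).image
        fun u => (l, u) := by
    rintro ⟨l, u⟩ h
    simp only [siblings, Finset.mem_filter, Finset.mem_product, Finset.mem_range] at h
    simp only [Finset.mem_biUnion, Finset.mem_range, Finset.mem_image, Finset.mem_erase,
      Prod.mk.injEq]
    refine ⟨l, h.1.1, u, ⟨h.2.2, u % N, Nat.mod_lt _ (by omega), ?_⟩, rfl, rfl⟩
    rw [← h.2.1, Nat.div_add_mod]
  refine (Finset.card_le_card hsub).trans (Finset.card_biUnion_le.trans ?_)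
  have : ∀ l ∈ Finset.range r, (((((Finset.range N).image fun c =>
      N * (a / N ^ (l + 1)) + c).erase (a / N ^ l)).image fun u => (l, u)).card) ≤ N - 1 := by
    intro l _
    refine Finset.card_image_le.trans ?_
    rw [Finset.card_erase_of_mem]
    · refine Nat.sub_le_sub_right (Finset.card_image_le.trans (by simp)) 1
    · refine Finset.mem_image.2 ⟨a / N ^ l % N, Finset.mem_range.2 (Nat.mod_lt _ (by omega)), ?_⟩
      rw [pow_succ, ← Nat.div_div_eq_div_mul, Nat.div_add_mod]
  simpa using Finset.sum_le_card_nsmul _ _ _ this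

/-- The elements of `insert (0, a) (siblings N r a)`, viewed as intervals
`{x | x / N ^ l = u}`, are pairwise comparable. -/
theorem siblings_lt {N r a : ℕ} {e e' : ℕ × ℕ}
    (he : e ∈ insert (0, a) (siblings N r a)) (he' : e' ∈ insert (0, a) (siblings N r a))
    (hee : e ≠ e') {x y x' y' : ℕ} (hx : x / N ^ e.1 = e.2) (hx' : x' / N ^ e.1 = e.2)
    (hy : y / N ^ e'.1 = e'.2) (hy' : y' / N ^ e'.1 = e'.2) (h : x ≤ y) : x' < y' := by
  have key : ∀ f ∈ insert (0, a) (siblings N r a), f.2 / N = a / N ^ (f.1 + 1) ∧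
      (1 ≤ f.1 → f.2 ≠ a / N ^ f.1) := by
    intro f hf
    rcases Finset.mem_insert.1 hf with rfl | hf
    · simp
    · have := (Finset.mem_filter.1 hf).2
      exact ⟨this.1, fun _ => this.2⟩
  have up : ∀ f ∈ insert (0, a) (siblings N r a), ∀ z, z / N ^ f.1 = f.2 → ∀ l, f.1 < l →
      z / N ^ l = a / N ^ l := by
    intro f hf z hz l hl
    obtain ⟨c, rfl⟩ : ∃ c, l = f.1 + 1 + c := ⟨l - (f.1 + 1), by omega⟩
    rw [pow_add, ← Nat.div_div_eq_div_mul, ← Nat.div_div_eq_div_mul, ← (key f hf).1, ← hz,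
      pow_succ, Nat.div_div_eq_div_mul z (N ^ f.1)]
  have lt_of : ∀ l, x / N ^ l ≠ y / N ^ l → x' / N ^ l = x / N ^ l → y' / N ^ l = y / N ^ l →
      x' < y' := by
    intro l h1 h2 h3
    have h4 : x / N ^ l ≤ y / N ^ l := Nat.div_le_div_right h
    by_contra h5
    have := Nat.div_le_div_right (c := N ^ l) (not_lt.1 h5)
    omega
  rcases lt_trichotomy e.1 e'.1 with hl | hl | hl
  · refine lt_of e'.1 ?_ ?_ (hy'.trans hy.symm)
    · rw [up e he x hx _ hl, hy]
      exact ((key e' he').2 (by omega)).symm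
    · rw [up e he x hx _ hl, up e he x' hx' _ hl]
  · refine lt_of e.1 ?_ (hx'.trans hx.symm) ?_
    · rw [hx, hl, hy]
      exact fun h => hee (Prod.ext hl h)
    · rw [hl, hy, hy']
  · refine lt_of e.1 ?_ (hx'.trans hx.symm) ?_
    · rw [up e' he' y hy _ hl, hx]
      exact (key e he).2 (by omega)
    · rw [up e' he' y hy _ hl, up e' he' y' hy' _ hl]

open Classical in
theorem siblings_division {N r a k : ℕ} (hN : 2 ≤ N) {E : Finset (ℕ × ℕ)}
    (hE : E ⊆ siblings N r a) (hk : k ≤ E.card + 1) :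
    ∃ J : Fin k → Set ℕ, (∀ x y, x < y → ∀ b ∈ J x, ∀ c ∈ J y, b < c) ∧
      ∀ S : Finset ℕ, (a ∈ S ∧ ∀ p ∈ E, ∃ b ∈ S, b / N ^ p.1 = p.2) → ∀ x, ∃ b ∈ S, b ∈ J x := by
  set F := insert (0, a) E with hF
  have hFs : ∀ e ∈ F, e ∈ insert (0, a) (siblings N r a) := fun e he =>
    Finset.insert_subset_insert _ hE he
  have hN0 : ∀ l, 0 < N ^ l := fun l => pow_pos (by omega) _
  have hkey : ∀ e : ℕ × ℕ, e.2 * N ^ e.1 / N ^ e.1 = e.2 := fun e =>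
    Nat.mul_div_cancel _ (hN0 _)
  have hinj : Set.InjOn (fun e : ℕ × ℕ => e.2 * N ^ e.1) F := by
    intro e he e' he' h
    by_contra hne
    exact absurd (siblings_lt (hFs e he) (hFs e' he') hne (hkey e) (hkey e) (hkey e') (hkey e')
      h.le) (by simp only at h; omega)
  have hFcard : (F.image fun e : ℕ × ℕ => e.2 * N ^ e.1).card = E.card + 1 := by
    rw [Finset.card_image_of_injOn hinj, hF, Finset.card_insert_of_notMem]
    intro h
    have := (Finset.mem_filter.1 (hE h)).2.2
    simp at this
  set emb := (F.image fun e : ℕ × ℕ => e.2 * N ^ e.1).orderEmbOfCardLe (k := k) (by omega)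
    with hemb
  refine ⟨fun x => {b | ∃ e ∈ F, e.2 * N ^ e.1 = emb x ∧ b / N ^ e.1 = e.2}, ?_, ?_⟩
  · rintro x y hxy b ⟨e, he, hex, heb⟩ c ⟨e', he', hey, hec⟩
    have hlt : emb x < emb y := emb.strictMono hxy
    refine siblings_lt (hFs e he) (hFs e' he') ?_ (hkey e) heb (hkey e') hec (by omega)
    rintro rfl
    omega
  · rintro S ⟨haS, hES⟩ x
    obtain ⟨e, he, hex⟩ := Finset.mem_image.1 (Finset.orderEmbOfCardLe_mem
      (F.image fun e : ℕ × ℕ => e.2 * N ^ e.1) (k := k) (by omega) x)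
    rcases Finset.mem_insert.1 he with rfl | heE
    · exact ⟨a, haS, (0, a), he, hex, by simp⟩
    · obtain ⟨b, hb, hbe⟩ := hES e heE
      exact ⟨b, hb, e, he, hex, hbe⟩

/-- The number of children met by `S` of the level-`(l + 1)` ancestor of `a`. -/
def branching (N : ℕ) (S : Finset ℕ) (a l : ℕ) : ℕ :=
  ((S.image fun x => x / N ^ l).filter fun u => u / N = a / N ^ (l + 1)).card

theorem branching_pos {N : ℕ} {S : Finset ℕ} {a : ℕ} (ha : a ∈ S) (l : ℕ) :
    0 < branching N S a l :=
  Finset.card_pos.2 ⟨a / N ^ l, Finset.mem_filter.2 ⟨Finset.mem_image_of_mem _ ha, by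
    rw [pow_succ, Nat.div_div_eq_div_mul]⟩⟩

theorem sum_inv_prod_branching {N : ℕ} (r : ℕ) : ∀ S : Finset ℕ, S.Nonempty →
    (∀ a ∈ S, a < N ^ r) →
    ∑ a ∈ S, ∏ l ∈ Finset.range r, ((branching N S a l : ℝ))⁻¹ = 1 := by
  induction r with
  | zero =>
    intro S hS h
    have : S = {0} := by
      obtain ⟨a, ha⟩ := hS
      refine Finset.eq_singleton_iff_unique_mem.2 ⟨?_, fun b hb => by simpa using h b hb⟩
      have : a = 0 := by simpa using h a ha
      exact this ▸ ha
    simp [this]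
  | succ r ih =>
    intro S hS h
    have hN : 0 < N := by
      obtain ⟨a, ha⟩ := hS
      exact Nat.pos_of_ne_zero fun h0 => by simpa [h0] using h a ha
    have h1 := ih (S.image fun a => a / N) (hS.image _) fun b hb => by
      obtain ⟨a, ha, rfl⟩ := Finset.mem_image.1 hb
      exact Nat.div_lt_of_lt_mul (by rw [mul_comm, ← pow_succ]; exact h a ha)
    have hshift : ∀ a l, branching N S a (l + 1) =
        branching N (S.image fun a => a / N) (a / N) l := by
      intro a l
      have e1 : (S.image fun x => x / N ^ (l + 1)) =
          (S.image fun a => a / N).image fun x => x / N ^ l := by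
        rw [Finset.image_image]
        refine Finset.image_congr fun x _ => ?_
        simp only [Function.comp, Nat.div_div_eq_div_mul, pow_succ']
      simp only [branching, e1, Nat.div_div_eq_div_mul, ← pow_succ']
    rw [← h1, ← Finset.sum_fiberwise_of_maps_to
      (g := fun a => a / N) (t := S.image fun a => a / N)
      (fun a ha => Finset.mem_image_of_mem _ ha)]
    refine Finset.sum_congr rfl fun v hv => ?_
    have e2 : ∀ a ∈ S.filter (fun a => a / N = v),
        ∏ l ∈ Finset.range (r + 1), ((branching N S a l : ℝ))⁻¹ =
        ((S.filter fun a => a / N = v).card : ℝ)⁻¹ *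
          ∏ l ∈ Finset.range r, ((branching N (S.image fun a => a / N) v l : ℝ))⁻¹ := by
      intro a ha
      have hav := (Finset.mem_filter.1 ha).2
      rw [Finset.prod_range_succ', mul_comm]
      simp only [hshift, hav]
      congr 3
      simp [branching, hav]
    rw [Finset.sum_congr rfl e2, Finset.sum_const, nsmul_eq_mul, ← mul_assoc, mul_inv_cancel₀,
      one_mul]
    obtain ⟨a, ha, rfl⟩ := Finset.mem_image.1 hv
    have : 0 < (S.filter fun b => b / N = a / N).card :=
      Finset.card_pos.2 ⟨a, Finset.mem_filter.2 ⟨ha, rfl⟩⟩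
    positivity

theorem pow_card_le_sum_prod_branching {N r D : ℕ} {S : Finset ℕ} (hS : S.Nonempty)
    (h : ∀ a ∈ S, a < N ^ r) :
    (S.card : ℝ) ^ (D + 1) ≤ ∑ a ∈ S, (∏ l ∈ Finset.range r, (branching N S a l : ℝ)) ^ D := by
  have hpos : ∀ a ∈ S, 0 < ∏ l ∈ Finset.range r, (branching N S a l : ℝ) := fun a ha =>
    Finset.prod_pos fun l _ => by exact_mod_cast branching_pos ha l
  have := Real.pow_arith_mean_le_arith_mean_pow S
    (fun a => ∏ l ∈ Finset.range r, ((branching N S a l : ℝ))⁻¹)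
    (fun a => ∏ l ∈ Finset.range r, (branching N S a l : ℝ))
    (fun a _ => by positivity) (sum_inv_prod_branching r S hS h) (fun a ha => (hpos a ha).le)
    (D + 1)
  have e1 : ∀ a ∈ S, (∏ l ∈ Finset.range r, ((branching N S a l : ℝ))⁻¹) *
      ∏ l ∈ Finset.range r, (branching N S a l : ℝ) = 1 := fun a ha => by
    rw [Finset.prod_inv_distrib, inv_mul_cancel₀ (hpos a ha).ne']
  rw [Finset.sum_congr rfl e1] at this
  refine (by simpa using this : (S.card : ℝ) ^ (D + 1) ≤ _).trans (le_of_eq ?_)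
  refine Finset.sum_congr rfl fun a ha => ?_
  have := (hpos a ha).ne'
  simp only [Finset.prod_inv_distrib, pow_succ']
  field_simp

theorem prod_le_pow_of_sum {r h : ℕ} (hr : 1 ≤ r) (c : ℕ → ℕ)
    (hsum : ∑ l ∈ Finset.range r, c l = h + r) :
    ∏ l ∈ Finset.range r, (c l : ℝ) ≤ (1 + (h : ℝ) / r) ^ r := by
  have hr0 : (0 : ℝ) < r := by exact_mod_cast hr
  have h1 := Real.geom_mean_le_arith_mean_weighted (Finset.range r) (fun _ => 1 / (r : ℝ))
    (fun l => (c l : ℝ)) (fun _ _ => by positivity) (by simp [hr0.ne']) (fun _ _ => by positivity)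
  rw [← Finset.mul_sum, ← Nat.cast_sum, hsum] at h1
  rw [Real.finsetProd_rpow _ _ (fun _ _ => by positivity)] at h1
  have h2 := pow_le_pow_left₀ (by positivity) h1 r
  rw [one_div, Real.rpow_inv_natCast_pow (by positivity) (by omega)] at h2
  refine h2.trans (le_of_eq ?_)
  congr 1
  push_cast
  field_simp
  ring

open Classical in
theorem card_hit_siblings {N r : ℕ} {S : Finset ℕ} (hS : ∀ a ∈ S, a < N ^ r) {a : ℕ}
    (ha : a ∈ S) :
    ∑ l ∈ Finset.range r, branching N S a l =
      ((siblings N r a).filter fun p => ∃ b ∈ S, b / N ^ p.1 = p.2).card + r := by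
  have e1 : (siblings N r a).filter (fun p => ∃ b ∈ S, b / N ^ p.1 = p.2) =
      (Finset.range r).biUnion fun l => (((S.image fun x => x / N ^ l).filter
        fun u => u / N = a / N ^ (l + 1)).erase (a / N ^ l)).image fun u => (l, u) := by
    ext ⟨l, u⟩
    simp only [siblings, Finset.mem_filter, Finset.mem_product, Finset.mem_range,
      Finset.mem_biUnion, Finset.mem_image, Finset.mem_erase, Prod.mk.injEq]
    constructor
    · rintro ⟨⟨⟨hl, hu⟩, h1, h2⟩, b, hb, hbu⟩
      exact ⟨l, hl, u, ⟨h2, ⟨b, hb, hbu⟩, h1⟩, rfl, rfl⟩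
    · rintro ⟨l', hl, u', ⟨h2, ⟨b, hb, hbu⟩, h1⟩, rfl, rfl⟩
      refine ⟨⟨⟨hl, ?_⟩, h1, h2⟩, b, hb, hbu⟩
      rw [← hbu]
      exact (Nat.div_le_self _ _).trans_lt (hS b hb)
  rw [e1, Finset.card_biUnion]
  · have : ∀ l ∈ Finset.range r, branching N S a l = ((((S.image fun x => x / N ^ l).filter
        fun u => u / N = a / N ^ (l + 1)).erase (a / N ^ l)).image fun u => (l, u)).card + 1 := by
      intro l _
      rw [Finset.card_image_of_injective _ (Prod.mk_right_injective l), Finset.card_erase_add_one,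
        branching]
      exact Finset.mem_filter.2 ⟨Finset.mem_image_of_mem _ ha, by
        rw [pow_succ, Nat.div_div_eq_div_mul]⟩
    rw [Finset.sum_congr rfl this, Finset.sum_add_distrib]
    simp
  · intro l _ l' _ hll
    rw [Function.onFun, Finset.disjoint_left]
    intro p hp hp'
    obtain ⟨u, -, rfl⟩ := Finset.mem_image.1 hp
    obtain ⟨u', -, h⟩ := Finset.mem_image.1 hp'
    exact hll (Prod.ext_iff.1 h).1.symm

open Classical in
/-- The dimension step for the family of divisions into a point and `q` of its siblings in the
`N`-ary tree of depth `r`. -/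
theorem ExBound.spine {D k : ℕ} (hD : 1 ≤ D) {G' : ℝ} (hG'0 : 0 ≤ G') (hG' : ExBound D k G')
    {N r q : ℕ} (hN : 2 ≤ N) (hr : 1 ≤ r) (hq : k ≤ q + 1) {A B G : ℝ} (hA : 0 < A) (hB : 0 ≤ B)
    (hcond : ∀ h : ℕ, h ≤ r * (N - 1) →
      A * ((1 + (h : ℝ) / r) ^ (r * D) - B / (1 + (h : ℝ) / r) ^ r) ≤ h.choose q)
    (hG0 : 0 ≤ G)
    (hG : B / N ^ (r * D) * G + (r * (N - 1)).choose q * N ^ r * G' / (A * N ^ (r * D)) +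
      (D + 1) * N ^ r ≤ G) : ExBound (D + 1) k G := by
  set Λ : Finset ((_ : ℕ) × Finset (ℕ × ℕ)) :=
    (Finset.range (N ^ r)).sigma fun a => (siblings N r a).powersetCard q with hΛ
  set hit : ((_ : ℕ) × Finset (ℕ × ℕ)) → Finset ℕ → Prop :=
    fun l S => l.1 ∈ S ∧ ∀ p ∈ l.2, ∃ b ∈ S, b / N ^ p.1 = p.2 with hhit
  have hΛcard : (Λ.card : ℝ) ≤ (r * (N - 1)).choose q * N ^ r := by
    have : Λ.card ≤ (Finset.range (N ^ r)).card • (r * (N - 1)).choose q := by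
      rw [hΛ, Finset.card_sigma]
      refine Finset.sum_le_card_nsmul _ _ _ fun a _ => ?_
      rw [Finset.card_powersetCard]
      exact Nat.choose_le_choose _ (card_siblings_le hN)
    rw [Finset.card_range, smul_eq_mul] at this
    calc (Λ.card : ℝ) ≤ ((N ^ r * (r * (N - 1)).choose q : ℕ) : ℝ) := by exact_mod_cast this
      _ = _ := by push_cast; ring
  refine ExBound.succ hD hG'0 hG' Λ hit (t := N ^ r)
    (hN.trans (Nat.le_self_pow (by omega) N)) ?_ hB hA ?_ hG0 ?_
  · rintro ⟨a, E⟩ hl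
    have hl' := Finset.mem_powersetCard.1 (Finset.mem_sigma.1 hl).2
    obtain ⟨J, hJ, hJS⟩ := siblings_division (k := k) hN hl'.1 (by rw [hl'.2]; exact hq)
    exact ⟨J, hJ, fun S hS => hJS S hS⟩
  · intro S hS hSt
    set hh : ℕ → ℕ := fun a =>
      ((siblings N r a).filter fun p => ∃ b ∈ S, b / N ^ p.1 = p.2).card with hhh
    have e1 : (Λ.filter fun l => hit l S).card = ∑ a ∈ S, (hh a).choose q := by
      have : Λ.filter (fun l => hit l S) = S.sigma fun a => ((siblings N r a).filter
          fun p => ∃ b ∈ S, b / N ^ p.1 = p.2).powersetCard q := by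
        ext ⟨a, E⟩
        simp only [hΛ, hhit, Finset.mem_filter, Finset.mem_sigma, Finset.mem_range,
          Finset.mem_powersetCard]
        constructor
        · rintro ⟨⟨-, h1, h2⟩, h3, h4⟩
          exact ⟨h3, fun p hp => Finset.mem_filter.2 ⟨h1 hp, h4 p hp⟩, h2⟩
        · rintro ⟨h1, h2, h3⟩
          exact ⟨⟨hSt a h1, fun p hp => (Finset.mem_filter.1 (h2 hp)).1, h3⟩, h1,
            fun p hp => (Finset.mem_filter.1 (h2 hp)).2⟩
      rw [this, Finset.card_sigma]
      simp only [Finset.card_powersetCard, hhh]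
    have e2 : (S.card : ℝ) ^ (D + 1) - B ≤ ∑ a ∈ S,
        ((∏ l ∈ Finset.range r, (branching N S a l : ℝ)) ^ D -
          B * ∏ l ∈ Finset.range r, ((branching N S a l : ℝ))⁻¹) := by
      rw [Finset.sum_sub_distrib, ← Finset.mul_sum, sum_inv_prod_branching r S hS hSt, mul_one]
      exact sub_le_sub_right (pow_card_le_sum_prod_branching hS hSt) _
    refine (mul_le_mul_of_nonneg_left e2 hA.le).trans ?_
    refine le_trans ?_ (le_of_eq (congrArg Nat.cast (show (∑ a ∈ S, (hh a).choose q) = _ by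
      rw [← e1]; congr)))
    rw [Finset.mul_sum, Nat.cast_sum]
    refine Finset.sum_le_sum fun a ha => ?_
    have hXpos : 0 < ∏ l ∈ Finset.range r, (branching N S a l : ℝ) :=
      Finset.prod_pos fun l _ => by exact_mod_cast branching_pos ha l
    have hX := prod_le_pow_of_sum hr (branching N S a) (card_hit_siblings hSt ha)
    refine le_trans ?_ (hcond (hh a) ((Finset.card_filter_le _ _).trans (card_siblings_le hN)))
    refine mul_le_mul_of_nonneg_left ?_ hA.le
    change _ ≤ (1 + (hh a : ℝ) / r) ^ r at hX
    rw [Finset.prod_inv_distrib, pow_mul, div_eq_mul_inv B]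
    refine sub_le_sub (by gcongr) (mul_le_mul_of_nonneg_left ?_ hB)
    exact inv_anti₀ hXpos hX
  · refine le_trans ?_ hG
    push_cast
    rw [← pow_mul]
    gcongr

open Finset

theorem one_sub_mul_one_add_pow_le_one {h r q : ℕ} (hr : 1 ≤ r) (hq : q ≤ h) :
    (1 - (q:ℝ)/(h+1)) * (1 + 1/((r:ℝ)+h))^q ≤ 1 := by
  have hr' : (1:ℝ) ≤ r := by exact_mod_cast hr
  have h0 : (0:ℝ) ≤ h := h.cast_nonneg
  have hq' : (q:ℝ) ≤ h := by exact_mod_cast hq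
  have h1 : 1 - (q:ℝ)/(h+1) ≤ Real.exp (-((q:ℝ)/(h+1))) := by
    have := Real.add_one_le_exp (-((q:ℝ)/(h+1))); linarith
  have h2 : (1 + 1/((r:ℝ)+h))^q ≤ Real.exp (q * (1/((r:ℝ)+h))) := by
    rw [Real.exp_nat_mul]
    have := Real.add_one_le_exp (1/((r:ℝ)+h))
    exact pow_le_pow_left₀ (by positivity) (by linarith) _
  calc _ ≤ Real.exp (-((q:ℝ)/(h+1))) * Real.exp (q * (1/((r:ℝ)+h))) := by
        have : 0 ≤ 1 - (q:ℝ)/(h+1) := by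
          rw [sub_nonneg, div_le_one (by positivity)]; linarith
        gcongr
    _ ≤ 1 := by
        rw [← Real.exp_add, Real.exp_le_one_iff]
        have : (q:ℝ) * (1/((r:ℝ)+h)) ≤ q/(h+1) := by
          rw [mul_one_div]
          exact div_le_div_of_nonneg_left q.cast_nonneg (by linarith) (by linarith)
        linarith

theorem choose_div_pow_mono {r q : ℕ} (hr : 1 ≤ r) {a b : ℕ} (ha : q ≤ a) (hab : a ≤ b) :
    (a.choose q : ℝ) / ((r:ℝ)+a)^q ≤ (b.choose q : ℝ) / ((r:ℝ)+b)^q := by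
  induction b, hab using Nat.le_induction with
  | base => rfl
  | succ h hah ih =>
    refine ih.trans ?_
    have hr' : (1:ℝ) ≤ r := by exact_mod_cast hr
    have hqh : q ≤ h := ha.trans hah
    have hq' : (q:ℝ) ≤ h := by exact_mod_cast hqh
    have h0 : (0:ℝ) ≤ h := h.cast_nonneg
    have key := one_sub_mul_one_add_pow_le_one (h := h) (q := q) hr hqh
    have hc : ((h+1).choose q : ℝ) * (h+1-q) = h.choose q * (h+1) := by
      have := Nat.choose_mul_succ_eq h q
      have h2 : (h + 1 - q : ℕ) = (h:ℝ) + 1 - q := by push_cast [Nat.cast_sub (show q ≤ h+1 by omega)]; ring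
      rw [← h2]; exact_mod_cast this.symm
    have e1 : (1 + 1/((r:ℝ)+h)) = ((r:ℝ)+(h+1:ℕ))/((r:ℝ)+h) := by
      push_cast; field_simp; ring
    have e2 : (1 - (q:ℝ)/(h+1)) = (h+1-q)/(h+1) := by field_simp
    rw [e1, e2, div_pow, div_mul_div_comm, div_le_one (by positivity)] at key
    rw [div_le_div_iff₀ (by positivity) (by positivity)]
    have hpos : (0:ℝ) < h+1-q := by linarith
    refine le_of_mul_le_mul_right ?_ hpos
    calc (h.choose q : ℝ) * ((r:ℝ)+(h+1:ℕ))^q * (h+1-q)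
        = h.choose q * ((h+1-q) * ((r:ℝ)+(h+1:ℕ))^q) := by ring
      _ ≤ h.choose q * ((h+1) * ((r:ℝ)+h)^q) := by gcongr
      _ = _ := by rw [← mul_assoc, ← hc]; ring

/-- The threshold function behind `ExBound.spine`, in its generic instance. -/
theorem threshold_le_choose {D r H h : ℕ} (hr : 1 ≤ r) (hH : D ≤ H) :
    ((r*H).choose (r*D) : ℝ) / ((H:ℝ)+1)^(r*D) *
      ((1 + (h:ℝ)/r)^(r*D) - ((H:ℝ)+1)^(r*(D+1))/(1 + (h:ℝ)/r)^r) ≤ h.choose (r*D) := by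
  have hr' : (0:ℝ) < r := by exact_mod_cast hr
  have hA : 0 ≤ ((r*H).choose (r*D) : ℝ) / ((H:ℝ)+1)^(r*D) := by positivity
  rcases le_total h (r*H) with hh | hh
  · have ht : 1 + (h:ℝ)/r ≤ H+1 := by
      have : (h:ℝ) ≤ r*H := by exact_mod_cast hh
      rw [add_comm, add_le_add_iff_right, div_le_iff₀ hr']; linarith
    have : (1 + (h:ℝ)/r)^(r*D) - ((H:ℝ)+1)^(r*(D+1))/(1 + (h:ℝ)/r)^r ≤ 0 := by
      rw [sub_nonpos, le_div_iff₀ (by positivity), ← pow_add]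
      have : r*D + r = r*(D+1) := by ring
      rw [this]
      exact pow_le_pow_left₀ (by positivity) ht _
    exact (mul_nonpos_of_nonneg_of_nonpos hA this).trans (by positivity)
  · have hm := choose_div_pow_mono (q := r*D) hr (Nat.mul_le_mul_left r hH) hh
    have e1 : (r:ℝ) + (r*H:ℕ) = r * ((H:ℝ)+1) := by push_cast; ring
    have e2 : (r:ℝ) + h = r * (1 + (h:ℝ)/r) := by field_simp
    rw [e1, e2, mul_pow, mul_pow, ← div_div, ← div_div, div_right_comm,
      div_right_comm _ ((r:ℝ)^(r*D)), div_le_div_iff_of_pos_right (by positivity)] at hm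
    rw [le_div_iff₀ (by positivity)] at hm
    refine le_trans ?_ hm
    gcongr
    have : 0 ≤ ((H:ℝ)+1)^(r*(D+1))/(1 + (h:ℝ)/r)^r := by positivity
    linarith

theorem ExBound.generic {D k : ℕ} (hD : 1 ≤ D) {G' : ℝ} (hG'0 : 0 ≤ G') (hG' : ExBound D k G')
    {N r H : ℕ} (hN : 2 ≤ N) (hr : 1 ≤ r) (hk : k ≤ r*D + 1) (hH : D ≤ H) {G : ℝ} (hG0 : 0 ≤ G)
    (hG : ((H:ℝ)+1)^(r*(D+1))/(N:ℝ)^(r*D)*G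
      + ((r*(N-1)).choose (r*D):ℝ) / (r*H).choose (r*D)
          * ((N:ℝ)^r * ((H:ℝ)+1)^(r*D) / (N:ℝ)^(r*D)) * G' + (D+1)*(N:ℝ)^r ≤ G) :
    ExBound (D+1) k G := by
  have hc : (0:ℝ) < (r*H).choose (r*D) := by
    exact_mod_cast Nat.choose_pos (Nat.mul_le_mul_left r hH)
  have hNpos : (0:ℝ) < N := by exact_mod_cast (by omega : 0 < N)
  refine ExBound.spine hD hG'0 hG' hN hr (q := r*D) hk
    (A := ((r*H).choose (r*D) : ℝ) / ((H:ℝ)+1)^(r*D)) (B := ((H:ℝ)+1)^(r*(D+1)))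
    (by positivity) (by positivity) (fun h _ => threshold_le_choose hr hH) hG0 ?_
  refine le_trans (le_of_eq ?_) hG
  congr 2
  field_simp

theorem prod_range_mul_eq {f : ℕ → ℝ} (r n : ℕ) :
    ∏ i ∈ range (r*n), f i = ∏ s ∈ range n, ∏ u ∈ range r, f (r*s+u) := by
  induction n with
  | zero => simp
  | succ n ih => rw [Nat.mul_succ, prod_range_add, ih, prod_range_succ]

theorem ratio_mul_ratio_le {a b u v t : ℝ} (hu : 0 ≤ u) (hv : 0 ≤ v) (huv : u + v ≤ t)
    (hb : t < b) (hab : b ≤ a) :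
    (a-u)/(b-u) * ((a-v)/(b-v)) ≤ a/b * ((a-t)/(b-t)) := by
  have h1 : (a-v)/(b-v) ≤ (a-(t-u))/(b-(t-u)) := by
    rw [div_le_div_iff₀ (by linarith) (by linarith)]
    nlinarith
  have h2 : 0 ≤ (a-u)/(b-u) := div_nonneg (by linarith) (by linarith)
  refine (mul_le_mul_of_nonneg_left h1 h2).trans ?_
  rw [div_mul_div_comm, div_mul_div_comm, div_le_div_iff₀
    (mul_pos (by linarith) (by linarith)) (mul_pos (by linarith) (by linarith))]
  have h3 : 0 ≤ u*(t-u) := mul_nonneg hu (by linarith)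
  have h4 : b*(b-t) ≤ a*(a-t) := mul_le_mul hab (by linarith) (by linarith) (by linarith)
  nlinarith [mul_le_mul_of_nonneg_left h4 h3]

theorem sq_prod_ratio_le {a b : ℝ} {r : ℕ} (hb : (r:ℝ) < b) (hab : b ≤ a) :
    (∏ u ∈ range r, (a-u)/(b-u))^2 ≤ (a/b * ((a-r)/(b-r)))^r := by
  rw [sq]
  nth_rw 2 [← prod_range_reflect]
  rw [← prod_mul_distrib]
  calc _ ≤ ∏ u ∈ range r, (a/b * ((a-r)/(b-r))) := by
        refine prod_le_prod (fun u hu => ?_) (fun u hu => ?_)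
        · rw [mem_range] at hu
          have h1 : (u:ℝ) ≤ r := by exact_mod_cast hu.le
          have h2 : ((r-1-u:ℕ):ℝ) ≤ r := by exact_mod_cast (by omega : r-1-u ≤ r)
          exact mul_nonneg (div_nonneg (by linarith) (by linarith))
            (div_nonneg (by linarith) (by linarith))
        · rw [mem_range] at hu
          refine ratio_mul_ratio_le (Nat.cast_nonneg _) (Nat.cast_nonneg _) ?_ hb hab
          exact_mod_cast (by omega : u + (r-1-u) ≤ r)
    _ = _ := by simp

theorem choose_div_choose_eq_prod {a b n : ℕ} (hb : n ≤ b) (hab : b ≤ a) :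
    (a.choose n : ℝ) / b.choose n = ∏ i ∈ range n, ((a:ℝ)-i)/((b:ℝ)-i) := by
  have key : ∀ c : ℕ, n ≤ c → (c.choose n : ℝ) = (∏ i ∈ range n, ((c:ℝ)-i)) / n.factorial := by
    intro c hc
    rw [eq_div_iff (by positivity), mul_comm]
    have h1 : (n.factorial : ℝ) * c.choose n = (c.descFactorial n : ℕ) := by
      rw [Nat.descFactorial_eq_factorial_mul_choose]; push_cast; ring
    rw [h1, Nat.descFactorial_eq_prod_range, Nat.cast_prod]
    refine prod_congr rfl fun i hi => ?_
    rw [mem_range] at hi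
    rw [Nat.cast_sub (by omega)]
  rw [key a (hb.trans hab), key b hb, div_div_div_cancel_right₀ (by positivity), prod_div_distrib]

theorem choose_ratio_sq_le {D r H N : ℕ} (hr : 1 ≤ r) (hH : D + 1 ≤ H) (hN : H + 1 ≤ N) :
    (((r*(N-1)).choose (r*D):ℝ) / (r*H).choose (r*D))^2 ≤
      (((N-1).choose D:ℝ) / H.choose D * (((N-2).choose D:ℝ) / (H-1).choose D))^r := by
  have hr0 : (0:ℝ) < r := by exact_mod_cast hr
  rw [choose_div_choose_eq_prod (Nat.mul_le_mul_left r (by omega))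
      (Nat.mul_le_mul_left r (by omega)), prod_range_mul_eq,
    choose_div_choose_eq_prod (by omega) (by omega),
    choose_div_choose_eq_prod (by omega) (by omega), ← prod_mul_distrib, ← prod_pow, ← prod_pow]
  refine prod_le_prod (fun _ _ => sq_nonneg _) fun s hs => ?_
  rw [mem_range] at hs
  have hs' : (s:ℝ) + 2 ≤ H := by exact_mod_cast (by omega : s + 2 ≤ H)
  have hN' : (H:ℝ) ≤ ((N-1:ℕ):ℝ) := by exact_mod_cast (by omega : H ≤ N-1)
  have := sq_prod_ratio_le (a := r*(((N-1:ℕ):ℝ)-s)) (b := r*((H:ℝ)-s)) (r := r)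
    (by nlinarith) (by nlinarith)
  refine (le_of_eq ?_).trans (this.trans (le_of_eq ?_))
  · congr 1
    refine prod_congr rfl fun u _ => ?_
    push_cast; congr 1 <;> ring
  · congr 1
    have e1 : ((N-2:ℕ):ℝ) = ((N-1:ℕ):ℝ) - 1 := by
      rw [show N-2 = N-1-1 by omega, Nat.cast_sub (by omega : 1 ≤ N-1)]; simp
    have e2 : ((H-1:ℕ):ℝ) = (H:ℝ) - 1 := by
      rw [Nat.cast_sub (by omega)]; simp
    have e3 : (((N-1:ℕ):ℝ) - 1 - s)/((H:ℝ) - 1 - s)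
        = (r*(((N-1:ℕ):ℝ)-s) - r)/(r*((H:ℝ)-s) - r) := by
      rw [← mul_div_mul_left _ _ hr0.ne']
      congr 1 <;> ring
    rw [mul_div_mul_left _ _ hr0.ne', e1, e2, e3]

/-- One dimension costs a factor `E ^ r` for every `r ≥ r₀` with `k ≤ r * D + 1`. -/
theorem ExBound.step {D k : ℕ} (hD : 1 ≤ D) {G' : ℝ} (hG' : ExBound D k G')
    {N H r₀ r : ℕ} (hr₀ : 1 ≤ r₀) (hr : r₀ ≤ r) (hk : k ≤ r*D + 1)
    (hH : D + 1 ≤ H) (hN : H + 1 ≤ N) {w x E : ℝ} (hw : 0 < w) (hw' : w * (D+1) ≤ G') (hx0 : 0 ≤ x)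
    (hρ : ((H:ℝ)+1)^(D+1) ≤ (N:ℝ)^D)
    (hx : ((N-1).choose D:ℝ) / H.choose D * (((N-2).choose D:ℝ) / (H-1).choose D) *
      (N * ((H:ℝ)+1)^D / (N:ℝ)^D)^2 ≤ x^2)
    (hxE : x ≤ E) (hNE : (N:ℝ) ≤ E)
    (hE : x^r₀ + (N:ℝ)^r₀ / w + (((H:ℝ)+1)^(D+1) / (N:ℝ)^D * E)^r₀ ≤ E^r₀) :
    ExBound (D+1) k (E^r * G') := by
  have hN0 : (0:ℝ) < N := by exact_mod_cast (by omega : 0 < N)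
  have hE0 : 0 < E := hN0.trans_le hNE
  have hG'0 : 0 < G' := lt_of_lt_of_le (by positivity) hw'
  set ρ : ℝ := ((H:ℝ)+1)^(D+1) / (N:ℝ)^D with hρdef
  have hρ1 : ρ ≤ 1 := by rw [hρdef, div_le_one (by positivity)]; exact hρ
  have hρ0 : 0 ≤ ρ := by positivity
  have hpow : ∀ y : ℝ, 0 ≤ y → y ≤ E → y^r ≤ y^r₀ * E^(r-r₀) := fun y hy hyE => by
    rw [← Nat.add_sub_of_le hr, pow_add, Nat.add_sub_cancel_left]
    gcongr
  have hE' : x^r + (N:ℝ)^r / w + (ρ * E)^r ≤ E^r := by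
    have h3 := hpow (ρ*E) (by positivity) (mul_le_of_le_one_left hE0.le hρ1)
    have h2 : (N:ℝ)^r / w ≤ (N:ℝ)^r₀ / w * E^(r-r₀) := by
      rw [div_mul_eq_mul_div]; gcongr; exact hpow _ hN0.le hNE
    calc _ ≤ (x^r₀ + (N:ℝ)^r₀ / w + (ρ * E)^r₀) * E^(r-r₀) := by
          linarith [hpow x hx0 hxE]
      _ ≤ E^r₀ * E^(r-r₀) := by gcongr
      _ = E^r := by rw [← pow_add, Nat.add_sub_of_le hr]
  refine ExBound.generic hD hG'0.le hG' (N := N) (H := H) (by omega) (hr₀.trans hr) hk (by omega)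
    (by positivity) ?_
  have hratio : ((r*(N-1)).choose (r*D):ℝ) / (r*H).choose (r*D)
      * ((N:ℝ)^r * ((H:ℝ)+1)^(r*D) / (N:ℝ)^(r*D)) ≤ x^r := by
    refine (pow_le_pow_iff_left₀ (by positivity) (by positivity) two_ne_zero).1 ?_
    have e : (N:ℝ)^r * ((H:ℝ)+1)^(r*D) / (N:ℝ)^(r*D) = (N * ((H:ℝ)+1)^D / (N:ℝ)^D)^r := by
      rw [div_pow, mul_pow, ← pow_mul, ← pow_mul, mul_comm r]
    calc _ ≤ (((N-1).choose D:ℝ) / H.choose D * (((N-2).choose D:ℝ) / (H-1).choose D))^r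
          * ((N * ((H:ℝ)+1)^D / (N:ℝ)^D)^r)^2 := by
          rw [e, mul_pow]
          exact mul_le_mul_of_nonneg_right (choose_ratio_sq_le (hr₀.trans hr) hH hN) (by positivity)
      _ = _ := by rw [← pow_mul, mul_comm r 2, pow_mul, ← mul_pow]
      _ ≤ (x^2)^r := pow_le_pow_left₀ (by positivity) hx _
      _ = _ := by rw [← pow_mul, ← pow_mul, mul_comm]
  have hthird : ((D:ℝ)+1)*(N:ℝ)^r ≤ (N:ℝ)^r / w * G' := by
    rw [div_mul_eq_mul_div, le_div_iff₀ hw]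
    nlinarith [pow_pos hN0 r]
  have hfirst : ((H:ℝ)+1)^(r*(D+1))/(N:ℝ)^(r*D)*(E^r*G') = (ρ*E)^r * G' := by
    rw [hρdef, mul_pow, div_pow, ← pow_mul, ← pow_mul, mul_comm r, mul_comm r]; ring
  rw [hfirst]
  nlinarith [mul_le_mul_of_nonneg_right hratio hG'0.le, mul_le_mul_of_nonneg_right hE' hG'0.le]

/-- The version of the inductive step that discards all nontrivial blocks at once. -/
theorem ExBound.step_coarse {D k : ℕ} (hD : 1 ≤ D) (hk : 2 ≤ k) (hDk : k^2 ≤ D) {G' : ℝ}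
    (hG' : ExBound D k G') (hG'd : (D:ℝ) + 1 ≤ G') : ExBound (D+1) k (4*k*G') := by
  have hD0 : (0:ℝ) ≤ D := D.cast_nonneg
  have hk0 : (0:ℝ) < k := by exact_mod_cast (by omega : 0 < k)
  have hsmall : 2 * ((k:ℝ)-1)^(D+1) ≤ (k:ℝ)^D := by
    obtain ⟨n, rfl⟩ : ∃ n, k = n+2 := ⟨k-2, by omega⟩
    have h1 : (2:ℝ) ≤ (1 + 1/((n:ℝ)+1))^(n+2) := by
      have h2 := one_add_mul_le_pow (a := 1/((n:ℝ)+1)) (by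
        have : 0 ≤ 1/((n:ℝ)+1) := by positivity
        linarith) (n+2)
      refine le_trans ?_ h2
      push_cast
      have : ((n:ℝ)+2) * (1/((n:ℝ)+1)) = 1 + 1/((n:ℝ)+1) := by field_simp; ring
      rw [this]
      have : 0 ≤ 1/((n:ℝ)+1) := by positivity
      linarith
    have h3 : (2:ℝ)*(n+1) ≤ 2^(n+2) := by
      have : n + 1 ≤ 2^n := Nat.lt_two_pow_self
      have : ((n:ℝ)+1) ≤ 2^n := by exact_mod_cast this
      rw [pow_add]; nlinarith
    have h4 : (2:ℝ)*(n+1) ≤ (1 + 1/((n:ℝ)+1))^D := by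
      have h5 : (1:ℝ) ≤ 1 + 1/((n:ℝ)+1) := by
        have : 0 ≤ 1/((n:ℝ)+1) := by positivity
        linarith
      calc (2:ℝ)*(n+1) ≤ 2^(n+2) := h3
        _ ≤ ((1 + 1/((n:ℝ)+1))^(n+2))^(n+2) := by gcongr
        _ = (1 + 1/((n:ℝ)+1))^((n+2)^2) := by rw [← pow_mul, sq]
        _ ≤ _ := pow_le_pow_right₀ h5 hDk
    have e1 : (1 + 1/((n:ℝ)+1)) = (n+2)/(n+1) := by field_simp; ring
    have e2 : (((n+2:ℕ):ℝ)-1) = n+1 := by push_cast; ring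
    rw [e1, div_pow, le_div_iff₀ (by positivity)] at h4
    rw [e2, pow_succ]; push_cast; linarith
  refine ExBound.spine hD (by linarith) hG' hk le_rfl (q := k-1) (by omega)
    (A := ((k:ℝ)^D)⁻¹) (B := ((k:ℝ)-1)^(D+1)) (by positivity) ?_ ?_ (by
      have : 0 ≤ G' := by linarith
      positivity) ?_
  · have : (1:ℝ) ≤ k := by exact_mod_cast (by omega : 1 ≤ k)
    exact pow_nonneg (by linarith) _
  · intro h hh
    have h0 : (0:ℝ) ≤ h := h.cast_nonneg
    rw [Nat.cast_one, div_one, one_mul, pow_one]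
    rcases (show h + 2 ≤ k ∨ h = k-1 by omega) with hlt | rfl
    · refine le_trans (mul_nonpos_of_nonneg_of_nonpos (by positivity) ?_) (Nat.cast_nonneg _)
      rw [sub_nonpos, le_div_iff₀ (by positivity), ← pow_succ]
      have : (h:ℝ) + 2 ≤ k := by exact_mod_cast hlt
      exact pow_le_pow_left₀ (by positivity) (by linarith) _
    · rw [Nat.choose_self, Nat.cast_one, inv_mul_le_iff₀ (by positivity), mul_one]
      have e : 1 + ((k-1:ℕ):ℝ) = k := by rw [Nat.cast_sub (by omega)]; simp
      rw [e]
      have : 0 ≤ ((k:ℝ)-1)^(D+1)/k := div_nonneg (pow_nonneg (by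
        have : (1:ℝ) ≤ k := by exact_mod_cast (by omega : 1 ≤ k)
        linarith) _) hk0.le
      linarith
  · rw [one_mul, one_mul, Nat.choose_self, inv_mul_cancel₀ (by positivity), pow_one]
    have h1 : ((k:ℝ)-1)^(D+1) / (k:ℝ)^D ≤ 1/2 := by
      rw [div_le_iff₀ (by positivity)]; linarith
    have hG0 : 0 ≤ 4*k*G' := by
      have : 0 ≤ G' := by linarith
      positivity
    push_cast
    nlinarith [mul_le_mul_of_nonneg_right h1 hG0, mul_le_mul_of_nonneg_right hG'd hk0.le]

/-- The side length `⌈k ^ (d / (d - 1))⌉` for `d = D + 1`. -/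
noncomputable def sideLen (k D : ℕ) : ℕ :=
  ⌈(k : ℝ) ^ (((D + 1 : ℕ) : ℝ) / (((D + 1 : ℕ) : ℝ) - 1))⌉₊

/-- The constant of the main bound in dimension `D + 1`. -/
noncomputable def target (k D : ℕ) : ℕ :=
  k ^ (D + 1) * ((D + 1) * sideLen k D * (sideLen k D + 1).choose k) ^ D

theorem sideLen_eq (k : ℕ) {D : ℕ} (hD : 1 ≤ D) (hk : 1 ≤ k) :
    sideLen k D = ⌈(k : ℝ) * (k : ℝ) ^ ((D : ℝ)⁻¹)⌉₊ := by
  have hD0 : (0:ℝ) < D := by exact_mod_cast hD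
  have hk0 : (0:ℝ) < k := by exact_mod_cast hk
  rw [sideLen]
  congr 1
  rw [show ((D + 1 : ℕ) : ℝ) / (((D + 1 : ℕ) : ℝ) - 1) = 1 + (D:ℝ)⁻¹ by
    push_cast
    rw [add_sub_cancel_right, add_div, div_self hD0.ne', one_div], Real.rpow_add hk0, Real.rpow_one]

theorem mul_rpow_le_sideLen {k D : ℕ} (hD : 1 ≤ D) (hk : 1 ≤ k) :
    (k : ℝ) * (k : ℝ) ^ ((D : ℝ)⁻¹) ≤ sideLen k D := by
  rw [sideLen_eq k hD hk]; exact Nat.le_ceil _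

theorem one_le_rpow_inv {k D : ℕ} (hk : 1 ≤ k) : (1:ℝ) ≤ (k : ℝ) ^ ((D : ℝ)⁻¹) :=
  Real.one_le_rpow (by exact_mod_cast hk) (by positivity)

theorem le_sideLen {k D : ℕ} (hD : 1 ≤ D) (hk : 1 ≤ k) : k ≤ sideLen k D := by
  have h1 := mul_rpow_le_sideLen hD hk
  have h2 := one_le_rpow_inv (D := D) hk
  have : (k:ℝ) ≤ sideLen k D := le_trans (le_mul_of_one_le_right k.cast_nonneg h2) h1
  exact_mod_cast this

theorem lt_sideLen_of_pow_lt {k D m : ℕ} (hD : 1 ≤ D) (hk : 1 ≤ k) (h : m ^ D < k ^ (D + 1)) :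
    m < sideLen k D := by
  by_contra! hle
  have h1 := mul_rpow_le_sideLen hD hk
  have h2 : (k : ℝ) * (k : ℝ) ^ ((D : ℝ)⁻¹) ≤ m := h1.trans (by exact_mod_cast hle)
  have h3 := pow_le_pow_left₀ (by positivity) h2 D
  rw [mul_pow, Real.rpow_inv_natCast_pow k.cast_nonneg (by omega), ← pow_succ] at h3
  have : k ^ (D+1) ≤ m ^ D := by exact_mod_cast h3
  omega

theorem sideLen_add_one_le (k : ℕ) {D : ℕ} (hD : 1 ≤ D) (hk : 1 ≤ k) :
    sideLen k D + 1 ≤ sideLen (k+1) D := by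
  rw [sideLen_eq k hD hk, Nat.succ_le_iff, Nat.lt_iff_add_one_le, ← Nat.ceil_add_one (by positivity)]
  rw [sideLen_eq (k+1) hD (by omega)]
  refine Nat.ceil_mono ?_
  have h1 : (k : ℝ) ^ ((D : ℝ)⁻¹) ≤ ((k+1:ℕ) : ℝ) ^ ((D : ℝ)⁻¹) :=
    Real.rpow_le_rpow k.cast_nonneg (by push_cast; linarith) (by positivity)
  have h2 := one_le_rpow_inv (D := D) (k := k+1) (by omega)
  push_cast at *
  nlinarith [(Nat.cast_nonneg k : (0:ℝ) ≤ k)]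

theorem target_mono {k k' : ℕ} (D : ℕ) (hk : 1 ≤ k) (h : k ≤ k') : target k D ≤ target k' D := by
  rcases Nat.eq_zero_or_pos D with rfl | hD
  · simpa [target] using h
  induction k', h using Nat.le_induction with
  | base => rfl
  | succ a ha ih =>
    refine ih.trans ?_
    have h1 := sideLen_add_one_le a hD (hk.trans ha)
    have h2 : (sideLen a D + 1).choose a ≤ (sideLen (a+1) D + 1).choose (a+1) :=
      calc _ ≤ (sideLen a D + 1).choose a + (sideLen a D + 1).choose (a+1) := Nat.le_add_right _ _
        _ = (sideLen a D + 1 + 1).choose (a+1) := (Nat.choose_succ_succ _ _).symm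
        _ ≤ _ := Nat.choose_le_choose _ (by omega)
    unfold target
    gcongr <;> omega

theorem factorial_le_stirling {n : ℕ} (hn : 1 ≤ n) :
    (n.factorial : ℝ) ≤ Real.exp 1 * √n * (n / Real.exp 1)^n := by
  obtain ⟨m, rfl⟩ : ∃ m, n = m+1 := ⟨n-1, by omega⟩
  have h := Stirling.stirlingSeq'_antitone (Nat.zero_le m)
  simp only [Function.comp] at h
  rw [show Nat.succ 0 = 1 from rfl, Stirling.stirlingSeq_one, Stirling.stirlingSeq,
    div_le_iff₀ (by positivity)] at h
  refine h.trans (le_of_eq ?_)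
  rw [Nat.succ_eq_add_one, Real.sqrt_mul (by norm_num)]
  field_simp

theorem sq_pow_self_le_choose {M k : ℕ} (hk : 1 ≤ k) (hkM : k < M) :
    (M:ℝ) * ((M:ℝ)^M)^2 ≤
      9 * k * (M-k:ℕ) * ((k:ℝ)^k * ((M-k:ℕ):ℝ)^(M-k))^2 * (M.choose k : ℝ)^2 := by
  set y := M - k with hy
  have hMy : M = k + y := by omega
  have hy1 : 1 ≤ y := by omega
  have h1 := factorial_le_stirling hk
  have h2 := factorial_le_stirling hy1
  have h3 := Stirling.le_factorial_stirling M
  have h4 : (M.factorial : ℝ) = M.choose k * k.factorial * y.factorial := by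
    have := Nat.choose_mul_factorial_mul_factorial hkM.le
    rw [← hy] at this; exact_mod_cast this.symm
  have h5 : √(2 * Real.pi * M) * (M / Real.exp 1) ^ M ≤ M.choose k *
      (Real.exp 1 * √k * (k / Real.exp 1)^k) * (Real.exp 1 * √y * (y / Real.exp 1)^y) := by
    rw [h4] at h3
    refine h3.trans ?_
    gcongr
  have h6 := pow_le_pow_left₀ (by positivity) h5 2
  have he : Real.exp 1 ^ M = Real.exp 1 ^ k * Real.exp 1 ^ y := by rw [hMy, pow_add]
  have hk0 : (0:ℝ) ≤ k := k.cast_nonneg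
  have hy0 : (0:ℝ) ≤ y := y.cast_nonneg
  have hM0 : (0:ℝ) ≤ M := M.cast_nonneg
  simp only [mul_pow, div_pow] at h6 ⊢
  rw [Real.sq_sqrt (by positivity), Real.sq_sqrt hk0, Real.sq_sqrt hy0, he] at h6
  have hE := Real.exp_pos 1
  set e := Real.exp 1
  have h7 : 2 * Real.pi * (M * ((M:ℝ)^M)^2) ≤
      e^4 * (k * y * (((k:ℝ)^k)^2 * ((y:ℝ)^y)^2) * (M.choose k : ℝ)^2) := by
    have hpos : 0 < (e^k * e^y)^2 := by positivity
    refine le_of_mul_le_mul_right ?_ (inv_pos.2 hpos)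
    refine (le_of_eq ?_).trans (h6.trans (le_of_eq ?_)) <;> field_simp
  have h8 : e^4 ≤ 9 * (2 * Real.pi) := by
    have := Real.exp_one_lt_d9
    have h9 := Real.pi_gt_d6
    have : e^4 ≤ 2.7182818286^4 := pow_le_pow_left₀ hE.le this.le 4
    norm_num at this
    linarith
  have hpi := Real.pi_pos
  have hX : 0 ≤ k * y * (((k:ℝ)^k)^2 * ((y:ℝ)^y)^2) * (M.choose k : ℝ)^2 := by positivity
  refine le_of_mul_le_mul_left (h7.trans ((mul_le_mul_of_nonneg_right h8 hX).trans (le_of_eq ?_)))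
    (by positivity : 0 < 2 * Real.pi)
  ring

theorem exBound_self_one {k : ℕ} : ExBound 1 k k := by
  intro P _ n M hM
  rw [Nat.sub_self, pow_zero, mul_one]
  norm_cast
  by_contra! hk
  have hinj : Function.Injective fun y : Fin 1 → Fin n => y 0 := fun y z h => by
    funext i
    rw [Subsingleton.elim i 0]
    exact h
  have hS : k ≤ (M.image fun y => y 0).card := by
    rw [Finset.card_image_of_injective _ hinj]
    exact hk.le
  refine hM ⟨fun _ => (M.image fun y => y 0).orderEmbOfCardLe hS,
    fun _ => OrderEmbedding.strictMono _, fun e _ => ?_⟩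
  obtain ⟨y, hy, hye⟩ := Finset.mem_image.1 (Finset.orderEmbOfCardLe_mem _ hS (e 0))
  have : (fun i => (M.image fun y => y 0).orderEmbOfCardLe hS (e i)) = y := by
    funext i
    rw [Subsingleton.elim i 0]
    exact hye.symm
  exact this ▸ hy

theorem exBound_one_right (d : ℕ) : ExBound d 1 0 := by
  intro P _ n M hM
  rw [zero_mul]
  norm_cast
  rw [Nat.le_zero, Finset.card_eq_zero, Finset.eq_empty_iff_forall_notMem]
  intro y hy
  refine hM ⟨fun i _ => y i, fun i => Subsingleton.strictMono _, fun e _ => hy⟩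

/-- The lower bound required of the previous constant, relative to the dimension. -/
def stepWeight (D : ℕ) : ℕ := if D = 1 then 1 else 16

/-- `E ^ r` is an admissible factor for passing from dimension `D` to `D + 1`. -/
def StepGood (D r E : ℕ) : Prop :=
  ∀ (k : ℕ) (G : ℝ), 1 ≤ k → k ≤ r * D + 1 → ExBound D k G →
    ((stepWeight D * (D + 1) : ℕ) : ℝ) ≤ G → ExBound (D + 1) k ((E : ℝ) ^ r * G)

/-- Parameters `(c, N, v, x, E)` of a dimension step that is usable for all exponents `r ≥ c`. -/
abbrev StepEntry := ℕ × ℕ × ℕ × ℕ × ℕ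

/-- Verification of the parameters of a step from dimension `D` to `D + 1`. -/
def entryCheck (D : ℕ) : StepEntry → Bool
  | (c, N, v, x, E) =>
    Nat.ble 1 D && Nat.ble 1 c && Nat.ble (D + 2) v && Nat.ble (v + 1) N &&
    Nat.ble (v ^ (D + 1)) (N ^ D) &&
    Nat.ble (N ^ 2 * (N - 1).descFactorial D * (N - 2).descFactorial D * v ^ (2 * D))
      (x ^ 2 * (v - 1).descFactorial D * (v - 2).descFactorial D * N ^ (2 * D)) &&
    Nat.ble x E && Nat.ble N E &&
    Nat.ble (stepWeight D * (x ^ c * N ^ (D * c) + (v ^ (D + 1) * E) ^ c) + N ^ c * N ^ (D * c))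
      (stepWeight D * E ^ c * N ^ (D * c))

theorem stepWeight_pos (D : ℕ) : 0 < stepWeight D := by unfold stepWeight; split <;> norm_num

theorem StepGood.of_entryCheck {D c N v x E r : ℕ} (h : entryCheck D (c, N, v, x, E) = true)
    (hr : c ≤ r) : StepGood D r E := by
  simp only [entryCheck, Bool.and_eq_true, Nat.ble_eq] at h
  obtain ⟨⟨⟨⟨⟨⟨⟨⟨hD, hc⟩, hv⟩, hN⟩, hρ⟩, hx⟩, hxE⟩, hNE⟩, hE⟩ := h
  obtain ⟨H, rfl⟩ : ∃ H, v = H + 1 := ⟨v - 1, by omega⟩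
  intro k G _ hk hG hw
  have hN0 : (0:ℝ) < N := by exact_mod_cast (by omega : 0 < N)
  have hw0 := stepWeight_pos D
  set w := stepWeight D
  have hwr : (0:ℝ) < w := by exact_mod_cast hw0
  refine hG.step hD hc hr hk (H := H) (N := N) (x := x) (E := E) (w := w) (by omega) (by omega)
    hwr (by exact_mod_cast hw) (by positivity) (by exact_mod_cast hρ) ?_
    (by exact_mod_cast hxE) (by exact_mod_cast hNE) ?_
  · have h1 : (0:ℝ) < (H.descFactorial D : ℝ) := by
      exact_mod_cast Nat.descFactorial_pos.2 (by omega)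
    have h2 : (0:ℝ) < ((H-1).descFactorial D : ℝ) := by
      exact_mod_cast Nat.descFactorial_pos.2 (by omega)
    have e1 : ∀ a : ℕ, (a.choose D : ℝ) = a.descFactorial D / D.factorial := by
      intro a
      rw [Nat.descFactorial_eq_factorial_mul_choose]
      push_cast
      field_simp
    simp only [e1]
    have hx' : ((N:ℝ) ^ 2 * (N - 1).descFactorial D * (N - 2).descFactorial D * (H+1:ℝ) ^ (2 * D))
      ≤ (x:ℝ) ^ 2 * H.descFactorial D * (H-1).descFactorial D * (N:ℝ) ^ (2 * D) := by
      exact_mod_cast hx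
    have hf : (0:ℝ) < D.factorial := by positivity
    have : ((N - 1).descFactorial D / D.factorial : ℝ) / (H.descFactorial D / D.factorial)
        * ((N - 2).descFactorial D / D.factorial / ((H-1).descFactorial D / D.factorial))
        * (N * ((H:ℝ)+1)^D / (N:ℝ)^D)^2 =
        ((N:ℝ) ^ 2 * (N - 1).descFactorial D * (N - 2).descFactorial D * (H+1:ℝ) ^ (2 * D)) /
          (H.descFactorial D * (H-1).descFactorial D * (N:ℝ) ^ (2 * D)) := by
      rw [mul_comm 2 D, pow_mul, pow_mul]
      field_simp
    rw [this, div_le_iff₀ (by positivity)]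
    linarith
  · have hE' : (w:ℝ) * ((x:ℝ) ^ c * (N:ℝ) ^ (D * c) + (((H:ℝ)+1) ^ (D + 1) * E) ^ c)
      + (N:ℝ) ^ c * (N:ℝ) ^ (D * c) ≤ w * (E:ℝ) ^ c * (N:ℝ) ^ (D * c) := by exact_mod_cast hE
    have hp : (0:ℝ) < w * (N:ℝ)^(D*c) := by positivity
    refine le_of_mul_le_mul_right (le_trans (le_of_eq ?_) (hE'.trans (le_of_eq ?_))) hp
    · rw [div_mul_eq_mul_div, div_pow, pow_mul]
      field_simp
      ring
    · ring

/-- The factor of the last entry of a row with class at most `r`. -/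
def pickFactor (r : ℕ) : ℕ → List StepEntry → ℕ
  | b, [] => b
  | b, (c, _, _, _, E) :: t => pickFactor r (bif Nat.ble c r then E else b) t

theorem StepGood.of_pickFactor {D r r' : ℕ} (hr : r ≤ r') {row : List StepEntry}
    (h : row.all (entryCheck D) = true) {b : ℕ} (hb : b = 0 ∨ StepGood D r' b) :
    pickFactor r b row = 0 ∨ StepGood D r' (pickFactor r b row) := by
  induction row generalizing b with
  | nil => exact hb
  | cons a t ih =>
    obtain ⟨c, N, v, x, E⟩ := a
    rw [List.all_cons, Bool.and_eq_true] at h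
    refine ih h.2 ?_
    cases hc : Nat.ble c r with
    | true => exact .inr (.of_entryCheck h.1 (le_trans (by simpa using hc) hr))
    | false => exact hb

/-- All entries of the rows for the steps from dimensions `D`, `D + 1`, … are valid. -/
def tableCheck : ℕ → List (List StepEntry) → Bool
  | _, [] => true
  | D, row :: rows => row.all (entryCheck D) && tableCheck (D + 1) rows

/-- Evaluation of `f` at `n`, written so that kernel reduction computes `n` first. -/
noncomputable def forceNat {α : Type} (n : ℕ) (f : ℕ → α) : α :=
  Nat.rec (f 0) (fun n _ => f (Nat.succ n)) n

theorem forceNat_eq {α : Type} (n : ℕ) (f : ℕ → α) : forceNat n f = f n := by cases n <;> rfl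

/-- Binary search with `j` bits, starting from `a`, for the largest `a` satisfying `p`. -/
noncomputable def bitSearch (p : ℕ → Bool) (j : ℕ) : ℕ → ℕ :=
  Nat.rec (fun a => a) (fun j ih a => forceNat (Nat.add a (Nat.pow 2 j)) fun b =>
    Bool.rec (ih a) (ih b) (p b)) j

theorem bitSearch_succ (p : ℕ → Bool) (j a : ℕ) :
    bitSearch p (j + 1) a = bif p (a + 2 ^ j) then bitSearch p j (a + 2 ^ j)
      else bitSearch p j a := by
  have : bitSearch p (j + 1) a = forceNat (a + 2 ^ j) fun b =>
    Bool.rec (bitSearch p j a) (bitSearch p j b) (p b) := rfl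
  rw [this, forceNat_eq]
  cases p (a + 2 ^ j) <;> rfl

theorem bitSearch_spec {p : ℕ → Bool} : ∀ (j : ℕ) {a : ℕ}, p a = true → p (bitSearch p j a) = true
  | 0, _, h => h
  | j + 1, a, h => by
    rw [bitSearch_succ]
    cases hc : p (a + 2 ^ j) with
    | true => exact bitSearch_spec j hc
    | false => exact bitSearch_spec j h

theorem pow_le_choose_of_mul_le {M k q : ℕ} (h : q * k ≤ M + 1 - k) : q ^ k ≤ M.choose k := by
  have h1 : (M + 1 - k) ^ k ≤ k.factorial * M.choose k := by
    have := (div_le_iff₀' (by positivity)).1 (Nat.pow_le_choose k M (α := ℚ))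
    exact_mod_cast this
  refine Nat.le_of_mul_le_mul_left ?_ k.factorial_pos
  calc k.factorial * q ^ k ≤ k ^ k * q ^ k := Nat.mul_le_mul_right _ (Nat.factorial_le_pow k)
    _ = (q * k) ^ k := by rw [mul_pow, mul_comm]
    _ ≤ (M + 1 - k) ^ k := Nat.pow_le_pow_left h k
    _ ≤ _ := h1

/-- A lower bound for the square of `M.choose k`. -/
def chooseSqLower (M k : ℕ) : ℕ :=
  bif Nat.ble (Nat.mul 256 k) M then Nat.pow (Nat.div (M + 1 - k) k) (2 * k)
  else Nat.div (Nat.pow M (2 * M + 1))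
    (Nat.mul (9 * k * (M - k)) (Nat.mul (Nat.pow k (2 * k)) (Nat.pow (M - k) (2 * (M - k)))))

theorem chooseSqLower_le {M k : ℕ} (hk : 1 ≤ k) : chooseSqLower M k ≤ (M.choose k) ^ 2 := by
  unfold chooseSqLower
  cases Nat.ble (Nat.mul 256 k) M with
  | true =>
    change ((M + 1 - k) / k) ^ (2 * k) ≤ _
    rw [mul_comm 2 k, pow_mul]
    exact Nat.pow_le_pow_left (pow_le_choose_of_mul_le (Nat.div_mul_le_self _ _)) 2
  | false =>
    change M ^ (2 * M + 1) / (9 * k * (M - k) * (k ^ (2 * k) * (M - k) ^ (2 * (M - k)))) ≤ _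
    rcases lt_or_ge k M with hkM | hkM
    · refine Nat.div_le_of_le_mul ?_
      have h := sq_pow_self_le_choose hk hkM
      have h' : M * (M ^ M) ^ 2 ≤
          9 * k * (M - k) * (k ^ k * (M - k) ^ (M - k)) ^ 2 * (M.choose k) ^ 2 := by exact_mod_cast h
      calc M ^ (2 * M + 1) = M * (M ^ M) ^ 2 := by ring
        _ ≤ _ := h'
        _ = 9 * k * (M - k) * (k ^ (2 * k) * (M - k) ^ (2 * (M - k))) * (M.choose k) ^ 2 := by ring
    · simp [Nat.sub_eq_zero_of_le hkM]

/-- A lower bound for `(target k D / k) ^ (2 / D)` when `m ≤ sideLen k D`. -/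
def targetBase (k D m : ℕ) : ℕ :=
  Nat.mul (Nat.pow (k * (D + 1) * m) 2) (chooseSqLower (m + 1) k)

/-- A lower bound for the square of `target k D`; the argument `b` bounds the effort spent on
approximating `sideLen k D`. -/
noncomputable def targetSqLower (b k D : ℕ) : ℕ :=
  forceNat (Nat.pow k (D + 1)) fun K =>
  forceNat (bitSearch (fun m => Nat.blt (Nat.pow m D) K) b k + 1) fun m =>
  Nat.mul (Nat.pow k 2) (Nat.pow (targetBase k D m) D)

theorem targetSqLower_le {b k D : ℕ} (hk : 2 ≤ k) (hD : 1 ≤ D) :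
    targetSqLower b k D ≤ (target k D) ^ 2 := by
  have hroot := bitSearch_spec (p := fun m => Nat.blt (m ^ D) (k ^ (D + 1))) b (a := k)
    (by rw [Nat.blt_eq]; exact Nat.pow_lt_pow_right (by omega) (by omega))
  have hdef : targetSqLower b k D = k ^ 2 * (targetBase k D
      (bitSearch (fun m => Nat.blt (m ^ D) (k ^ (D + 1))) b k + 1)) ^ D := by
    rw [targetSqLower, forceNat_eq, forceNat_eq]
    rfl
  have hbase : ∀ m, targetBase k D m = (k * (D + 1) * m) ^ 2 * chooseSqLower (m + 1) k :=
    fun _ => rfl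
  rw [hdef, hbase]
  generalize bitSearch (fun m => Nat.blt (m ^ D) (k ^ (D + 1))) b k = m₀ at hroot ⊢
  rw [Nat.blt_eq] at hroot
  have hm := lt_sideLen_of_pow_lt hD (by omega) hroot
  have hC : chooseSqLower (m₀ + 1 + 1) k ≤ ((sideLen k D + 1).choose k) ^ 2 :=
    (chooseSqLower_le (by omega)).trans
      (Nat.pow_le_pow_left (Nat.choose_le_choose _ (by omega)) 2)
  calc _ ≤ k ^ 2 * ((k * (D + 1) * sideLen k D) ^ 2 * ((sideLen k D + 1).choose k) ^ 2) ^ D := by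
        gcongr; omega
    _ = _ := by
      have e : k * (D + 1) * sideLen k D * (sideLen k D + 1).choose k =
        k * ((D + 1) * sideLen k D * (sideLen k D + 1).choose k) := by ring
      rw [target, ← mul_pow _ _ 2, e, ← pow_mul, mul_comm 2 D, pow_mul, ← mul_pow, mul_pow k _ D,
        pow_succ k D, mul_comm (k ^ D) k, mul_assoc k (k ^ D)]

/-- An upper bound, valid for `k₁ ≤ k ≤ k₂`, for the constant reached in dimension `256`: the
exponent of two approximates `logTarget k 255` from below, and `k₁ ≤ 2` is treated separately. -/
def finalBound (k₁ k₂ : ℕ) : ℕ :=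
  bif Nat.ble k₁ 2 then 2 ^ 256 * 4608 ^ 255 else
    2 ^ ((2 * k₁ * Nat.log2 (k₁ ^ 64) + (2 * k₁ * Nat.log2 (k₁ ^ 64) * 1083 / 100000 + 765) *
      Nat.log2 ((163200000 * k₁ + (6932 * (Nat.log2 (k₂ ^ 64) + 1) * k₁ + 163200000)) ^ 64 /
        (6932 * (Nat.log2 (k₂ ^ 64) + 1) * k₁ + 163200000) ^ 64) +
      769 * Nat.log2 (k₁ ^ 64) + 209100) / 128)

/-- Simultaneous check of `target k₁` against the product of the step factors for `k₂`. -/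
noncomputable def chunkCheck (b k₁ k₂ : ℕ) : ℕ → ℕ → List (List StepEntry) → Bool
  | _, g, [] => Nat.ble g (finalBound k₁ k₂)
  | D, g, row :: rows =>
    forceNat D fun D => forceNat (Nat.div (k₂ - 2) D + 1) fun r =>
    forceNat (pickFactor r 0 row) fun E => forceNat (Nat.mul (Nat.pow E r) g) fun g' =>
    Nat.ble 1 E && Nat.ble (stepWeight D * (D + 1)) g &&
      Nat.ble (Nat.pow g' 2) (targetSqLower (Nat.add b (Nat.div b D)) k₁ D) &&
      chunkCheck b k₁ k₂ (D + 1) g' rows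

theorem exBound_target_of_chunkCheck {b k₁ k₂ : ℕ} (hk₁ : 2 ≤ k₁) {k : ℕ}
    (hk : k₁ ≤ k) (hk₂ : k ≤ k₂) {rows : List (List StepEntry)} :
    ∀ {D g : ℕ}, 1 ≤ D → tableCheck D rows = true → chunkCheck b k₁ k₂ D g rows = true →
      ExBound D k g → (∀ i < rows.length, ExBound (D + i + 1) k (target k (D + i))) ∧
        ExBound (D + rows.length) k (finalBound k₁ k₂) := by
  induction rows with
  | nil =>
    intro D g _ _ hc hG
    refine ⟨fun i hi => by simp at hi, hG.mono ?_⟩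
    rw [chunkCheck, Nat.ble_eq] at hc
    exact_mod_cast hc
  | cons row rows ih =>
    intro D g hD ht hc hG
    simp only [tableCheck, Bool.and_eq_true] at ht
    simp only [chunkCheck, forceNat_eq, Bool.and_eq_true, Nat.ble_eq] at hc
    obtain ⟨⟨⟨hE, hw⟩, htl⟩, hrec⟩ := hc
    obtain ⟨r, hr⟩ : ∃ r, r = (k₂ - 2) / D + 1 := ⟨_, rfl⟩
    change 1 ≤ pickFactor ((k₂ - 2) / D + 1) 0 row at hE
    change (pickFactor ((k₂ - 2) / D + 1) 0 row ^ ((k₂ - 2) / D + 1) * g) ^ 2 ≤ _ at htl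
    change chunkCheck b k₁ k₂ (D + 1)
      (pickFactor ((k₂ - 2) / D + 1) 0 row ^ ((k₂ - 2) / D + 1) * g) rows = true at hrec
    rw [← hr] at hE htl hrec
    rcases StepGood.of_pickFactor (le_refl r) ht.1 (b := 0) (.inl rfl) with h0 | hgood
    · omega
    generalize pickFactor r 0 row = E at *
    have hkr : k ≤ r * D + 1 := by
      have := Nat.div_add_mod (k₂ - 2) D
      have := Nat.mod_lt (k₂ - 2) (by omega : D > 0)
      have h2 : r * D = D * ((k₂ - 2) / D) + D := by rw [hr]; ring
      omega
    have hG' : ExBound (D + 1) k ((E ^ r * g : ℕ) : ℝ) := by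
      have := hgood k _ (by omega) hkr hG (by exact_mod_cast hw)
      exact_mod_cast this
    obtain ⟨ih₁, ih₂⟩ := ih (D := D + 1) (by omega) ht.2 hrec hG'
    refine ⟨fun i hi => ?_, by rwa [List.length_cons, Nat.add_comm rows.length, ← Nat.add_assoc]⟩
    rcases Nat.eq_zero_or_pos i with rfl | hi0
    · refine hG'.mono ?_
      have h1 : (E ^ r * g) ^ 2 ≤ (target k D) ^ 2 :=
        htl.trans ((targetSqLower_le hk₁ hD).trans
          (Nat.pow_le_pow_left (target_mono D (by omega) hk) _))
      exact_mod_cast le_of_pow_le_pow_left₀ (by norm_num) (by positivity) h1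
    · have := ih₁ (i - 1) (by simp at hi; omega)
      rwa [show D + 1 + (i - 1) = D + i by omega] at this

/-- Step parameters for the dimensions `1, 2, …, 255`. -/
def stepTable : List (List StepEntry) := [
  [(1, 17, 3, 33, 107), (2, 12, 3, 23, 40), (4, 11, 3, 21, 25)],
  [(1, 12, 4, 39, 72), (2, 10, 4, 30, 40), (4, 9, 4, 25, 29)],
  [(1, 19, 7, 51, 81), (2, 13, 6, 39, 49), (4, 12, 6, 34, 38)],
  [(1, 21, 9, 63, 93), (2, 18, 9, 48, 59), (4, 17, 9, 43, 47)],
  [(1, 26, 12, 76, 104), (2, 20, 11, 57, 69), (4, 19, 11, 51, 56)],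
  [(1, 30, 15, 88, 118), (2, 24, 14, 66, 80), (4, 21, 13, 59, 65)],
  [(1, 36, 19, 100, 131), (2, 26, 16, 76, 91), (4, 23, 15, 67, 74)],
  [(1, 37, 21, 109, 144), (2, 32, 20, 89, 101), (4, 27, 18, 78, 84)],
  [(1, 42, 25, 118, 158), (2, 37, 24, 97, 112), (4, 32, 22, 84, 93)],
  [(1, 50, 30, 137, 172), (2, 37, 25, 106, 123), (4, 34, 24, 94, 103)],
  [(1, 49, 31, 146, 187), (2, 42, 29, 116, 134), (4, 36, 26, 104, 113)],
  [(1, 54, 35, 158, 200), (2, 47, 33, 127, 145), (4, 44, 32, 114, 123)],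
  [(1, 59, 39, 172, 215), (2, 52, 37, 139, 156), (4, 46, 34, 125, 133)],
  [(1, 65, 44, 182, 229), (2, 52, 38, 148, 169), (4, 48, 36, 137, 144)],
  [(1, 73, 50, 196, 243), (2, 57, 42, 161, 180), (4, 51, 39, 143, 154)],
  [(1, 74, 52, 206, 259), (2, 60, 45, 170, 192), (4, 57, 44, 152, 163)],
  [(1, 77, 55, 218, 272), (2, 66, 50, 180, 202), (4, 63, 49, 163, 174)],
  [(1, 85, 61, 236, 286), (2, 69, 53, 190, 215), (4, 65, 51, 175, 184)],
  [(1, 88, 64, 250, 301), (2, 74, 57, 206, 226), (4, 68, 54, 183, 195)],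
  [(1, 92, 68, 260, 317), (2, 77, 60, 216, 238), (4, 70, 56, 196, 206)],
  [(1, 96, 72, 269, 332), (2, 80, 63, 226, 250), (4, 77, 62, 205, 216)],
  [(1, 101, 76, 289, 346), (2, 91, 72, 237, 262), (4, 80, 65, 213, 226)],
  [(1, 105, 80, 299, 362), (2, 94, 75, 247, 273), (4, 82, 67, 226, 237)],
  [(1, 111, 85, 316, 376), (2, 93, 75, 257, 286), (4, 85, 70, 235, 249)],
  [(1, 115, 89, 327, 392), (2, 99, 80, 274, 299), (4, 92, 76, 247, 259)],
  [(1, 122, 95, 341, 407), (2, 103, 84, 281, 311), (4, 95, 79, 256, 270)],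
  [(1, 126, 99, 352, 422), (2, 110, 90, 294, 323), (4, 102, 85, 269, 280)],
  [(1, 133, 105, 367, 437), (2, 109, 90, 303, 336), (4, 105, 88, 279, 291)],
  [(1, 136, 108, 383, 453), (2, 116, 96, 317, 347), (4, 108, 91, 289, 303)],
  [(1, 141, 113, 390, 468), (2, 124, 103, 329, 360), (4, 111, 94, 299, 314)],
  [(1, 152, 122, 408, 482), (2, 122, 102, 340, 372), (4, 119, 101, 311, 325)],
  [(1, 151, 122, 423, 499), (2, 130, 109, 353, 385), (4, 117, 100, 319, 337)],
  [(1, 159, 129, 437, 514), (2, 133, 112, 365, 398), (4, 125, 107, 332, 347)],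
  [(1, 162, 132, 453, 530), (2, 141, 119, 378, 410), (4, 128, 110, 342, 358)],
  [(1, 171, 140, 464, 545), (2, 140, 119, 385, 423), (4, 137, 118, 353, 370)],
  [(1, 171, 141, 474, 561), (2, 154, 131, 399, 435), (4, 134, 116, 363, 381)],
  [(1, 174, 144, 490, 577), (2, 151, 129, 412, 448), (4, 142, 123, 378, 392)],
  [(1, 187, 155, 506, 591), (2, 154, 132, 425, 461), (4, 146, 127, 386, 404)],
  [(1, 187, 156, 515, 608), (2, 158, 136, 433, 473), (4, 148, 129, 400, 416)],
  [(1, 190, 159, 532, 624), (2, 167, 144, 446, 486), (4, 152, 133, 407, 426)],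
  [(1, 194, 163, 544, 639), (2, 170, 147, 459, 499), (4, 155, 136, 418, 438)],
  [(1, 208, 175, 561, 655), (2, 173, 150, 472, 512), (4, 164, 144, 433, 450)],
  [(1, 212, 179, 574, 671), (2, 177, 154, 481, 524), (4, 167, 147, 444, 461)],
  [(1, 216, 183, 587, 686), (2, 180, 157, 494, 538), (4, 171, 151, 452, 473)],
  [(1, 220, 187, 601, 703), (2, 184, 161, 503, 550), (4, 174, 154, 463, 484)],
  [(1, 224, 191, 614, 718), (2, 192, 168, 523, 564), (4, 176, 156, 478, 496)],
  [(1, 228, 195, 628, 735), (2, 196, 172, 533, 577), (4, 187, 166, 488, 508)],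
  [(1, 237, 203, 645, 750), (2, 199, 175, 546, 590), (4, 190, 169, 500, 520)],
  [(1, 241, 207, 659, 767), (2, 203, 179, 556, 603), (4, 193, 172, 512, 532)],
  [(1, 246, 212, 669, 783), (2, 213, 188, 570, 616), (4, 196, 175, 523, 543)],
  [(1, 255, 220, 688, 799), (2, 216, 191, 584, 629), (4, 208, 186, 532, 555)],
  [(1, 252, 218, 705, 816), (2, 220, 195, 594, 642), (4, 211, 189, 544, 566)],
  [(1, 257, 223, 715, 832), (2, 231, 205, 606, 655), (4, 214, 192, 556, 578)],
  [(1, 262, 228, 725, 848), (2, 226, 201, 622, 669), (4, 217, 195, 569, 591)],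
  [(1, 271, 236, 745, 864), (2, 231, 206, 628, 682), (4, 220, 198, 581, 603)],
  [(1, 281, 245, 762, 880), (2, 241, 215, 645, 695), (4, 223, 201, 593, 614)],
  [(1, 279, 244, 774, 897), (2, 245, 219, 655, 707), (4, 226, 204, 606, 627)],
  [(1, 284, 249, 784, 913), (2, 247, 221, 673, 722), (4, 230, 208, 614, 638)],
  [(1, 294, 258, 802, 929), (2, 252, 226, 680, 734), (4, 233, 211, 627, 651)],
  [(1, 292, 257, 813, 946), (2, 263, 236, 696, 748), (4, 237, 215, 636, 663)],
  [(1, 302, 266, 831, 961), (2, 259, 233, 705, 762), (4, 240, 218, 648, 675)],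
  [(1, 313, 276, 847, 978), (2, 270, 243, 721, 775), (4, 251, 228, 665, 687)],
  [(1, 310, 274, 861, 995), (2, 266, 240, 730, 789), (4, 255, 232, 674, 699)],
  [(1, 321, 284, 877, 1011), (2, 277, 250, 747, 802)],
  [(1, 319, 283, 886, 1028), (2, 290, 262, 757, 814)],
  [(1, 330, 293, 903, 1043), (2, 285, 258, 769, 829)],
  [(1, 333, 296, 922, 1061), (2, 297, 269, 784, 842)],
  [(1, 345, 307, 937, 1077), (2, 293, 266, 791, 856)],
  [(1, 342, 305, 948, 1093), (2, 305, 277, 806, 868)],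
  [(1, 355, 317, 960, 1110), (2, 308, 280, 821, 882)],
  [(1, 358, 320, 979, 1127), (2, 311, 283, 836, 896)],
  [(1, 356, 319, 986, 1144), (2, 316, 288, 844, 910)],
  [(1, 368, 330, 1002, 1160), (2, 319, 291, 859, 924)],
  [(1, 371, 333, 1021, 1177), (2, 322, 294, 874, 938)],
  [(1, 375, 337, 1037, 1194), (2, 336, 307, 885, 950)],
  [(1, 387, 348, 1054, 1210), (2, 331, 303, 893, 964)],
  [(1, 391, 352, 1070, 1227), (2, 334, 306, 908, 978)],
  [(1, 395, 356, 1085, 1243), (2, 348, 319, 921, 992)],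
  [(1, 393, 355, 1091, 1261), (2, 351, 322, 936, 1006)],
  [(1, 413, 373, 1113, 1277), (2, 354, 325, 951, 1020)],
  [(1, 410, 371, 1122, 1294), (2, 357, 328, 966, 1033)],
  [(1, 414, 375, 1137, 1311), (2, 361, 332, 978, 1047)],
  [(1, 418, 379, 1153, 1328), (2, 376, 346, 990, 1061)],
  [(1, 422, 383, 1169, 1345), (2, 379, 349, 1005, 1075)],
  [(1, 426, 387, 1184, 1362), (2, 383, 353, 1017, 1088)],
  [(1, 448, 407, 1204, 1378), (2, 386, 356, 1033, 1103)],
  [(1, 445, 405, 1211, 1395), (2, 390, 360, 1045, 1117)],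
  [(1, 450, 410, 1223, 1412), (2, 394, 364, 1057, 1130)],
  [(1, 461, 420, 1249, 1429), (2, 397, 367, 1073, 1145)],
  [(1, 465, 424, 1265, 1446), (2, 401, 371, 1085, 1159)],
  [(1, 469, 428, 1281, 1463), (2, 405, 375, 1097, 1172)],
  [(1, 474, 433, 1294, 1480), (2, 409, 379, 1110, 1187)],
  [(1, 479, 438, 1307, 1497), (2, 413, 383, 1122, 1201)],
  [(1, 483, 442, 1323, 1514), (2, 417, 387, 1134, 1215)],
  [(1, 488, 447, 1336, 1531), (2, 421, 391, 1147, 1229)],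
  [(1, 494, 453, 1345, 1547), (2, 425, 395, 1159, 1243)],
  [(1, 506, 464, 1370, 1564), (2, 430, 400, 1168, 1257)],
  [(1, 511, 469, 1384, 1582), (2, 443, 412, 1191, 1271)],
  [(1, 517, 475, 1393, 1599), (2, 447, 416, 1204, 1285)],
  [(1, 510, 469, 1411, 1617), (2, 451, 420, 1216, 1299)],
  [(1, 523, 481, 1433, 1633), (2, 456, 425, 1225, 1312)],
  [(1, 528, 486, 1446, 1650), (2, 461, 430, 1235, 1327)],
  [(1, 533, 491, 1460, 1668), (2, 476, 444, 1254, 1341)],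
  [(1, 539, 497, 1469, 1685), (2, 480, 448, 1267, 1355)],
  [(1, 553, 510, 1490, 1702), (2, 471, 440, 1279, 1369)],
  [(1, 546, 504, 1506, 1720), (2, 476, 445, 1289, 1384)],
  [(1, 552, 510, 1516, 1737), (2, 491, 459, 1309, 1398)],
  [(1, 565, 522, 1541, 1754), (2, 495, 463, 1322, 1412)],
  [(1, 571, 528, 1551, 1771), (2, 501, 469, 1328, 1426)],
  [(1, 566, 524, 1559, 1789), (2, 502, 470, 1351, 1441)],
  [(1, 579, 536, 1585, 1806), (2, 507, 475, 1361, 1455)],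
  [(1, 585, 542, 1595, 1823), (2, 512, 480, 1370, 1468)],
  [(1, 601, 557, 1612, 1840), (2, 529, 496, 1387, 1483)],
  [(1, 593, 550, 1629, 1858), (2, 519, 487, 1400, 1498)],
  [(1, 600, 557, 1635, 1875), (2, 524, 492, 1409, 1512)],
  [(1, 615, 571, 1656, 1892), (2, 540, 507, 1430, 1526)],
  [(1, 608, 565, 1669, 1910), (2, 531, 499, 1439, 1541)],
  [(1, 623, 579, 1691, 1927), (2, 547, 514, 1459, 1554)],
  [(1, 617, 574, 1700, 1945), (2, 553, 520, 1466, 1568)],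
  [(1, 631, 587, 1725, 1962), (2, 555, 522, 1486, 1584)],
  [(1, 648, 603, 1741, 1979), (2, 560, 527, 1496, 1598)],
  [(1, 640, 596, 1756, 1997), (2, 562, 529, 1516, 1613)],
  [(1, 648, 604, 1760, 2014), (2, 568, 535, 1523, 1627)],
  [(1, 650, 606, 1784, 2032), (2, 587, 553, 1537, 1641)],
  [(1, 666, 621, 1804, 2049), (2, 576, 543, 1550, 1656)],
  [(1, 659, 615, 1815, 2067), (2, 594, 560, 1567, 1670)],
  [(1, 675, 630, 1836, 2084), (2, 584, 551, 1576, 1684)],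
  [(1, 669, 625, 1843, 2102)],
  [(1, 685, 640, 1864, 2119)],
  [(1, 680, 636, 1867, 2137)],
  [(1, 695, 650, 1892, 2154)],
  [(1, 698, 653, 1913, 2172)],
  [(1, 706, 661, 1917, 2189)],
  [(1, 708, 663, 1942, 2207)],
  [(1, 727, 681, 1955, 2224)],
  [(1, 719, 674, 1966, 2241)],
  [(1, 722, 677, 1987, 2259)],
  [(1, 740, 694, 2005, 2277)],
  [(1, 743, 697, 2026, 2295)],
  [(1, 737, 692, 2030, 2313)],
  [(1, 754, 708, 2052, 2330)],
  [(1, 758, 712, 2070, 2348)],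
  [(1, 779, 732, 2079, 2364)],
  [(1, 769, 723, 2095, 2383)],
  [(1, 772, 726, 2116, 2400)],
  [(1, 776, 730, 2134, 2419)],
  [(1, 796, 749, 2148, 2436)],
  [(1, 789, 743, 2153, 2454)],
  [(1, 792, 746, 2174, 2472)],
  [(1, 812, 765, 2189, 2489)],
  [(1, 815, 768, 2210, 2506)],
  [(1, 819, 772, 2228, 2524)],
  [(1, 823, 776, 2247, 2543)],
  [(1, 818, 772, 2243, 2561)],
  [(1, 836, 789, 2266, 2578)],
  [(1, 839, 792, 2288, 2596)],
  [(1, 843, 796, 2306, 2614)],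
  [(1, 848, 801, 2321, 2632)],
  [(1, 852, 805, 2339, 2650)],
  [(1, 874, 826, 2350, 2667)],
  [(1, 877, 829, 2372, 2685)],
  [(1, 881, 833, 2390, 2703)],
  [(1, 886, 838, 2405, 2721)],
  [(1, 890, 842, 2423, 2739)],
  [(1, 895, 847, 2438, 2756)],
  [(1, 899, 851, 2457, 2775)],
  [(1, 904, 856, 2472, 2793)],
  [(1, 909, 861, 2487, 2811)],
  [(1, 933, 884, 2495, 2828)],
  [(1, 937, 888, 2513, 2846)],
  [(1, 941, 892, 2532, 2864)],
  [(1, 946, 897, 2547, 2882)],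
  [(1, 950, 901, 2566, 2900)],
  [(1, 955, 906, 2581, 2918)],
  [(1, 960, 911, 2596, 2935)],
  [(1, 965, 916, 2612, 2954)],
  [(1, 970, 921, 2627, 2972)],
  [(1, 975, 926, 2643, 2990)],
  [(1, 980, 931, 2658, 3008)],
  [(1, 986, 937, 2670, 3026)],
  [(1, 991, 942, 2685, 3043)],
  [(1, 1012, 962, 2707, 3062)],
  [(1, 1017, 967, 2723, 3080)],
  [(1, 1002, 953, 2745, 3099)],
  [(1, 1007, 958, 2760, 3117)],
  [(1, 1013, 964, 2772, 3134)],
  [(1, 1018, 969, 2788, 3153)],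
  [(1, 1024, 975, 2800, 3171)],
  [(1, 1030, 981, 2812, 3189)],
  [(1, 1049, 999, 2842, 3207)],
  [(1, 1054, 1004, 2857, 3224)],
  [(1, 1060, 1010, 2870, 3243)],
  [(1, 1067, 1017, 2879, 3261)],
  [(1, 1055, 1006, 2889, 3280)],
  [(1, 1073, 1023, 2923, 3297)],
  [(1, 1078, 1028, 2939, 3316)],
  [(1, 1084, 1034, 2951, 3333)],
  [(1, 1091, 1041, 2961, 3352)],
  [(1, 1113, 1062, 2984, 3370)],
  [(1, 1098, 1048, 3002, 3389)],
  [(1, 1104, 1054, 3014, 3407)],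
  [(1, 1110, 1060, 3027, 3425)],
  [(1, 1131, 1080, 3054, 3443)],
  [(1, 1138, 1087, 3063, 3461)],
  [(1, 1124, 1074, 3077, 3480)],
  [(1, 1132, 1082, 3083, 3498)],
  [(1, 1151, 1100, 3118, 3516)],
  [(1, 1158, 1107, 3127, 3534)],
  [(1, 1146, 1096, 3133, 3553)],
  [(1, 1165, 1114, 3169, 3571)],
  [(1, 1172, 1121, 3178, 3589)],
  [(1, 1174, 1123, 3204, 3608)],
  [(1, 1180, 1129, 3217, 3626)],
  [(1, 1187, 1136, 3226, 3644)],
  [(1, 1212, 1160, 3244, 3662)],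
  [(1, 1195, 1144, 3265, 3681)],
  [(1, 1202, 1151, 3274, 3699)],
  [(1, 1226, 1174, 3296, 3717)],
  [(1, 1211, 1160, 3309, 3736)],
  [(1, 1219, 1168, 3315, 3753)],
  [(1, 1241, 1189, 3344, 3771)],
  [(1, 1227, 1176, 3354, 3791)],
  [(1, 1250, 1198, 3380, 3809)],
  [(1, 1236, 1185, 3389, 3828)],
  [(1, 1258, 1206, 3419, 3846)],
  [(1, 1266, 1214, 3426, 3864)],
  [(1, 1268, 1216, 3452, 3883)],
  [(1, 1275, 1223, 3461, 3900)],
  [(1, 1264, 1213, 3459, 3920)],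
  [(1, 1284, 1232, 3497, 3938)],
  [(1, 1292, 1240, 3504, 3956)],
  [(1, 1294, 1242, 3530, 3975)],
  [(1, 1302, 1250, 3536, 3993)],
  [(1, 1304, 1252, 3562, 4012)],
  [(1, 1311, 1259, 3572, 4030)],
  [(1, 1314, 1262, 3595, 4049)],
  [(1, 1322, 1270, 3601, 4067)],
  [(1, 1347, 1294, 3625, 4085)],
  [(1, 1332, 1280, 3634, 4104)],
  [(1, 1357, 1304, 3658, 4122)],
  [(1, 1343, 1291, 3663, 4141)],
  [(1, 1367, 1314, 3691, 4159)],
  [(1, 1369, 1316, 3717, 4177)],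
  [(1, 1377, 1324, 3724, 4196)],
  [(1, 1380, 1327, 3747, 4214)],
  [(1, 1388, 1335, 3754, 4233)],
  [(1, 1390, 1337, 3780, 4251)],
  [(1, 1380, 1328, 3770, 4270)],
  [(1, 1401, 1348, 3810, 4289)],
  [(1, 1404, 1351, 3833, 4308)],
  [(1, 1412, 1359, 3840, 4326)],
  [(1, 1415, 1362, 3863, 4345)],
  [(1, 1424, 1371, 3867, 4363)],
  [(1, 1426, 1373, 3893, 4382)],
  [(1, 1454, 1400, 3912, 4400)]]

/-- Chunks `(s, k₁, k₂)`. -/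
def chunkList : List (ℕ × ℕ × ℕ) :=
  [(2, 2, 2), (2, 3, 3), (3, 4, 4), (3, 5, 5), (3, 6, 6), (3, 7, 7), (4, 8, 8), (4, 9, 9), (4,
   10, 10), (4, 11, 11), (4, 12, 13), (4, 14, 14), (4, 15, 15), (5, 16, 16), (5, 17, 17), (5, 18,
   19), (5, 20, 21), (5, 22, 22), (5, 23, 23), (5, 24, 25), (5, 26, 26), (5, 27, 27), (5, 28,
   29), (5, 30, 31), (6, 32, 33), (6, 34, 35), (6, 36, 37), (6, 38, 38), (6, 39, 40), (6, 41,
   41), (6, 42, 43), (6, 44, 45), (6, 46, 47), (6, 48, 49), (6, 50, 51), (6, 52, 54), (6, 55,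
   57), (6, 58, 60), (6, 61, 63), (7, 64, 66), (7, 67, 70), (7, 71, 73), (7, 74, 77), (7, 78,
   81), (7, 82, 85), (7, 86, 90), (7, 91, 95), (7, 96, 100), (7, 101, 106), (7, 107, 112), (7,
   113, 119), (7, 120, 127), (8, 128, 136), (8, 137, 145), (8, 146, 154), (8, 155, 163), (8, 164,
   175), (8, 176, 187), (8, 188, 201), (8, 202, 217), (8, 218, 235), (8, 236, 253), (8, 254,
   273), (9, 274, 297), (9, 298, 323), (9, 324, 352), (9, 353, 381), (9, 382, 416), (9, 417,
   457), (9, 458, 504), (9, 505, 557), (10, 558, 617), (10, 618, 687), (10, 688, 769), (10, 770,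
   865), (10, 866, 977), (10, 978, 1111)]

theorem tableCheck_stepTable : tableCheck 1 stepTable = true := by decide +kernel

theorem length_stepTable : stepTable.length = 255 := by decide +kernel

theorem chunkCheck_of_mem_chunkList :
    ∀ c ∈ chunkList, chunkCheck c.1 c.2.1 c.2.2 1 c.2.2 stepTable = true := by
  unfold chunkList
  repeat' (refine List.forall_mem_cons.2 ⟨by decide +kernel, ?_⟩)
  exact List.forall_mem_nil _

theorem exists_mem_chunkList :
    ∀ k < 1024, 2 ≤ k → ∃ c ∈ chunkList, 2 ≤ c.2.1 ∧ c.2.1 ≤ k ∧ k ≤ c.2.2 ∧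
      (c.2.1 = 2 → k = 2) := by
  decide +kernel

/-- The bounds for small exponents and dimensions. -/
theorem exBound_small {k : ℕ} (hk2 : 2 ≤ k) (hkN : k < 1024) :
    (∀ D, 1 ≤ D → D ≤ 255 → ExBound (D + 1) k (target k D)) ∧
      ∃ k₁ k₂, 2 ≤ k₁ ∧ k₁ ≤ k ∧ k ≤ k₂ ∧ (k₁ = 2 → k = 2) ∧
        ExBound 256 k (finalBound k₁ k₂) := by
  obtain ⟨c, hc, h1, h2, h3, h4⟩ := exists_mem_chunkList k hkN hk2
  obtain ⟨h₁, h₂⟩ := exBound_target_of_chunkCheck h1 h2 h3 le_rfl tableCheck_stepTable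
    (chunkCheck_of_mem_chunkList c hc) (exBound_self_one.mono (by exact_mod_cast h3))
  rw [length_stepTable] at h₁ h₂
  refine ⟨fun D hD hD' => ?_, _, _, h1, h2, h3, h4, h₂⟩
  have := h₁ (D - 1) (by omega)
  rwa [show 1 + (D - 1) = D by omega] at this

theorem monotoneOn_add_mul_log {c t₀ : ℝ} (ht₀ : 0 < t₀) (hc : c * (2 * t₀ + 1) ≤ t₀) :
    MonotoneOn (fun t : ℝ => (t + c) * Real.log (1 + t⁻¹)) (Set.Ici t₀) := by
  have hpos : ∀ t ∈ Set.Ici t₀, 0 < t := fun t ht => ht₀.trans_le ht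
  have hderiv : ∀ t ∈ Set.Ici t₀, HasDerivAt (fun t : ℝ => (t + c) * Real.log (1 + t⁻¹))
      (1 * Real.log (1 + t⁻¹) + (t + c) * (-(t ^ 2)⁻¹ / (1 + t⁻¹))) t := fun t ht => by
    have h0 := hpos t ht
    have h1 : (1 + t⁻¹) ≠ 0 := by positivity
    exact ((hasDerivAt_id t).add_const c).mul (((hasDerivAt_inv h0.ne').const_add 1).log h1)
  refine monotoneOn_of_deriv_nonneg (convex_Ici _)
    (fun t ht => (hderiv t ht).continuousAt.continuousWithinAt)
    (fun t ht => (hderiv t (interior_subset ht)).differentiableAt.differentiableWithinAt) ?_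
  intro t ht
  rw [(hderiv t (interior_subset ht)).deriv]
  have ht' : t₀ ≤ t := interior_subset ht
  have h0 := hpos t ht'
  have h1 := Real.le_log_one_add_of_nonneg (x := t⁻¹) (by positivity)
  have h2 : c * (2 * t + 1) ≤ t := by
    rcases le_total c 0 with h | h
    · nlinarith
    · have h3 : c * (2 * t₀) * t ≤ t₀ * t - c * t := by nlinarith
      have h4 : t₀ * (c * (2 * t + 1)) ≤ t₀ * t := by nlinarith
      exact le_of_mul_le_mul_left h4 ht₀
  have h3 : 2 * t⁻¹ / (t⁻¹ + 2) + (t + c) * (-(t ^ 2)⁻¹ / (1 + t⁻¹)) =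
      (t - c * (2 * t + 1)) / (t * (t + 1) * (2 * t + 1)) := by
    field_simp
    ring
  have h4 : 0 ≤ (t - c * (2 * t + 1)) / (t * (t + 1) * (2 * t + 1)) :=
    div_nonneg (by linarith) (by positivity)
  linarith

theorem log_choose_lower {k y : ℕ} (hk : 1 ≤ k) (hy : 1 ≤ y) :
    k * Real.log (1 + (y:ℝ) / k) + (y + 1 / 2) * Real.log (1 + (k:ℝ) / y)
      - Real.log k / 2 - Real.log 3 ≤ Real.log ((k + y).choose k) := by
  have hk0 : (0:ℝ) < k := by exact_mod_cast hk
  have hy0 : (0:ℝ) < y := by exact_mod_cast hy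
  have hC : (0:ℝ) < (k + y).choose k := by
    exact_mod_cast Nat.choose_pos (by omega)
  have h := sq_pow_self_le_choose (M := k + y) hk (by omega)
  rw [Nat.add_sub_cancel_left] at h
  have hM : (0:ℝ) < ((k + y : ℕ) : ℝ) := by push_cast; linarith
  have h' := Real.log_le_log (by positivity) h
  rw [show (9:ℝ) = 3 ^ 2 by norm_num, Real.log_mul hM.ne' (by positivity),
    Real.log_mul (by positivity) (by positivity), Real.log_mul (by positivity) (by positivity),
    Real.log_mul (by positivity) hy0.ne', Real.log_mul (by norm_num) hk0.ne'] at h'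
  simp only [Real.log_pow] at h'
  rw [Real.log_mul (by positivity) (by positivity)] at h'
  simp only [Real.log_pow] at h'
  have e1 : 1 + (y:ℝ) / k = ((k + y : ℕ) : ℝ) / k := by push_cast; field_simp
  have e2 : 1 + (k:ℝ) / y = ((k + y : ℕ) : ℝ) / y := by push_cast; field_simp; ring
  rw [e1, e2, Real.log_div hM.ne' hk0.ne', Real.log_div hM.ne' hy0.ne']
  set Z := Real.log ((k + y : ℕ) : ℝ)
  push_cast at h' ⊢
  linarith

/-- The logarithm appearing in `logTarget`. -/
noncomputable def logRatio (k D : ℕ) : ℝ := Real.log (1 + (Real.log k / D + (k:ℝ)⁻¹)⁻¹)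

/-- A lower bound for the logarithm of `target k D`. -/
noncomputable def logTarget (k D : ℕ) : ℝ :=
  k * Real.log k + (k * Real.log k + 3 / 2 * D) * logRatio k D + (3 / 2 * D + 2) * Real.log k
    + D * Real.log (D + 1) - D * Real.log 3

theorem log_target_ge_of_le {k D : ℕ} (hk : 2 ≤ k) (hD : 1 ≤ D) {X : ℝ}
    (hX : X ≤ Real.log ((sideLen k D + 1).choose k)) :
    2 * (D + 1) * Real.log k + D * Real.log (D + 1) + D * X ≤ Real.log (target k D) := by
  have hk0 : (0:ℝ) < k := by exact_mod_cast (by omega : 0 < k)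
  have hD0 : (0:ℝ) < D := by exact_mod_cast hD
  have hm := le_sideLen hD (by omega : 1 ≤ k)
  have hm0 : (0:ℝ) < sideLen k D := by exact_mod_cast (by omega : 0 < sideLen k D)
  have hC : (0:ℝ) < (sideLen k D + 1).choose k := by
    exact_mod_cast Nat.choose_pos (by omega)
  have h1 : (D + 1) * Real.log k ≤ D * Real.log (sideLen k D) := by
    have h := Real.log_le_log (by positivity) (mul_rpow_le_sideLen hD (by omega : 1 ≤ k))
    rw [Real.log_mul hk0.ne' (by positivity), Real.log_rpow hk0] at h
    have h2 := mul_le_mul_of_nonneg_left h hD0.le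
    rw [mul_add, ← mul_assoc, mul_inv_cancel₀ hD0.ne'] at h2
    linarith
  have h2 := mul_le_mul_of_nonneg_left hX hD0.le
  have e : Real.log (target k D) = (D + 1) * Real.log k + D * (Real.log (D + 1) +
      Real.log (sideLen k D) + Real.log ((sideLen k D + 1).choose k)) := by
    rw [target]
    push_cast
    rw [Real.log_mul (by positivity) (by positivity), Real.log_pow, Real.log_pow,
      Real.log_mul (by positivity) hC.ne', Real.log_mul (by positivity) hm0.ne']
    push_cast
    ring
  rw [e]
  linarith

theorem logTarget_le {k D : ℕ} (hk : 2 ≤ k) (hD : 1 ≤ D) :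
    logTarget k D ≤ Real.log (target k D) := by
  have hk0 : (0:ℝ) < k := by exact_mod_cast (by omega : 0 < k)
  have hk2 : (2:ℝ) ≤ k := by exact_mod_cast hk
  have hD0 : (0:ℝ) < D := by exact_mod_cast hD
  have hL : 0 < Real.log k := Real.log_pos (by linarith)
  have hm := le_sideLen hD (by omega : 1 ≤ k)
  obtain ⟨y, hy⟩ : ∃ y, sideLen k D + 1 = k + y := ⟨sideLen k D + 1 - k, by omega⟩
  have hy1 : 1 ≤ y := by omega
  have hy0 : (0:ℝ) < y := by exact_mod_cast hy1
  have hC := log_choose_lower (by omega : 1 ≤ k) hy1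
  set A := (k:ℝ) ^ ((D:ℝ)⁻¹) with hA
  have hAlog : Real.log A = Real.log k / D := by rw [hA, Real.log_rpow hk0]; ring
  have hA0 : 0 < A := by positivity
  have hA1 : Real.log k / D + 1 ≤ A := by
    rw [← hAlog]; linarith [Real.log_le_sub_one_of_pos hA0]
  have hyA : k * A + 1 ≤ k + y := by
    have := mul_rpow_le_sideLen hD (by omega : 1 ≤ k)
    have h2 : ((sideLen k D : ℝ) + 1) = k + y := by exact_mod_cast hy
    linarith
  have ht : A - 1 + (k:ℝ)⁻¹ ≤ y / k := by
    rw [le_div_iff₀ hk0, add_mul, inv_mul_cancel₀ hk0.ne']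
    linarith
  set t₀ := Real.log k / D + (k:ℝ)⁻¹ with ht₀
  have ht₀0 : 0 < t₀ := by positivity
  have htt : t₀ ≤ y / k := by linarith
  have hc : 1 / (2 * (k:ℝ)) * (2 * t₀ + 1) ≤ t₀ := by
    have h1 : (1:ℝ) / (2 * k) ≤ 1 / 4 := by
      apply one_div_le_one_div_of_le <;> linarith
    have h2 : 1 / (2 * (k:ℝ)) = (k:ℝ)⁻¹ / 2 := by field_simp
    have h3 : (k:ℝ)⁻¹ ≤ t₀ := by rw [ht₀]; linarith [div_pos hL hD0]
    nlinarith
  have hmono := monotoneOn_add_mul_log ht₀0 hc (Set.mem_Ici.2 le_rfl) (Set.mem_Ici.2 htt) htt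
  simp only at hmono
  have h1 : Real.log k / D ≤ Real.log (1 + y / k) := by
    rw [← hAlog]
    exact Real.log_le_log hA0 (by linarith [inv_pos.2 hk0])
  have h2 : (k * Real.log k / D + 3 / 2) * logRatio k D ≤
      (y + 1 / 2) * Real.log (1 + (k:ℝ) / y) := by
    have h3 := mul_le_mul_of_nonneg_left hmono hk0.le
    have e1 : k * ((t₀ + 1 / (2 * (k:ℝ))) * Real.log (1 + t₀⁻¹)) =
        (k * Real.log k / D + 3 / 2) * logRatio k D := by
      rw [logRatio, ← ht₀, ← mul_assoc]
      congr 1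
      rw [ht₀]
      field_simp
      ring
    have e2 : k * ((y / k + 1 / (2 * (k:ℝ))) * Real.log (1 + (y / k : ℝ)⁻¹)) =
        (y + 1 / 2) * Real.log (1 + (k:ℝ) / y) := by
      rw [inv_div, ← mul_assoc]
      congr 1
      field_simp
    linarith
  have h4 := log_target_ge_of_le hk hD (X := k * (Real.log k / D) +
    (k * Real.log k / D + 3 / 2) * logRatio k D - Real.log k / 2 - Real.log 3) (by
      rw [hy]
      have := mul_le_mul_of_nonneg_left h1 hk0.le
      linarith)
  refine le_trans (le_of_eq ?_) h4
  rw [logTarget]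
  field_simp
  ring

theorem logRatio_eq {k D : ℕ} (hk : 1 ≤ k) (hD : 1 ≤ D) :
    logRatio k D = Real.log ((k * Real.log k + (k + 1) * D) / (k * Real.log k + D)) := by
  have hk0 : (0:ℝ) < k := by exact_mod_cast hk
  have hD0 : (0:ℝ) < D := by exact_mod_cast hD
  have hL : 0 ≤ Real.log k := Real.log_natCast_nonneg k
  have h1 : (k * Real.log k + D : ℝ) ≠ 0 := by positivity
  have h2 : (Real.log k / D + (k:ℝ)⁻¹) ≠ 0 := by positivity
  rw [logRatio]
  congr 1
  field_simp
  ring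

/-- A lower bound for `logTarget k (D + 1) - logTarget k D`. -/
noncomputable def logTargetIncr (k D : ℕ) : ℝ :=
  k * Real.log k / (Real.log k + (D + 1) + (D + 1) / k) + 3 / 2 * logRatio k (D + 1)
    + 3 / 2 * Real.log k - Real.log 3 + Real.log (D + 1) + (D + 1) / (D + 2)

theorem logTarget_add_incr_le {k D : ℕ} (hk : 2 ≤ k) (hD : 1 ≤ D) :
    logTarget k D + logTargetIncr k D ≤ logTarget k (D + 1) := by
  have hk0 : (0:ℝ) < k := by exact_mod_cast (by omega : 0 < k)
  have hD0 : (1:ℝ) ≤ D := by exact_mod_cast hD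
  have hL : 0 < Real.log k := Real.log_pos (by exact_mod_cast (by omega : 1 < k))
  set L := Real.log k with hLdef
  have hψ : k * (k * L) / ((k * L + (k + 1) * (D + 1)) * (k * L + D)) ≤
      logRatio k (D + 1) - logRatio k D := by
    rw [logRatio_eq (by omega) hD, logRatio_eq (by omega) (by omega), ← hLdef,
      ← Real.log_div (by positivity) (by positivity)]
    push_cast
    refine le_trans (le_of_eq ?_) (Real.one_sub_inv_le_log_of_pos (by positivity))
    field_simp
    ring
  have h1 : k * L / (L + (D + 1) + (D + 1) / k) ≤
      (k * L + 3 / 2 * D) * (logRatio k (D + 1) - logRatio k D) := by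
    calc k * L / (L + (D + 1) + (D + 1) / k) = (k * L + D) *
          (k * (k * L) / ((k * L + (k + 1) * (D + 1)) * (k * L + D))) := by
          field_simp
          ring
      _ ≤ (k * L + 3 / 2 * D) * (k * (k * L) / ((k * L + (k + 1) * (D + 1)) * (k * L + D))) := by
          gcongr; linarith
      _ ≤ _ := by gcongr
  have h2 : (D + 1) / (D + 2) + D * Real.log (D + 1) ≤ (D + 1) * Real.log (D + 2) - Real.log (D + 1)
      := by
    have h3 := Real.one_sub_inv_le_log_of_pos (x := (D + 2) / (D + 1 : ℝ)) (by positivity)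
    rw [Real.log_div (by positivity) (by positivity), inv_div] at h3
    have h4 := mul_le_mul_of_nonneg_left h3 (by positivity : (0:ℝ) ≤ D + 1)
    have h5 : (D + 1 : ℝ) * (1 - (D + 1) / (D + 2)) = (D + 1) / (D + 2) := by field_simp; ring
    linarith
  rw [logTarget, logTarget, logTargetIncr, ← hLdef]
  push_cast
  rw [show (D + 1 + 1 : ℝ) = D + 2 by ring]
  linarith

theorem mul_log_le_logTarget {k D : ℕ} (hk : 3 ≤ k) (hD : 1 ≤ D) :
    D * Real.log (D + 1) ≤ logTarget k D := by
  have hk0 : (3:ℝ) ≤ k := by exact_mod_cast hk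
  have hD0 : (1:ℝ) ≤ D := by exact_mod_cast hD
  have h3 : 0 < Real.log 3 := Real.log_pos (by norm_num)
  have hL : Real.log 3 ≤ Real.log k := Real.log_le_log (by norm_num) hk0
  have hψ : 0 ≤ logRatio k D := Real.log_nonneg (by
    have : (0:ℝ) ≤ (Real.log k / D + (k:ℝ)⁻¹)⁻¹ := by positivity
    linarith)
  have h1 : 0 ≤ k * Real.log k := by positivity
  have h2 : 0 ≤ (k * Real.log k + 3 / 2 * D) * logRatio k D := by positivity
  have h4 : D * Real.log 3 ≤ (3 / 2 * D + 2) * Real.log k := by nlinarith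
  rw [logTarget]
  linarith

theorem prod_div_mul_pow_le_exp {v N c κ : ℝ} {D : ℕ} {j : ℝ} (hv : 0 < v) (hvN : v ≤ N)
    (hj : j ≤ 2) (hc : 0 < c) (hcv : c + (D + 1) ≤ v)
    (hκ : D * (D + 3) / 2 * ((N - v) / (N * c)) ≤ κ) :
    (∏ i ∈ range D, (N - j - i) / (v - j - i)) * (v / N) ^ D ≤ Real.exp κ := by
  have hN : 0 < N := hv.trans_le hvN
  have hsum : ∑ i ∈ range D, ((i:ℝ) + 2) = D * (D + 3) / 2 := by
    clear hcv hκ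
    induction D with
    | zero => simp
    | succ n ih => rw [sum_range_succ, ih]; push_cast; ring
  have hpow : (v / N) ^ D = ∏ _i ∈ range D, v / N := by
    rw [prod_const, card_range]
  rw [hpow, ← prod_mul_distrib]
  refine le_trans (prod_le_prod (g := fun i : ℕ => Real.exp (((i:ℝ) + 2) * ((N - v) / (N * c)))) ?_ ?_) ?_
  · intro i hi
    have : (i:ℝ) + 1 ≤ D := by exact_mod_cast mem_range.1 hi
    have h1 : 0 < v - j - i := by linarith
    have h2 : 0 < N - j - i := by linarith
    positivity
  · intro i hi
    have : (i:ℝ) + 1 ≤ D := by exact_mod_cast mem_range.1 hi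
    have h1 : 0 < v - j - i := by linarith
    refine le_trans ?_ (Real.add_one_le_exp _)
    have h3 : (N - j - i) / (v - j - i) * (v / N) = (j + i) * ((N - v) / (N * (v - j - i))) + 1 := by
      field_simp
      ring
    rw [h3]
    have h4 : (N - v) / (N * (v - j - i)) ≤ (N - v) / (N * c) := by
      have : 0 ≤ N - v := by linarith
      gcongr
      linarith
    have h5 : 0 ≤ (N - v) / (N * (v - j - i)) := by
      have : 0 ≤ N - v := by linarith
      positivity
    have : (0:ℝ) ≤ i := i.cast_nonneg
    nlinarith
  · rw [← Real.exp_sum, ← sum_mul, hsum]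
    exact Real.exp_le_exp.2 hκ

theorem exists_two_mul_eq_mul_three_mul_sub_one {β : ℕ} (hβ : 1 ≤ β) :
    ∃ e : ℕ, 2 * e = β * (3 * β - 1) := by
  obtain ⟨m, rfl | rfl⟩ := β.even_or_odd'
  · exact ⟨m * (3 * (2 * m) - 1), (mul_assoc _ _ _).symm⟩
  · exact ⟨(2 * m + 1) * (3 * m + 1), by
      rw [show 3 * (2 * m + 1) - 1 = 2 * (3 * m + 1) by omega]; ring⟩

theorem log_two_pow_bound {β d : ℝ} (hβ : 8 ≤ β) (hd : 0 < d) (h : Real.log d ≤ (β + 1) * Real.log 2) :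
    Real.log (8 * (β * d)) ≤ 0.8182 * β + 3.8529 := by
  have h2 := Real.log_two_lt_d9
  have h8 : Real.log 8 = 3 * Real.log 2 := by
    rw [show (8:ℝ) = 2 ^ 3 by norm_num, Real.log_pow]; norm_num
  have h1 : Real.log (β / 8) ≤ β / 8 - 1 := Real.log_le_sub_one_of_pos (by positivity)
  rw [Real.log_div (by positivity) (by norm_num)] at h1
  rw [Real.log_mul (by norm_num) (by positivity), Real.log_mul (by positivity) (by positivity)]
  nlinarith

theorem ExBound.step_log {D k : ℕ} (hD : 256 ≤ D) {G' : ℝ} (hG' : ExBound D k G')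
    (hG'd : 16 * ((D:ℝ) + 1) ≤ G') {r : ℕ} (hr : 1 ≤ r) (hk : k ≤ r * D + 1) :
    ExBound (D + 1) k ((3 * (Nat.log 2 (D + 1) * (D + 1)) : ℝ) ^ r * G') := by
  have hlo := Nat.pow_log_le_self 2 (show D + 1 ≠ 0 by omega)
  have hhi := Nat.lt_pow_succ_log_self (b := 2) (by norm_num) (D + 1)
  have hβ8 : 8 ≤ Nat.log 2 (D + 1) := Nat.le_log_of_pow_le (by norm_num) (by omega)
  set β := Nat.log 2 (D + 1) with hβdef
  have h32 : 32 * β ≤ 2 ^ β := by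
    clear_value β
    clear hβdef hlo hhi
    induction β, hβ8 using Nat.le_induction with
    | base => norm_num
    | succ n hn ih => rw [pow_succ]; omega
  obtain ⟨e, he⟩ := exists_two_mul_eq_mul_three_mul_sub_one (β := β) (by omega)
  have hβR : (8:ℝ) ≤ β := by exact_mod_cast hβ8
  have hDR : (256:ℝ) ≤ D := by exact_mod_cast hD
  have hdβ : (32:ℝ) * β ≤ D + 1 := by exact_mod_cast h32.trans hlo
  have heR : (e:ℝ) = β * (3 * β - 1) / 2 := by
    have : 2 * (e:ℝ) = β * (3 * β - 1) := by
      have h : 2 * e + β = β * (3 * β) := by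
        rw [he, ← Nat.mul_succ]; congr 1; omega
      have h' : 2 * (e:ℝ) + β = β * (3 * β) := by exact_mod_cast h
      linarith
    linarith
  have hlogd : Real.log ((D:ℝ) + 1) ≤ (β + 1) * Real.log 2 := by
    have h : ((D:ℝ) + 1) ≤ 2 ^ (β + 1) := by exact_mod_cast hhi.le
    have := Real.log_le_log (by positivity) h
    rw [Real.log_pow] at this
    push_cast at this
    exact this
  have hln := log_two_pow_bound hβR (by positivity) hlogd
  set v : ℝ := β * (D + 1) with hv
  have hv0 : 0 < v := by positivity
  obtain ⟨H, hH⟩ : ∃ H, β * (D + 1) = H + 1 := ⟨β * (D + 1) - 1, by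
    have : 0 < β * (D + 1) := by positivity
    omega⟩
  have hHv : (H:ℝ) + 1 = v := by rw [hv]; exact_mod_cast hH.symm
  have hHD : 8 * (D + 1) ≤ H + 1 := by rw [← hH]; exact Nat.mul_le_mul_right _ hβ8
  set N := H + 1 + e with hN
  have hNR : (N:ℝ) = v + e := by rw [hN]; push_cast; rw [hHv]
  have he0 : (0:ℝ) < e := by rw [heR]; have : (0:ℝ) < 3 * β - 1 := by linarith
                             positivity
  have hN0 : (0:ℝ) < N := by rw [hNR]; positivity
  have heN : (N:ℝ) - v = e := by rw [hNR]; ring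
  have hθ : Real.log (8 * v) ≤ e / N * D := by
    refine hln.trans ?_
    have e1 : (e:ℝ) / N * D = (3 * β - 1) / 2 * D / ((D + 1) + (3 * β - 1) / 2) := by
      rw [hNR, heR, hv]
      field_simp
    have h0 : 0 < (D + 1 : ℝ) + (3 * β - 1) / 2 := by linarith
    rw [e1, le_div_iff₀ h0]
    nlinarith
  have hρ8 : (v / N) ^ D ≤ 1 / (8 * v) := by
    have h1 : v / N ≤ Real.exp (-(e / N)) := by
      refine le_trans (le_of_eq ?_) (Real.add_one_le_exp _)
      rw [← heN, sub_div, div_self hN0.ne']; linarith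
    calc (v / N) ^ D ≤ Real.exp (-(e / N)) ^ D := by gcongr
      _ = Real.exp (-(e / N * D)) := by rw [← Real.exp_nat_mul]; congr 1; ring
      _ ≤ Real.exp (-Real.log (8 * v)) := Real.exp_le_exp.2 (by linarith)
      _ = 1 / (8 * v) := by rw [Real.exp_neg, Real.exp_log (by positivity), one_div]
  have hρ8' : v ^ (D + 1) / (N:ℝ) ^ D ≤ 1 / 8 := by
    calc v ^ (D + 1) / (N:ℝ) ^ D = v * (v / N) ^ D := by rw [div_pow]; ring
      _ ≤ v * (1 / (8 * v)) := by gcongr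
      _ = 1 / 8 := by field_simp
  have hκ : (D:ℝ) * (D + 3) / 2 * ((N - v) / (N * ((β - 1) * (D + 1)))) ≤ 23 / 28 := by
    have hb : (0:ℝ) < β - 1 := by linarith
    rw [heN, ← mul_div_assoc, div_le_iff₀ (by positivity), hNR]
    have h1 : (D:ℝ) * (D + 3) ≤ (D + 1) * (D + 2) := by nlinarith
    have h2 : (e:ℝ) * (D + 2) / 2 ≤ 23 / 28 * ((v + e) * (β - 1)) := by
      have h3 : (β:ℝ) * (D + 2) ≤ v + e := by rw [heR, hv]; nlinarith
      have h4 : (e:ℝ) * (D + 2) / 2 = (β * (D + 2)) * ((3 * β - 1) / 4) := by rw [heR]; ring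
      rw [h4]
      have h5 : (3 * β - 1 : ℝ) / 4 ≤ 23 / 28 * (β - 1) := by linarith
      calc (β * (D + 2) : ℝ) * ((3 * β - 1) / 4) ≤ (v + e) * (23 / 28 * (β - 1)) := by
            have : (0:ℝ) ≤ (3 * β - 1) / 4 := by linarith
            gcongr
        _ = _ := by ring
    calc (D:ℝ) * (D + 3) / 2 * e ≤ (D + 1) * (D + 2) / 2 * e := by gcongr
      _ = (D + 1) * (e * (D + 2) / 2) := by ring
      _ ≤ (D + 1) * (23 / 28 * ((v + e) * (β - 1))) := by gcongr
      _ = _ := by ring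
  have hexp : Real.exp (23 / 28) ≤ 2.3 := by
    refine le_of_pow_le_pow_left₀ (n := 28) (by norm_num) (by norm_num) ?_
    rw [← Real.exp_nat_mul]
    have h1 : Real.exp ((28:ℕ) * (23 / 28)) = Real.exp 1 ^ 23 := by
      rw [← Real.exp_nat_mul]; norm_num
    rw [h1]
    calc Real.exp 1 ^ 23 ≤ 2.7182818286 ^ 23 := by gcongr; exact Real.exp_one_lt_d9.le
      _ ≤ _ := by norm_num
  have hprod : ∀ j : ℕ, j ≤ 2 → 1 ≤ j →
      (((N - j).choose D : ℝ) / ((H + 1 - j).choose D)) * (v / N) ^ D ≤ 2.3 := by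
    intro j hj hj1
    have hbd := (prod_div_mul_pow_le_exp (N := N) (j := j) (c := (β - 1) * (D + 1)) (D := D) hv0
      (by linarith)
      (by exact_mod_cast hj) (mul_pos (by linarith) (by positivity)) (by rw [hv]; linarith)
      hκ).trans hexp
    rw [choose_div_choose_eq_prod (by omega) (by omega)]
    refine le_trans (le_of_eq ?_) hbd
    congr 1
    refine prod_congr rfl fun i _ => ?_
    rw [Nat.cast_sub (by omega), Nat.cast_sub (by omega)]
    push_cast
    rw [hHv]
  have hNv : (N:ℝ) ≤ 1.06 * v := by
    rw [hNR, heR, hv]; nlinarith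
  refine hG'.step (by omega) le_rfl hr hk (H := H) (N := N) (x := 2.3 * N) (E := 3 * v) (w := 16)
    (by omega) (by omega) (by norm_num) hG'd (by positivity) ?_ ?_ (by linarith) (by linarith) ?_
  · rw [hHv]
    have := (div_le_iff₀ (by positivity)).1 hρ8'
    have h0 : (0:ℝ) ≤ (N:ℝ) ^ D := by positivity
    linarith
  · have h1 := hprod 1 (by norm_num) le_rfl
    have h2 := hprod 2 le_rfl (by norm_num)
    rw [show H + 1 - 1 = H by omega] at h1
    rw [show H + 1 - 2 = H - 1 by omega] at h2
    rw [hHv]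
    have h3 := mul_le_mul h1 h2 (by positivity) (by norm_num)
    calc _ = (((N - 1).choose D : ℝ) / (H.choose D)) * (v / N) ^ D *
          ((((N - 2).choose D : ℝ) / ((H - 1).choose D)) * (v / N) ^ D) * (N:ℝ) ^ 2 := by
          rw [div_pow v]; ring
      _ ≤ 2.3 * 2.3 * (N:ℝ) ^ 2 := by gcongr
      _ = _ := by ring
  · rw [hHv, pow_one, pow_one, pow_one, pow_one]
    have : v ^ (D + 1) / (N:ℝ) ^ D * (3 * v) ≤ 1 / 8 * (3 * v) := by gcongr
    linarith

theorem exp_mul_sub_le {u a j : ℝ} (huj : u ≤ j) (ha : 1 + j ≤ a) :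
    Real.exp u * (a - u) ≤ Real.exp j * (a - j) := by
  have h1 := Real.add_one_le_exp (j - u)
  have h2 : Real.exp j = Real.exp u * Real.exp (j - u) := by rw [← Real.exp_add]; congr 1; ring
  rw [h2, mul_assoc]
  have h3 : (a - u) ≤ Real.exp (j - u) * (a - j) := by nlinarith
  gcongr

theorem exp_mul_sub_le_exp (u a : ℝ) : Real.exp u * (a - u) ≤ Real.exp (a - 1) := by
  have h1 := Real.add_one_le_exp (a - u - 1)
  have h2 : Real.exp (a - 1) = Real.exp u * Real.exp (a - u - 1) := by
    rw [← Real.exp_add]; congr 1; ring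
  rw [h2]
  gcongr
  linarith

theorem log_three_bounds : 1.098 < Real.log 3 ∧ Real.log 3 < 1.0987 := by
  have h2 := Real.log_two_gt_d9
  have h2' := Real.log_two_lt_d9
  constructor
  · have h := Real.log_lt_log (by norm_num) (by norm_num : (2:ℝ) ^ 84 < 3 ^ 53)
    rw [Real.log_pow, Real.log_pow] at h
    push_cast at h
    linarith
  · have h := Real.log_lt_log (by norm_num) (by norm_num : (3:ℝ) ^ 147 < 2 ^ 233)
    rw [Real.log_pow, Real.log_pow] at h
    push_cast at h
    linarith

theorem exp_neg_small_le : Real.exp (-0.635) ≤ 0.531 := by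
  refine le_of_pow_le_pow_left₀ (n := 200) (by norm_num) (by norm_num) ?_
  rw [← Real.exp_nat_mul, show ((200:ℕ):ℝ) * -0.635 = -((127:ℕ) * 1) by norm_num, Real.exp_neg,
    Real.exp_nat_mul]
  have h : (2.7182818283:ℝ) ^ 127 ≤ Real.exp 1 ^ 127 := by
    gcongr; exact Real.exp_one_gt_d9.le
  calc (Real.exp 1 ^ 127)⁻¹ ≤ (2.7182818283 ^ 127)⁻¹ := by gcongr
    _ ≤ _ := by norm_num

/-- The numerical core of the induction step, in terms of `L = log k` and `ℓ = log P`. -/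
theorem step_numeric_main {L ℓ u w β : ℝ} (hu : u = L - ℓ) (hℓ : 5.545 ≤ ℓ) (hℓL : ℓ ≤ 2 * L)
    (hL : 2.832 ≤ L) (hβ0 : 0 < β) (hβ : β ≤ 1.4427 * ℓ + 0.006) (hw : w = Real.log (3 * β))
    (hwβ : w ≤ 2.1783 + β / 8) (hw3 : 3 ≤ w) {ψ : ℝ} (hψL : u ≤ 0 → L - L / 8 - 1.2045 ≤ ψ)
    (hψℓ : 0 ≤ u → ℓ - L / 8 - 1.2045 ≤ ψ) :
    max 0 (Real.exp u * (w + 0.365 - u)) ≤ 3 / 2 * ψ + 3 / 2 * L - 0.1075 - w := by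
  have he1 := Real.exp_one_lt_d9
  have he2 : Real.exp 2 ≤ 7.3891 := by
    have : Real.exp 2 = Real.exp 1 ^ 2 := by rw [← Real.exp_nat_mul]; norm_num
    rw [this]
    calc Real.exp 1 ^ 2 ≤ 2.7182818286 ^ 2 := by gcongr
      _ ≤ _ := by norm_num
  have hem1 : Real.exp (-1) ≤ 0.368 := by
    rw [Real.exp_neg]
    have := Real.exp_one_gt_d9
    calc (Real.exp 1)⁻¹ ≤ (2.7182818283)⁻¹ := by gcongr
      _ ≤ _ := by norm_num
  rcases le_total u 0 with h0 | h0
  · have := hψL h0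
    rcases le_total u (-1) with h1 | h1
    · have h := exp_mul_sub_le (a := w + 0.365) h1 (by linarith)
      have h' : Real.exp (-1) * (w + 0.365 - -1) ≤ 0.368 * (w + 0.365 - -1) := by
        gcongr; linarith
      exact max_le (by linarith) (by linarith)
    · have h := exp_mul_sub_le (a := w + 0.365) h0 (by linarith)
      rw [Real.exp_zero] at h
      exact max_le (by linarith) (by linarith)
  · have := hψℓ h0
    rcases le_total u 1 with h1 | h1
    · have h := exp_mul_sub_le (a := w + 0.365) h1 (by linarith)
      have h' : Real.exp 1 * (w + 0.365 - 1) ≤ 2.7182818286 * (w + 0.365 - 1) := by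
        gcongr; linarith
      exact max_le (by linarith) (by linarith)
    · rcases le_total u 2 with h2 | h2
      · have h := exp_mul_sub_le (a := w + 0.365) h2 (by linarith)
        have h' : Real.exp 2 * (w + 0.365 - 2) ≤ 7.3891 * (w + 0.365 - 2) := by
          gcongr; linarith
        exact max_le (by linarith) (by linarith)
      · have h := exp_mul_sub_le_exp u (w + 0.365)
        have h' : Real.exp (w + 0.365 - 1) ≤ 3 * β * 0.531 := by
          rw [show w + 0.365 - 1 = w + -0.635 by ring, Real.exp_add, hw,
            Real.exp_log (by positivity)]
          have := exp_neg_small_le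
          gcongr
        exact max_le (by linarith) (by linarith)

theorem log_256_bounds : 5.545 < Real.log 256 ∧ Real.log 256 < 5.5452 := by
  have h2 := Real.log_two_gt_d9
  have h2' := Real.log_two_lt_d9
  have : Real.log 256 = 8 * Real.log 2 := by
    rw [show (256:ℝ) = 2 ^ 8 by norm_num, Real.log_pow]; norm_num
  constructor <;> linarith

theorem step_numeric_loss {k P L ℓ w β W : ℝ} (hk : 17 ≤ k) (hP : 256 ≤ P) (hL : L = Real.log k)
    (hℓ : ℓ = Real.log P) (hL17 : 2.832 ≤ L) (hw3 : 3 ≤ w) (hβ : β ≤ 1.4427 * ℓ + 0.006)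
    (hwβ : w ≤ 2.1783 + β / 8) (hW : W ≤ ℓ + w + 0.004) :
    k / P * W ≤ k * L / (L + P + P / k) + max 0 (k / P * (w + 0.365 - (L - ℓ))) := by
  have hk0 : 0 < k := by linarith
  have hP0 : 0 < P := by linarith
  obtain ⟨h256l, h256u⟩ := log_256_bounds
  obtain ⟨s, hs⟩ : ∃ s, s = ℓ - Real.log 256 := ⟨_, rfl⟩
  have hs0 : 0 ≤ s := by
    have := Real.log_le_log (by norm_num) hP
    linarith
  have hPs : 256 * (1 + s + s ^ 2 / 2) ≤ P := by
    have h1 := Real.quadratic_le_exp_of_nonneg hs0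
    have h2 : Real.exp s = P / 256 := by
      rw [hs, hℓ, Real.exp_sub, Real.exp_log hP0, Real.exp_log (by norm_num)]
    rw [h2, le_div_iff₀ (by norm_num)] at h1
    linarith
  obtain ⟨L₀, hL₀⟩ : ∃ L₀, L₀ = ℓ + w + 0.365 := ⟨_, rfl⟩
  have hL₀s : L₀ ≤ 9.0893 + 1.1804 * s := by linarith
  have hL₀8 : 8 ≤ L₀ := by linarith
  have hquad : L₀ * (L₀ + 1) ≤ 0.361 * (L₀ + P) := by
    have h1 := mul_le_mul hL₀s (by linarith : L₀ + 0.639 ≤ 9.7283 + 1.1804 * s) (by linarith)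
      (by linarith)
    have := sq_nonneg s
    linarith
  have hsplit : k / P * W = k * (W / P) := by ring
  rw [hsplit]
  rcases le_total L L₀ with hLL | hLL
  · have hloss : L * (L + P / k) ≤ 0.361 * (L + P + P / k) := by
      rcases le_total P k with h | h
      · have hq : P / k ≤ 1 := (div_le_one hk0).2 h
        have h1 := mul_le_mul hLL (by linarith : L + 0.639 ≤ L₀ + 0.639) (by linarith) (by linarith)
        have h2 := mul_le_mul_of_nonneg_left hq (by linarith : 0 ≤ L)
        have : 0 < P / k := by positivity
        linarith
      · have h1 : L ≤ 0.171 * k := by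
          have h2 := Real.log_le_sub_one_of_pos (x := k / 17) (by positivity)
          have h3 : Real.log ((17:ℝ) ^ 11) ≤ Real.log ((2:ℝ) ^ 45) :=
            Real.log_le_log (by norm_num) (by norm_num)
          have h2u := Real.log_two_lt_d9
          rw [Real.log_pow, Real.log_pow] at h3
          push_cast at h3
          rw [Real.log_div (by positivity) (by norm_num), ← hL] at h2
          linarith
        have h2 : L * (P / k) ≤ 0.171 * P := by
          rw [← mul_div_assoc, div_le_iff₀ hk0]
          have := mul_le_mul_of_nonneg_right h1 hP0.le
          linarith
        have h3 : L ≤ ℓ := by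
          rw [hL, hℓ]; exact Real.log_le_log hk0 h
        have h4 : L * L ≤ 0.19 * P := by
          have h5 : L ≤ 5.5452 + s := by linarith
          have h6 := mul_le_mul h5 h5 (by linarith) (by linarith)
          have := sq_nonneg s
          linarith
        have h5 : 0 < P / k := by positivity
        linarith
    have h1 : L - 0.361 ≤ L * P / (L + P + P / k) := by
      rw [le_div_iff₀ (by positivity)]
      linarith
    have h2 : W / P ≤ L / (L + P + P / k) + (w + 0.365 - (L - ℓ)) / P := by
      rw [← sub_nonneg]
      have e : L / (L + P + P / k) + (w + 0.365 - (L - ℓ)) / P - W / P =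
          (L * P / (L + P + P / k) + (w + 0.365 - (L - ℓ)) - W) / P := by
        field_simp
      rw [e]
      exact div_nonneg (by linarith) hP0.le
    calc k * (W / P) ≤ k * (L / (L + P + P / k) + (w + 0.365 - (L - ℓ)) / P) := by gcongr
      _ = k * L / (L + P + P / k) + k / P * (w + 0.365 - (L - ℓ)) := by ring
      _ ≤ _ := by gcongr; exact le_max_right _ _
  · have hPk : P ≤ k := by
      rw [← Real.log_le_log_iff hP0 hk0, ← hL, ← hℓ]; linarith
    have hq : P / k ≤ 1 := (div_le_one hk0).2 hPk
    have hq0 : 0 < P / k := by positivity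
    have hWL : W ≤ L₀ - 0.361 := by linarith
    have h2 : W / P ≤ L / (L + P + P / k) := by
      rw [div_le_div_iff₀ hP0 (by positivity)]
      have h3 : (L₀ - 0.361) * (L + P + P / k) ≤ (L₀ - 0.361) * (L + P + 1) := by
        have : 0 ≤ L₀ - 0.361 := by linarith
        gcongr
      have h4 : W * (L + P + P / k) ≤ (L₀ - 0.361) * (L + P + P / k) := by
        have : 0 < L + P + P / k := by positivity
        gcongr
      have h5 : L₀ ≤ P := by
        have := mul_nonneg (by linarith : 0 ≤ L₀) (by linarith : 0 ≤ L₀ - 8)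
        linarith
      have h6 : (P - (L₀ - 0.361)) * L₀ ≤ (P - (L₀ - 0.361)) * L := by
        have : 0 ≤ P - (L₀ - 0.361) := by linarith
        gcongr
      linarith
    have h3 := mul_le_mul_of_nonneg_left h2 hk0.le
    have h4 : k * (L / (L + P + P / k)) = k * L / (L + P + P / k) := by ring
    have h5 := le_max_left 0 (k / P * (w + 0.365 - (L - ℓ)))
    linarith

theorem logTargetIncr_ge {k D : ℕ} (hD : 255 ≤ D) (hk : 17 ≤ k) (hDk : D + 1 < k ^ 2) :
    ((k:ℝ) / (D + 1) + 1) * Real.log (3 * (Nat.log 2 (D + 2) * (D + 2))) ≤ logTargetIncr k D := by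
  obtain ⟨P, hP⟩ : ∃ P : ℝ, P = D + 1 := ⟨_, rfl⟩
  have hβ8 : 8 ≤ Nat.log 2 (D + 2) := Nat.le_log_of_pow_le (by norm_num) (by omega)
  have hβpow : ((2:ℝ)) ^ (Nat.log 2 (D + 2)) ≤ P + 1 := by
    have := Nat.pow_log_le_self 2 (show D + 2 ≠ 0 by omega)
    have h : (2:ℝ) ^ (Nat.log 2 (D + 2)) ≤ ((D + 2 : ℕ) : ℝ) := by exact_mod_cast this
    push_cast at h
    linarith
  have hβR : (8:ℝ) ≤ Nat.log 2 (D + 2) := by exact_mod_cast hβ8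
  have hP256 : 256 ≤ P := by
    have : (255:ℝ) ≤ D := by exact_mod_cast hD
    linarith
  have hkR : (17:ℝ) ≤ k := by exact_mod_cast hk
  have hPk : P ≤ (k:ℝ) ^ 2 := by
    rw [hP]; exact_mod_cast hDk.le
  have hP0 : 0 < P := by linarith
  have hk0 : (0:ℝ) < k := by linarith
  obtain ⟨β, hβ⟩ : ∃ β : ℝ, β = Nat.log 2 (D + 2) := ⟨_, rfl⟩
  have hβlog : β * Real.log 2 ≤ Real.log (P + 1) := by
    have := Real.log_le_log (by positivity) hβpow
    rw [Real.log_pow] at this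
    rwa [hβ]
  rw [logTargetIncr, logRatio, show (D + 2 : ℝ) = P + 1 by rw [hP]; ring,
    show ((D + 1 : ℕ) : ℝ) = P by rw [hP]; push_cast; rfl, ← hP, ← hβ]
  rw [← hβ] at hβR
  clear hβpow
  obtain ⟨L, hL⟩ : ∃ L, L = Real.log k := ⟨_, rfl⟩
  obtain ⟨ℓ, hℓ⟩ : ∃ ℓ, ℓ = Real.log P := ⟨_, rfl⟩
  obtain ⟨w, hw⟩ : ∃ w, w = Real.log (3 * β) := ⟨_, rfl⟩
  have h2l := Real.log_two_gt_d9
  have h2u := Real.log_two_lt_d9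
  obtain ⟨h3l, h3u⟩ := log_three_bounds
  obtain ⟨h256l, h256u⟩ := log_256_bounds
  have hℓ8 : Real.log 256 ≤ ℓ := by rw [hℓ]; exact Real.log_le_log (by norm_num) hP256
  have hℓL : ℓ ≤ 2 * L := by
    have := Real.log_le_log hP0 hPk
    rw [Real.log_pow] at this
    rw [hℓ, hL]; exact_mod_cast this
  have hL17 : 2.832 ≤ L := by
    have h : Real.log ((2:ℝ) ^ 94) ≤ Real.log ((17:ℝ) ^ 23) :=
      Real.log_le_log (by norm_num) (by norm_num)
    rw [Real.log_pow, Real.log_pow] at h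
    have : Real.log 17 ≤ L := by rw [hL]; exact Real.log_le_log (by norm_num) hkR
    push_cast at h
    linarith
  have hlogP1 : Real.log (P + 1) ≤ ℓ + 0.004 := by
    have h1 := Real.log_le_sub_one_of_pos (x := (P + 1) / P) (by positivity)
    rw [Real.log_div (by positivity) (by positivity), ← hℓ] at h1
    have h2 : (P + 1) / P - 1 = 1 / P := by field_simp; ring
    have h3 : 1 / P ≤ 1 / 256 := one_div_le_one_div_of_le (by norm_num) hP256
    linarith
  have hβℓ : β ≤ 1.4427 * ℓ + 0.006 := by nlinarith
  have hwβ : w ≤ 2.1783 + β / 8 := by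
    have h1 := Real.log_le_sub_one_of_pos (x := β / 8) (by positivity)
    rw [Real.log_div (by positivity) (by norm_num), show (8:ℝ) = 2 ^ 3 by norm_num,
      Real.log_pow] at h1
    push_cast at h1
    rw [hw, Real.log_mul (by norm_num) (by positivity)]
    linarith
  have hw3 : 3 ≤ w := by
    rw [hw, Real.le_log_iff_exp_le (by positivity)]
    have : Real.exp 3 = Real.exp 1 ^ 3 := by rw [← Real.exp_nat_mul]; norm_num
    rw [this]
    calc Real.exp 1 ^ 3 ≤ 2.7182818286 ^ 3 := by gcongr; exact Real.exp_one_lt_d9.le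
      _ ≤ 3 * 8 := by norm_num
      _ ≤ _ := by linarith
  have hW : Real.log (3 * (β * (P + 1))) ≤ ℓ + w + 0.004 := by
    rw [← mul_assoc, Real.log_mul (by positivity) (by positivity), ← hw]
    linarith
  have hlogL : Real.log (L + 1) ≤ L / 8 + 1.2045 := by
    have h1 := Real.log_le_sub_one_of_pos (x := (L + 1) / 8) (by positivity)
    rw [Real.log_div (by positivity) (by norm_num), show (8:ℝ) = 2 ^ 3 by norm_num,
      Real.log_pow] at h1
    push_cast at h1
    linarith
  have hmain := step_numeric_main (L := L) (ℓ := ℓ) (u := L - ℓ) (w := w) (β := β)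
    (ψ := Real.log (1 + (L / P + (k:ℝ)⁻¹)⁻¹)) rfl (by linarith) hℓL hL17 (by linarith) hβℓ hw hwβ
    hw3 ?_ ?_
  · have hexp : Real.exp (L - ℓ) = k / P := by
      rw [Real.exp_sub, hL, hℓ, Real.exp_log hk0, Real.exp_log hP0]
    rw [hexp] at hmain
    rw [← hL, ← hℓ]
    set W := Real.log (3 * (β * (P + 1))) with hWdef
    have hkey : k / P * W ≤ k * L / (L + P + P / k) + max 0 (k / P * (w + 0.365 - (L - ℓ))) :=
      step_numeric_loss hkR hP256 hL hℓ hL17 hw3 hβℓ hwβ hW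
    have hP1 : 256 / 257 ≤ P / (P + 1) := by
      rw [div_le_div_iff₀ (by norm_num) (by positivity)]; linarith
    linarith
  · intro hu
    have hkP : k ≤ P := by
      rw [← Real.log_le_log_iff hk0 hP0, ← hL, ← hℓ]; linarith
    have h1 : (k:ℝ) / (L + 1) ≤ 1 + (L / P + (k:ℝ)⁻¹)⁻¹ := by
      have : L / P + (k:ℝ)⁻¹ ≤ (L + 1) / k := by
        rw [add_div, one_div]; gcongr
      have h := inv_anti₀ (by positivity) this
      rw [inv_div] at h
      linarith
    have h2 := Real.log_le_log (by positivity) h1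
    rw [Real.log_div (by positivity) (by positivity), ← hL] at h2
    linarith
  · intro hu
    have hkP : P ≤ k := by
      rw [← Real.log_le_log_iff hP0 hk0, ← hL, ← hℓ]; linarith
    have h1 : P / (L + 1) ≤ 1 + (L / P + (k:ℝ)⁻¹)⁻¹ := by
      have : L / P + (k:ℝ)⁻¹ ≤ (L + 1) / P := by
        rw [add_div, one_div]; gcongr
      have h := inv_anti₀ (by positivity) this
      rw [inv_div] at h
      linarith
    have h2 := Real.log_le_log (by positivity) h1
    rw [Real.log_div (by positivity) (by positivity), ← hℓ] at h2
    linarith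

theorem le_exp_logTarget {k D : ℕ} (hk : 3 ≤ k) (hD : 255 ≤ D) :
    16 * ((D:ℝ) + 2) ≤ Real.exp (logTarget k D) := by
  have h1 := mul_log_le_logTarget hk (by omega : 1 ≤ D)
  have hDR : (255:ℝ) ≤ D := by exact_mod_cast hD
  calc 16 * ((D:ℝ) + 2) ≤ (D + 1 : ℝ) ^ 2 := by nlinarith
    _ ≤ (D + 1 : ℝ) ^ D := pow_le_pow_right₀ (by linarith) (by omega)
    _ = Real.exp (D * Real.log (D + 1)) := by
        rw [Real.exp_nat_mul, Real.exp_log (by positivity)]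
    _ ≤ _ := Real.exp_le_exp.2 h1

theorem log_four_mul_le_logTargetIncr {k D : ℕ} (hk : 3 ≤ k) (hD : 1 ≤ D) (hkD : k ^ 2 ≤ D + 1) :
    Real.log (4 * k) ≤ logTargetIncr k D := by
  have hk3 : (3:ℝ) ≤ k := by exact_mod_cast hk
  have hk0 : (0:ℝ) < k := by linarith
  have hDR : (1:ℝ) ≤ D := by exact_mod_cast hD
  obtain ⟨h3l, h3u⟩ := log_three_bounds
  have hL3 : Real.log 3 ≤ Real.log k := Real.log_le_log (by norm_num) hk3
  have h4 : Real.log 4 = 2 * Real.log 2 := by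
    rw [show (4:ℝ) = 2 ^ 2 by norm_num, Real.log_pow]; norm_num
  have h2u := Real.log_two_lt_d9
  have hP : 2 * Real.log k ≤ Real.log (D + 1) := by
    have h : (k:ℝ) ^ 2 ≤ D + 1 := by exact_mod_cast hkD
    have := Real.log_le_log (by positivity) h
    rw [Real.log_pow] at this
    exact_mod_cast this
  have hL : 0 < Real.log k := by linarith
  have h1 : 0 ≤ k * Real.log k / (Real.log k + (D + 1) + (D + 1) / k) := by positivity
  have h2 : 0 ≤ (D + 1 : ℝ) / (D + 2) := by positivity
  have h5 : 0 ≤ logRatio k (D + 1) := Real.log_nonneg (by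
    have : (0:ℝ) ≤ (Real.log k / (D + 1 : ℕ) + (k:ℝ)⁻¹)⁻¹ := by positivity
    linarith)
  rw [Real.log_mul (by norm_num) hk0.ne', logTargetIncr]
  linarith

theorem exBound_exp_logTarget {k : ℕ} (hk : 3 ≤ k)
    (h : ExBound 256 k (Real.exp (logTarget k 255))) {D : ℕ} (hD : 255 ≤ D) :
    ExBound (D + 1) k (Real.exp (logTarget k D)) := by
  induction D, hD using Nat.le_induction with
  | base => exact h
  | succ D hD ih =>
    have hG := le_exp_logTarget hk hD
    have hincr := logTarget_add_incr_le (by omega : 2 ≤ k) (by omega : 1 ≤ D)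
    have hk0 : (0:ℝ) < k := by exact_mod_cast (by omega : 0 < k)
    rcases le_or_gt (k ^ 2) (D + 1) with hkD | hkD
    · refine (ih.step_coarse (by omega) (by omega) hkD (by push_cast; linarith)).mono ?_
      have h1 := log_four_mul_le_logTargetIncr hk (by omega) hkD
      rw [← Real.log_le_log_iff (by positivity) (Real.exp_pos _), Real.log_exp,
        Real.log_mul (by positivity) (Real.exp_pos _).ne', Real.log_exp]
      linarith
    · have hk17 : 17 ≤ k := by nlinarith
      have hr : k ≤ ((k - 2) / (D + 1) + 1) * (D + 1) + 1 := by
        have h1 := Nat.div_add_mod (k - 2) (D + 1)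
        have h2 := Nat.mod_lt (k - 2) (by omega : D + 1 > 0)
        rw [add_mul, mul_comm]
        omega
      refine (ih.step_log (r := (k - 2) / (D + 1) + 1) (by omega) (by push_cast; linarith)
        (Nat.le_add_left _ _) hr).mono ?_
      have h1 := logTargetIncr_ge hD hk17 hkD
      have hβ : 8 ≤ Nat.log 2 (D + 1 + 1) := Nat.le_log_of_pow_le (by norm_num) (by omega)
      have hβR : (8:ℝ) ≤ Nat.log 2 (D + 1 + 1) := by exact_mod_cast hβ
      have hrR : (((k - 2) / (D + 1) + 1 : ℕ) : ℝ) ≤ k / (D + 1) + 1 := by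
        push_cast
        have h2 : (((k - 2) / (D + 1) : ℕ) : ℝ) ≤ ((k - 2 : ℕ) : ℝ) / ((D + 1 : ℕ) : ℝ) :=
          Nat.cast_div_le
        have h3 : ((k - 2 : ℕ) : ℝ) ≤ k := by exact_mod_cast Nat.sub_le _ _
        have h4 : ((k - 2 : ℕ) : ℝ) / ((D + 1 : ℕ) : ℝ) ≤ k / (D + 1) := by push_cast; gcongr
        linarith
      rw [← Real.log_le_log_iff (by positivity) (Real.exp_pos _), Real.log_exp,
        Real.log_mul (by positivity) (Real.exp_pos _).ne', Real.log_exp, Real.log_pow]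
      have e : (3 * ((Nat.log 2 (D + 1 + 1) : ℝ) * ((D + 1 : ℕ) + 1))) =
        3 * (Nat.log 2 (D + 2) * (D + 2)) := by push_cast; ring
      rw [e]
      have h0 : 0 ≤ Real.log (3 * (Nat.log 2 (D + 2) * (D + 2) : ℝ)) := by
        refine Real.log_nonneg ?_
        have : (0:ℝ) ≤ D := D.cast_nonneg
        have : (8:ℝ) ≤ Nat.log 2 (D + 2) := hβR
        nlinarith
      have h2 := mul_le_mul_of_nonneg_right hrR h0
      linarith

theorem log2_mul_log_two_le {m : ℕ} (hm : 1 ≤ m) : (Nat.log2 m : ℝ) * Real.log 2 ≤ Real.log m := by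
  have h : ((2 ^ Nat.log2 m : ℕ) : ℝ) ≤ m := by exact_mod_cast Nat.log2_self_le (by omega)
  have := Real.log_le_log (by positivity) h
  rwa [Nat.cast_pow, Real.log_pow, Nat.cast_ofNat] at this

theorem log_le_log2_add_one_mul (m : ℕ) :
    Real.log m ≤ ((Nat.log2 m + 1 : ℕ) : ℝ) * Real.log 2 := by
  rcases Nat.eq_zero_or_pos m with rfl | hm
  · simp; positivity
  have h : (m:ℝ) ≤ ((2 ^ (Nat.log2 m + 1) : ℕ) : ℝ) := by exact_mod_cast Nat.lt_log2_self.le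
  have := Real.log_le_log (by positivity) h
  rwa [Nat.cast_pow, Real.log_pow, Nat.cast_ofNat] at this

theorem finalBound_le {k₁ k₂ k : ℕ} (hk₁ : 3 ≤ k₁) (hk : k₁ ≤ k) (hk₂ : k ≤ k₂) :
    (finalBound k₁ k₂ : ℝ) ≤ Real.exp (logTarget k 255) := by
  have hb : Nat.ble k₁ 2 = false := by
    rw [← Bool.not_eq_true, Nat.ble_eq]; omega
  obtain ⟨a, ha⟩ : ∃ a, a = Nat.log2 (k₁ ^ 64) := ⟨_, rfl⟩
  obtain ⟨Q, hQ⟩ : ∃ Q, Q = 6932 * (Nat.log2 (k₂ ^ 64) + 1) * k₁ + 163200000 := ⟨_, rfl⟩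
  obtain ⟨p, hp⟩ : ∃ p, p = Nat.log2 ((163200000 * k₁ + Q) ^ 64 / Q ^ 64) := ⟨_, rfl⟩
  rw [finalBound, hb, ← ha, ← hQ, ← hp, cond_false, Nat.cast_pow, Nat.cast_ofNat]
  rw [← Real.log_le_log_iff (by positivity) (Real.exp_pos _), Real.log_exp, Real.log_pow]
  have h2l := Real.log_two_gt_d9
  have h2u := Real.log_two_lt_d9
  have hk₁0 : (0:ℝ) < k₁ := by exact_mod_cast (by omega : 0 < k₁)
  have hkR : (k₁:ℝ) ≤ k := by exact_mod_cast hk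
  have hk0 : (0:ℝ) < k := by linarith
  have hL : a * Real.log 2 ≤ 64 * Real.log k := by
    have h := log2_mul_log_two_le (m := k₁ ^ 64) (Nat.pos_of_ne_zero (by positivity))
    rw [← ha, Nat.cast_pow, Real.log_pow] at h
    have := Real.log_le_log hk₁0 hkR
    push_cast at h
    linarith
  have hLu : 64 * Real.log k ≤ ((Nat.log2 (k₂ ^ 64) + 1 : ℕ) : ℝ) * Real.log 2 := by
    have h := log_le_log2_add_one_mul (k₂ ^ 64)
    rw [Nat.cast_pow, Real.log_pow] at h
    have := Real.log_le_log hk0 (by exact_mod_cast hk₂ : (k:ℝ) ≤ k₂)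
    push_cast at h ⊢
    linarith
  have hQ0 : (0:ℝ) < Q := by exact_mod_cast (by omega : 0 < Q)
  have ht : Real.log k / 255 + (k:ℝ)⁻¹ ≤ Q / (163200000 * k₁) := by
    have h1 : (k:ℝ)⁻¹ ≤ (k₁:ℝ)⁻¹ := by gcongr
    have h2 : Real.log k ≤ ((Nat.log2 (k₂ ^ 64) + 1 : ℕ) : ℝ) * 0.6932 / 64 := by
      have : ((Nat.log2 (k₂ ^ 64) + 1 : ℕ) : ℝ) * Real.log 2 ≤
        ((Nat.log2 (k₂ ^ 64) + 1 : ℕ) : ℝ) * 0.6932 := by gcongr; linarith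
      linarith
    have e : (Q:ℝ) / (163200000 * k₁) =
        ((Nat.log2 (k₂ ^ 64) + 1 : ℕ) : ℝ) * 0.6932 / 64 / 255 + (k₁:ℝ)⁻¹ := by
      rw [hQ]; push_cast; field_simp; ring
    rw [e]
    gcongr
  have hψ : p * Real.log 2 ≤ 64 * logRatio k 255 := by
    have h0 : 0 < Real.log k := by
      have : (3:ℝ) ≤ k₁ := by exact_mod_cast hk₁
      exact Real.log_pos (by linarith)
    have h1 : ((163200000 * k₁ + Q : ℕ) : ℝ) / Q ≤ 1 + (Real.log k / (255:ℕ) + (k:ℝ)⁻¹)⁻¹ := by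
      have : (Q / (163200000 * k₁) : ℝ)⁻¹ ≤ (Real.log k / (255:ℕ) + (k:ℝ)⁻¹)⁻¹ := by
        push_cast; gcongr
      refine le_trans (le_of_eq ?_) (add_le_add_right this 1)
      push_cast; field_simp; ring
    have h2 := Real.log_le_log (div_pos (by push_cast; positivity) hQ0) h1
    have h3 : 1 ≤ (163200000 * k₁ + Q) ^ 64 / Q ^ 64 :=
      (Nat.one_le_div_iff (Nat.pow_pos (by omega))).2 (Nat.pow_le_pow_left (by omega) _)
    have h4 := log2_mul_log_two_le h3
    rw [← hp] at h4
    have h5 := Real.log_le_log (by exact_mod_cast h3) (Nat.cast_div_le (α := ℝ) (m := (163200000 * k₁ + Q) ^ 64) (n := Q ^ 64))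
    rw [Nat.cast_pow, Nat.cast_pow, ← div_pow, Real.log_pow] at h5
    rw [logRatio]
    push_cast at *
    linarith
  have h3 : (104550:ℝ) * Real.log 2 ≤ 64 * (255 * Real.log 256 - 255 * Real.log 3) := by
    have h := Real.log_le_log (by norm_num) (by norm_num : (3:ℝ) ^ 64 ≤ 2 ^ 102)
    rw [Real.log_pow, Real.log_pow] at h
    rw [show (256:ℝ) = 2 ^ 8 by norm_num, Real.log_pow]
    push_cast at h ⊢
    linarith
  have hdiv : (((2 * k₁ * a + (2 * k₁ * a * 1083 / 100000 + 765) * p + 769 * a + 209100) / 128 : ℕ) : ℝ)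
      ≤ (2 * k₁ * a + (2 * k₁ * a * (1083 / 100000) + 765) * p + 769 * a + 209100) / 128 := by
    refine Nat.cast_div_le.trans ?_
    push_cast
    have : ((2 * k₁ * a * 1083 / 100000 : ℕ) : ℝ) ≤ 2 * k₁ * a * (1083 / 100000) := by
      refine Nat.cast_div_le.trans (le_of_eq ?_)
      push_cast; ring
    gcongr
  have hkL : (k₁ : ℝ) * (a * Real.log 2) ≤ 64 * (k * Real.log k) := by
    have := mul_le_mul hkR hL (by positivity) hk0.le
    linarith
  have hψ0 : 0 ≤ p * Real.log 2 := by positivity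
  have hprod : (k₁ * (a * Real.log 2) / 64 + 765 / 2) * (p * Real.log 2) ≤
      (k * Real.log k + 765 / 2) * (64 * logRatio k 255) := by
    have : k₁ * (a * Real.log 2) / 64 + 765 / 2 ≤ k * Real.log k + 765 / 2 := by linarith
    refine mul_le_mul this hψ hψ0 (le_trans (by positivity) this)
  have hlast : 2 * k₁ * a * (1083 / 100000) * p * Real.log 2 ≤ k₁ * (a * Real.log 2) / 32 * (p * Real.log 2) := by
    have : k₁ * a * (1083 / 50000) * (p * Real.log 2) ≤ k₁ * a * (Real.log 2 / 32) * (p * Real.log 2) := by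
      have : (1083 / 50000 : ℝ) ≤ Real.log 2 / 32 := by linarith
      gcongr
    linarith
  have := mul_le_mul_of_nonneg_right hdiv (by positivity : 0 ≤ Real.log 2)
  rw [logTarget]
  push_cast at *
  rw [show (255:ℝ) + 1 = 256 by norm_num]
  linarith

theorem exBound_exp_logTarget_base {k : ℕ} (hk : 3 ≤ k) (hk' : k < 1024) :
    ExBound 256 k (Real.exp (logTarget k 255)) := by
  obtain ⟨-, k₁, k₂, h2, h3, h4, h5, h⟩ := exBound_small (by omega : 2 ≤ k) hk'
  exact h.mono (finalBound_le (by omega) h3 h4)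

theorem exBound_two {D : ℕ} (hD : 255 ≤ D) :
    ExBound (D + 1) 2 (2 ^ (D + 1) * (18 * (D + 1)) ^ D) := by
  induction D, hD using Nat.le_induction with
  | base =>
    obtain ⟨-, k₁, k₂, h2, h3, -, -, h⟩ := exBound_small le_rfl (by norm_num : 2 < 1024)
    obtain rfl : k₁ = 2 := by omega
    refine h.mono (le_of_eq ?_)
    rw [finalBound, show Nat.ble 2 2 = true from rfl, cond_true]
    push_cast
    norm_num
  | succ D hD ih =>
    have hDR : (255:ℝ) ≤ D := by exact_mod_cast hD
    refine (ih.step_coarse (by omega) le_rfl (by omega) ?_).mono ?_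
    · have h1 : (1:ℝ) ≤ 2 ^ (D + 1) := one_le_pow₀ (by norm_num)
      have h2 : 18 * ((D:ℝ) + 1) ≤ (18 * (D + 1)) ^ D := le_self_pow₀ (by linarith) (by omega)
      push_cast
      nlinarith
    · have h2 : (18 * ((D:ℝ) + 1)) ^ D ≤ (18 * (D + 1 + 1)) ^ D := by gcongr; linarith
      push_cast
      calc 4 * 2 * (2 ^ (D + 1) * (18 * ((D:ℝ) + 1)) ^ D)
          ≤ 4 * 2 * (2 ^ (D + 1) * (18 * ((D:ℝ) + 1 + 1)) ^ D) := by gcongr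
        _ = 8 * (2 ^ (D + 1) * (18 * ((D:ℝ) + 1 + 1)) ^ D) := by ring
        _ ≤ 2 * (18 * (D + 1 + 1)) * (2 ^ (D + 1) * (18 * ((D:ℝ) + 1 + 1)) ^ D) := by
            gcongr; linarith
        _ = _ := by ring

theorem two_pow_mul_le_target {D : ℕ} (hD : 1 ≤ D) :
    2 ^ (D + 1) * (18 * (D + 1)) ^ D ≤ target 2 D := by
  have h := lt_sideLen_of_pow_lt (k := 2) (m := 2) hD (by norm_num)
    (Nat.pow_lt_pow_right (by norm_num) (by omega))
  have h2 : Nat.choose 4 2 ≤ (sideLen 2 D + 1).choose 2 := Nat.choose_le_choose _ (by omega)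
  rw [target]
  refine Nat.mul_le_mul_left _ (Nat.pow_le_pow_left ?_ _)
  calc 18 * (D + 1) = (D + 1) * 3 * Nat.choose 4 2 := by norm_num [Nat.choose]; ring
    _ ≤ _ := by gcongr; exact h

/-- Verification that `D * ((1 + t) * log (1 + t) - t * log t)` is at least `s * log 2 / 2 ^ 26`
for a rational lower bound `t` of `1024 ^ (1 / D) - 1`. -/
noncomputable def rateCheck (D s : ℕ) : Bool :=
  forceNat (Nat.mul 8 D) fun b =>
  forceNat (bitSearch (fun a => Nat.ble (Nat.pow (Nat.add a b) D)
    (Nat.mul 1024 (Nat.pow b D))) 14 0) fun a =>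
  Nat.ble (Nat.mul (Nat.pow 2 (s / 2 ^ 21 + 1)) (Nat.mul (Nat.pow a (4 * a)) (Nat.pow b (4 * b))))
    (Nat.pow (a + b) (4 * (a + b)))

/-- Verification of the steps for all large exponents at once: `s` and `σ` accumulate upper bounds
for the sums of `log E / D` (in units of `log 2 / 2 ^ 26`) and of `log E`
(in units of `log 2 / 64`). -/
noncomputable def sumsCheck : ℕ → ℕ → ℕ → List (List StepEntry) → Bool
  | _, s, σ, [] => Nat.ble s 3032000000 && Nat.ble σ 170000
  | D, s, σ, row :: rows =>
    forceNat D fun D => forceNat (pickFactor 4 0 row) fun E =>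
    forceNat (Nat.log2 (Nat.pow E 64) + 1) fun e =>
    forceNat (s + (e * 2 ^ 20 / D + 1)) fun s => forceNat (σ + e) fun σ =>
    Nat.ble 4 E && Nat.ble σ (64 * (14 * D + 10)) && rateCheck D s && sumsCheck (D + 1) s σ rows

theorem sumsCheck_stepTable : sumsCheck 1 0 0 stepTable = true := by decide +kernel

/-- The constant described by the accumulated sums. -/
noncomputable def sumsBound (k s σ : ℕ) : ℝ :=
  Real.exp (Real.log k + (k - 2) * (s * (Real.log 2 / 2 ^ 26)) + σ * (Real.log 2 / 64))

theorem pow_mul_sumsBound_le {k D E e s σ : ℕ} (hk : 2 ≤ k) (hD : 1 ≤ D) (hE : 1 ≤ E)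
    (he : Real.log E ≤ e * (Real.log 2 / 64)) :
    (E:ℝ) ^ ((k - 2) / D + 1) * sumsBound k s σ ≤
      sumsBound k (s + (e * 2 ^ 20 / D + 1)) (σ + e) := by
  have hE0 : (1:ℝ) ≤ E := by exact_mod_cast hE
  have hD0 : (0:ℝ) < D := by exact_mod_cast hD
  have hk2 : (2:ℝ) ≤ k := by exact_mod_cast hk
  have h2 : 0 < Real.log 2 := Real.log_pos (by norm_num)
  rw [sumsBound, sumsBound, ← Real.log_le_log_iff (by positivity) (Real.exp_pos _),
    Real.log_mul (by positivity) (Real.exp_pos _).ne', Real.log_exp, Real.log_exp, Real.log_pow]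
  have h1 : (((k - 2) / D + 1 : ℕ) : ℝ) ≤ (k - 2) / D + 1 := by
    have : (((k - 2) / D : ℕ) : ℝ) ≤ ((k - 2 : ℕ) : ℝ) / D := Nat.cast_div_le
    rw [Nat.cast_sub hk] at this
    push_cast at this ⊢
    linarith
  have h3 : (e:ℝ) * 2 ^ 20 / D ≤ ((e * 2 ^ 20 / D + 1 : ℕ) : ℝ) := by
    have h := Nat.lt_div_mul_add (a := e * 2 ^ 20) hD
    rw [div_le_iff₀ hD0]
    have : e * 2 ^ 20 ≤ (e * 2 ^ 20 / D + 1) * D := by rw [add_mul, one_mul]; exact h.le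
    exact_mod_cast this
  have h4 : (((k - 2) / D + 1 : ℕ) : ℝ) * Real.log E ≤
      ((k - 2) / D + 1) * (e * (Real.log 2 / 64)) := by
    refine mul_le_mul h1 he (Real.log_nonneg hE0) ?_
    have : (0:ℝ) ≤ k - 2 := by linarith
    positivity
  have h5 : ((k:ℝ) - 2) * ((e:ℝ) * 2 ^ 20 / D * (Real.log 2 / 2 ^ 26)) ≤
      (k - 2) * (((e * 2 ^ 20 / D + 1 : ℕ) : ℝ) * (Real.log 2 / 2 ^ 26)) := by
    have : (0:ℝ) ≤ k - 2 := by linarith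
    gcongr
  have e1 : ((k - 2) / D + 1) * (e * (Real.log 2 / 64)) =
      ((k:ℝ) - 2) * ((e:ℝ) * 2 ^ 20 / D * (Real.log 2 / 2 ^ 26)) + e * (Real.log 2 / 64) := by
    ring
  rw [Nat.cast_add s, Nat.cast_add σ]
  rw [e1] at h4
  linarith

theorem exBound_sumsBound {k : ℕ} (hk : 1024 ≤ k) {rows : List (List StepEntry)} :
    ∀ {D s σ : ℕ}, 1 ≤ D → D + rows.length ≤ 256 → tableCheck D rows = true →
      sumsCheck D s σ rows = true → 16 * ((D:ℝ) + 1) ≤ sumsBound k s σ →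
      ExBound D k (sumsBound k s σ) →
      (∀ i < rows.length, ∃ s σ, σ ≤ 64 * (14 * (D + i) + 10) ∧ rateCheck (D + i) s = true ∧
        ExBound (D + i + 1) k (sumsBound k s σ)) ∧
      ∃ s σ, s ≤ 3032000000 ∧ σ ≤ 170000 ∧ ExBound (D + rows.length) k (sumsBound k s σ) := by
  induction rows with
  | nil =>
    intro D s σ _ _ _ hc _ hG
    rw [sumsCheck, Bool.and_eq_true, Nat.ble_eq, Nat.ble_eq] at hc
    exact ⟨fun i hi => by simp at hi, s, σ, hc.1, hc.2, hG⟩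
  | cons row rows ih =>
    intro D s σ hD hDl ht hc hw hG
    rw [List.length_cons] at hDl
    simp only [tableCheck, Bool.and_eq_true] at ht
    simp only [sumsCheck, forceNat_eq, Bool.and_eq_true, Nat.ble_eq] at hc
    obtain ⟨⟨⟨hE, hσ⟩, hrate⟩, hrec⟩ := hc
    have hr : 4 ≤ (k - 2) / D + 1 := by
      have : 3 ≤ (k - 2) / D := (Nat.le_div_iff_mul_le hD).2 (by omega)
      omega
    rcases StepGood.of_pickFactor hr ht.1 (b := 0) (.inl rfl) with h0 | hgood
    · exact absurd (h0 ▸ hE) (by norm_num)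
    change 4 ≤ pickFactor 4 0 row at hE
    change σ + (Nat.log2 ((pickFactor 4 0 row) ^ 64) + 1) ≤ _ at hσ
    change rateCheck D (s + ((Nat.log2 ((pickFactor 4 0 row) ^ 64) + 1) * 2 ^ 20 / D + 1)) = true
      at hrate
    change sumsCheck (D + 1) (s + ((Nat.log2 ((pickFactor 4 0 row) ^ 64) + 1) * 2 ^ 20 / D + 1))
      (σ + (Nat.log2 ((pickFactor 4 0 row) ^ 64) + 1)) rows = true at hrec
    generalize pickFactor 4 0 row = E at *
    have he : Real.log E ≤ ((Nat.log2 (E ^ 64) + 1 : ℕ) : ℝ) * (Real.log 2 / 64) := by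
      have h := log_le_log2_add_one_mul (E ^ 64)
      rw [Nat.cast_pow, Real.log_pow] at h
      push_cast at h ⊢
      linarith
    generalize Nat.log2 (E ^ 64) + 1 = e at *
    have hstep := pow_mul_sumsBound_le (s := s) (σ := σ) (by omega : 2 ≤ k) hD (by omega : 1 ≤ E) he
    have hkr : k ≤ ((k - 2) / D + 1) * D + 1 := by
      have := Nat.div_add_mod (k - 2) D
      have := Nat.mod_lt (k - 2) (by omega : D > 0)
      rw [add_mul, mul_comm]
      omega
    have hD0 : (1:ℝ) ≤ D := by exact_mod_cast hD
    have hG' := (hgood k _ (by omega) hkr hG (by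
      have : stepWeight D ≤ 16 := by unfold stepWeight; split <;> norm_num
      have : ((stepWeight D : ℕ) : ℝ) ≤ 16 := by exact_mod_cast this
      push_cast
      nlinarith)).mono hstep
    have hw' : 16 * (((D + 1 : ℕ) : ℝ) + 1) ≤ sumsBound k (s + (e * 2 ^ 20 / D + 1)) (σ + e) := by
      refine le_trans ?_ hstep
      have hE4 : (4:ℝ) ≤ E := by exact_mod_cast hE
      have : (4:ℝ) ≤ (E:ℝ) ^ ((k - 2) / D + 1) :=
        hE4.trans (le_self_pow₀ (by linarith) (by omega))
      push_cast
      nlinarith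
    obtain ⟨ih₁, ih₂⟩ := ih (by omega) (by omega) ht.2 hrec hw' hG'
    refine ⟨fun i hi => ?_, by rwa [List.length_cons, Nat.add_comm rows.length, ← Nat.add_assoc]⟩
    rcases Nat.eq_zero_or_pos i with rfl | hi0
    · exact ⟨_, _, hσ, hrate, hG'⟩
    · have := ih₁ (i - 1) (by simp at hi; omega)
      rwa [show D + 1 + (i - 1) = D + i by omega] at this

theorem entropy_le {a b t : ℝ} (ha : 0 ≤ a) (hb : 0 < b) (ht : 0 < t) :
    (a + b) * Real.log (a + b) - a * Real.log a - b * Real.log b ≤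
      b * Real.log (1 + t) + a * Real.log (1 + t⁻¹) := by
  have h1 := Real.one_sub_inv_le_log_of_pos (by positivity : 0 < b * (1 + t) / (a + b))
  rw [Real.log_div (by positivity) (by positivity), Real.log_mul hb.ne' (by positivity)] at h1
  have h1' := mul_le_mul_of_nonneg_left h1 hb.le
  have e1 : b * (1 - (b * (1 + t) / (a + b))⁻¹) = b - (a + b) / (1 + t) := by field_simp
  rw [e1] at h1'
  rcases ha.eq_or_lt with rfl | ha'
  · have : 0 ≤ b * Real.log (1 + t) := mul_nonneg hb.le (Real.log_nonneg (by linarith))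
    simp only [zero_add, zero_mul]
    linarith
  have h2 := Real.one_sub_inv_le_log_of_pos (by positivity : 0 < a * (1 + t⁻¹) / (a + b))
  rw [Real.log_div (by positivity) (by positivity), Real.log_mul ha'.ne' (by positivity)] at h2
  have h2' := mul_le_mul_of_nonneg_left h2 ha
  have e2 : a * (1 - (a * (1 + t⁻¹) / (a + b))⁻¹) = a - (a + b) * t / (1 + t) := by
    field_simp
    ring
  rw [e2] at h2'
  have e3 : b - (a + b) / (1 + t) + (a - (a + b) * t / (1 + t)) = 0 := by field_simp; ring
  linarith

theorem le_of_rateCheck {D s k y : ℕ} (hD : 1 ≤ D) (hk : 1024 ≤ k) (hy : 1 ≤ y)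
    (hky : (k:ℝ) * (k:ℝ) ^ ((D:ℝ)⁻¹) ≤ k + y) (h : rateCheck D s = true) :
    s * (Real.log 2 / 2 ^ 26) ≤
      D * (Real.log (1 + (y:ℝ) / k) + (y:ℝ) / k * Real.log (1 + (k:ℝ) / y)) := by
  simp only [rateCheck, forceNat_eq] at h
  change Nat.ble (2 ^ (s / 2 ^ 21 + 1) * (bitSearch (fun a => Nat.ble ((a + 8 * D) ^ D)
    (1024 * (8 * D) ^ D)) 14 0 ^ (4 * bitSearch (fun a => Nat.ble ((a + 8 * D) ^ D)
    (1024 * (8 * D) ^ D)) 14 0) * (8 * D) ^ (4 * (8 * D))))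
    ((bitSearch (fun a => Nat.ble ((a + 8 * D) ^ D) (1024 * (8 * D) ^ D)) 14 0 + 8 * D) ^
      (4 * (bitSearch (fun a => Nat.ble ((a + 8 * D) ^ D)
    (1024 * (8 * D) ^ D)) 14 0 + 8 * D))) = true at h
  have hroot := bitSearch_spec (p := fun a => Nat.ble ((a + 8 * D) ^ D) (1024 * (8 * D) ^ D)) 14
    (a := 0) (by
      rw [Nat.ble_eq, zero_add]
      exact Nat.le_mul_of_pos_left _ (by norm_num))
  generalize bitSearch (fun a => Nat.ble ((a + 8 * D) ^ D) (1024 * (8 * D) ^ D)) 14 0 = a at *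
  rw [Nat.ble_eq] at h hroot
  obtain ⟨b, hb⟩ : ∃ b, b = 8 * D := ⟨_, rfl⟩
  rw [← hb] at h hroot
  have hD0 : (0:ℝ) < D := by exact_mod_cast hD
  have hk0 : (0:ℝ) < k := by exact_mod_cast (by omega : 0 < k)
  have hy0 : (0:ℝ) < y := by exact_mod_cast hy
  have hb0 : (0:ℝ) < b := by exact_mod_cast (by omega : 0 < b)
  have ha0 : (0:ℝ) ≤ a := a.cast_nonneg
  have hab : (a:ℝ) ≤ b * (y / k) := by
    have h1 : (((a:ℝ) + b) / b) ^ D ≤ k := by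
      have h2 : ((a:ℝ) + b) ^ D ≤ 1024 * b ^ D := by exact_mod_cast hroot
      rw [div_pow, div_le_iff₀ (by positivity)]
      refine h2.trans ?_
      gcongr
      exact_mod_cast hk
    have h2 : ((a:ℝ) + b) / b ≤ (k:ℝ) ^ ((D:ℝ)⁻¹) := by
      rw [← Real.pow_rpow_inv_natCast (by positivity : 0 ≤ ((a:ℝ) + b) / b) (by omega : D ≠ 0)]
      gcongr
    have h3 := (mul_le_mul_of_nonneg_left h2 hk0.le).trans hky
    rw [mul_div_assoc', div_le_iff₀ hb0] at h3
    rw [mul_div_assoc', le_div_iff₀ hk0]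
    linarith
  have hlog : ((s / 2 ^ 21 + 1 : ℕ) : ℝ) * Real.log 2 + 4 * (a * Real.log a) + 4 * (b * Real.log b)
      ≤ 4 * ((a + b) * Real.log (a + b)) := by
    have h1 : (2:ℝ) ^ (s / 2 ^ 21 + 1) * ((a:ℝ) ^ (4 * a) * (b:ℝ) ^ (4 * b)) ≤
      ((a:ℝ) + b) ^ (4 * (a + b)) := by exact_mod_cast h
    have ha1 : (0:ℝ) < (a:ℝ) ^ (4 * a) := by
      rcases Nat.eq_zero_or_pos a with rfl | ha
      · simp
      · exact pow_pos (by exact_mod_cast ha) _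
    have h2 := Real.log_le_log (by positivity) h1
    rw [Real.log_mul (by positivity) (by positivity), Real.log_mul ha1.ne' (by positivity),
      Real.log_pow, Real.log_pow, Real.log_pow, Real.log_pow] at h2
    push_cast at h2 ⊢
    linarith
  have hent := entropy_le ha0 hb0 (by positivity : 0 < (y:ℝ) / k)
  rw [inv_div] at hent
  have hmono := mul_le_mul_of_nonneg_right hab
    (Real.log_nonneg (by linarith [div_pos hk0 hy0] : 1 ≤ 1 + (k:ℝ) / y))
  have hs : (s:ℝ) / 2 ^ 21 ≤ ((s / 2 ^ 21 + 1 : ℕ) : ℝ) := by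
    have h := Nat.lt_div_mul_add (a := s) (by norm_num : 0 < 2 ^ 21)
    rw [div_le_iff₀ (by positivity)]
    have : s ≤ (s / 2 ^ 21 + 1) * 2 ^ 21 := by rw [add_mul, one_mul]; exact h.le
    exact_mod_cast this
  have h2 : 0 < Real.log 2 := Real.log_pos (by norm_num)
  have hs2 := mul_le_mul_of_nonneg_right hs h2.le
  have hbD : (b:ℝ) = 8 * D := by exact_mod_cast hb
  have e1 : s * (Real.log 2 / 2 ^ 26) = s / 2 ^ 21 * Real.log 2 / 32 := by ring
  rw [e1]
  have e2 : D * (Real.log (1 + (y:ℝ) / k) + (y:ℝ) / k * Real.log (1 + (k:ℝ) / y)) =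
    4 * (b * Real.log (1 + (y:ℝ) / k) + b * ((y:ℝ) / k) * Real.log (1 + (k:ℝ) / y)) / 32 := by
    rw [hbD]; ring
  rw [e2]
  linarith

theorem log_two_le_of_1024_le {k : ℕ} (hk : 1024 ≤ k) : 10 * Real.log 2 ≤ Real.log k := by
  have h : ((2:ℝ) ^ 10) ≤ k := le_trans (by norm_num) (by exact_mod_cast hk : (1024:ℝ) ≤ k)
  have := Real.log_le_log (by norm_num) h
  rwa [Real.log_pow] at this

theorem target_pos {k D : ℕ} (hk : 2 ≤ k) (hD : 1 ≤ D) : 0 < target k D := by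
  have h1 := le_sideLen hD (by omega : 1 ≤ k)
  have h2 := Nat.choose_pos (show k ≤ sideLen k D + 1 by omega)
  have h3 : 0 < sideLen k D := by omega
  rw [target]
  positivity

theorem sumsBound_le_target {D s σ k : ℕ} (hD : 1 ≤ D) (hk : 1024 ≤ k)
    (hσ : σ ≤ 64 * (14 * D + 10)) (h : rateCheck D s = true) :
    sumsBound k s σ ≤ target k D := by
  have hD0 : (1:ℝ) ≤ D := by exact_mod_cast hD
  have hk0 : (0:ℝ) < k := by exact_mod_cast (by omega : 0 < k)
  have hm := le_sideLen hD (by omega : 1 ≤ k)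
  obtain ⟨y, hy⟩ : ∃ y, sideLen k D + 1 = k + y := ⟨sideLen k D + 1 - k, by omega⟩
  have hy1 : 1 ≤ y := by omega
  have hy0 : (0:ℝ) < y := by exact_mod_cast hy1
  have hyR : (sideLen k D : ℝ) + 1 = k + y := by exact_mod_cast hy
  have hrate := le_of_rateCheck hD hk hy1
    (by linarith [mul_rpow_le_sideLen hD (by omega : 1 ≤ k)]) h
  have hch := log_choose_lower (by omega : 1 ≤ k) hy1
  rw [← hy] at hch
  have htar := log_target_ge_of_le (by omega : 2 ≤ k) hD hch
  have ht0 : (0:ℝ) < target k D := by exact_mod_cast target_pos (by omega) hD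
  rw [sumsBound, ← Real.le_log_iff_exp_le ht0]
  refine le_trans ?_ htar
  have hL := log_two_le_of_1024_le hk
  have h2l := Real.log_two_gt_d9
  have h3 := log_three_bounds.2
  have h1 : Real.log 2 ≤ Real.log ((D:ℝ) + 1) := Real.log_le_log (by norm_num) (by linarith)
  have hσR : (σ:ℝ) * (Real.log 2 / 64) ≤ (14 * D + 10) * Real.log 2 := by
    have : (σ:ℝ) ≤ 64 * (14 * D + 10) := by exact_mod_cast hσ
    calc (σ:ℝ) * (Real.log 2 / 64) ≤ 64 * (14 * D + 10) * (Real.log 2 / 64) := by gcongr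
      _ = _ := by ring
  have hkr := mul_le_mul_of_nonneg_left hrate hk0.le
  have e : (k:ℝ) * (D * (Real.log (1 + (y:ℝ) / k) + (y:ℝ) / k * Real.log (1 + (k:ℝ) / y))) =
      D * (k * Real.log (1 + (y:ℝ) / k) + y * Real.log (1 + (k:ℝ) / y)) := by
    field_simp
  rw [e] at hkr
  have hhalf : 0 ≤ D * (Real.log (1 + (k:ℝ) / y) / 2) := by
    have := Real.log_nonneg (by linarith [div_pos hk0 hy0] : 1 ≤ 1 + (k:ℝ) / y)
    positivity
  have hsw : 0 ≤ s * (Real.log 2 / 2 ^ 26) := by positivity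
  have hDL := mul_le_mul_of_nonneg_left hL (by linarith : 0 ≤ 3 / 2 * (D:ℝ) + 1)
  have hD1 := mul_le_mul_of_nonneg_left h1 (by linarith : 0 ≤ (D:ℝ))
  have hD3 := mul_le_mul_of_nonneg_left h3.le (by linarith : 0 ≤ (D:ℝ))
  have hD2 := mul_le_mul_of_nonneg_left h2l.le (by linarith : 0 ≤ (D:ℝ))
  linarith

theorem le_log_of_pow_le {x : ℝ} (hx : 0 < x) {q : ℕ} (h : (2.7182818286:ℝ) ^ q ≤ x ^ 50) :
    (q:ℝ) / 50 ≤ Real.log x := by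
  have h1 : Real.exp q ≤ x ^ 50 := by
    refine le_trans ?_ h
    rw [← mul_one (q:ℝ), Real.exp_nat_mul]
    exact pow_le_pow_left₀ (Real.exp_pos _).le Real.exp_one_lt_d9.le _
  have h2 := (Real.le_log_iff_exp_le (by positivity)).2 h1
  rw [Real.log_pow] at h2
  push_cast at h2
  linarith

theorem logRatio_ge {k : ℕ} (hk : 1024 ≤ k) {B : ℝ} (hB : Real.log k ≤ B) {q : ℕ}
    (h : (2.7182818286:ℝ) ^ q ≤ (1 + 255 / (B + 1 / 4)) ^ 50) :
    (q:ℝ) / 50 ≤ logRatio k 255 := by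
  have hkR : (1024:ℝ) ≤ k := by exact_mod_cast hk
  have hL : 0 < Real.log k := Real.log_pos (by linarith)
  refine (le_log_of_pow_le (by have : 0 < B := hL.trans_le hB; positivity) h).trans ?_
  have hB0 : 0 < B := hL.trans_le hB
  have h1 : (k:ℝ)⁻¹ ≤ 1 / 1020 := by
    rw [← one_div]; exact one_div_le_one_div_of_le (by norm_num) (by linarith)
  have h2 : 255 / (B + 1 / 4) ≤ (Real.log k / (255 : ℕ) + (k:ℝ)⁻¹)⁻¹ := by
    have e : 255 / (B + 1 / 4) = (B / 255 + 1 / 1020)⁻¹ := by field_simp; ring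
    rw [e]
    push_cast
    gcongr
  rw [logRatio]
  gcongr

theorem sumsBound_le_exp_logTarget {k s σ : ℕ} (hk : 1024 ≤ k) (hs : s ≤ 3032000000)
    (hσ : σ ≤ 170000) : sumsBound k s σ ≤ Real.exp (logTarget k 255) := by
  rw [sumsBound, Real.exp_le_exp, logTarget]
  have hkR : (1024:ℝ) ≤ k := by exact_mod_cast hk
  have h2l := Real.log_two_gt_d9
  have h2u := Real.log_two_lt_d9
  have hL := log_two_le_of_1024_le hk
  have hψ0 : 0 ≤ logRatio k 255 := Real.log_nonneg (by
    have : (0:ℝ) ≤ (Real.log k / (255 : ℕ) + (k:ℝ)⁻¹)⁻¹ := by positivity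
    linarith)
  have hS : s * (Real.log 2 / 2 ^ 26) ≤ 31.32 := by
    have : (s:ℝ) ≤ 3032000000 := by exact_mod_cast hs
    have : s * (Real.log 2 / 2 ^ 26) ≤ 3032000000 * (0.6931471808 / 2 ^ 26) := by gcongr
    refine this.trans (by norm_num)
  have hσ' : σ * (Real.log 2 / 64) ≤ 1842 := by
    have : (σ:ℝ) ≤ 170000 := by exact_mod_cast hσ
    have : σ * (Real.log 2 / 64) ≤ 170000 * (0.6931471808 / 64) := by gcongr
    refine this.trans (by norm_num)
  have hmain : 31.32 ≤ Real.log k * (1 + logRatio k 255) := by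
    rcases le_or_gt (Real.log k) 7.36 with h | h
    · have := logRatio_ge hk (B := 7.36) (q := 177) h (by norm_num)
      push_cast at this
      nlinarith
    rcases le_or_gt (Real.log k) 9.8 with h' | h'
    · have := logRatio_ge hk (B := 9.8) (q := 163) h' (by norm_num)
      push_cast at this
      nlinarith
    rcases le_or_gt (Real.log k) 31.32 with h'' | h''
    · have := logRatio_ge hk (B := 31.35) (q := 110) (by linarith) (by norm_num)
      push_cast at this
      nlinarith
    · nlinarith
  have h3 := log_three_bounds.2
  have h256 := log_256_bounds.1
  have hkS := mul_le_mul_of_nonneg_left (hS.trans hmain) (by linarith : 0 ≤ (k:ℝ))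
  have hs0 : 0 ≤ s * (Real.log 2 / 2 ^ 26) := by positivity
  push_cast
  rw [show (255:ℝ) + 1 = 256 by norm_num]
  linarith

theorem exBound_large {k : ℕ} (hk : 1024 ≤ k) :
    (∀ D, 1 ≤ D → D ≤ 255 → ExBound (D + 1) k (target k D)) ∧
      ExBound 256 k (Real.exp (logTarget k 255)) := by
  have hkR : (1024:ℝ) ≤ k := by exact_mod_cast hk
  have e : sumsBound k 0 0 = k := by
    rw [sumsBound]
    simp [Real.exp_log (by linarith : (0:ℝ) < k)]
  obtain ⟨h₁, s, σ, hs, hσ, h₂⟩ := exBound_sumsBound hk le_rfl (by rw [length_stepTable])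
    tableCheck_stepTable sumsCheck_stepTable (by rw [e]; push_cast; linarith)
    (by rw [e]; exact exBound_self_one)
  rw [length_stepTable] at h₁ h₂
  refine ⟨fun D hD hD' => ?_, h₂.mono (sumsBound_le_exp_logTarget hk hs hσ)⟩
  obtain ⟨s, σ, hσ, hs, h⟩ := h₁ (D - 1) (by omega)
  rw [show 1 + (D - 1) = D by omega] at hσ hs h
  exact h.mono (sumsBound_le_target hD hk hσ hs)

theorem exBound_target {k D : ℕ} (hk : 2 ≤ k) (hD : 1 ≤ D) : ExBound (D + 1) k (target k D) := by
  rcases le_or_gt D 255 with hD' | hD'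
  · rcases lt_or_ge k 1024 with hk' | hk'
    · exact (exBound_small hk hk').1 D hD hD'
    · exact (exBound_large hk').1 D hD hD'
  · rcases hk.eq_or_lt with rfl | hk3
    · exact (exBound_two hD'.le).mono (by exact_mod_cast two_pow_mul_le_target hD)
    · have hbase : ExBound 256 k (Real.exp (logTarget k 255)) := by
        rcases lt_or_ge k 1024 with hk' | hk'
        · exact exBound_exp_logTarget_base hk3 hk'
        · exact (exBound_large hk').2
      refine (exBound_exp_logTarget hk3 hbase hD'.le).mono ?_
      have h := logTarget_le hk hD
      exact (Real.le_log_iff_exp_le (by exact_mod_cast target_pos hk hD)).1 h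

theorem fK_le_of_exBound {d k n G : ℕ} (h : ExBound d k G) : fK n k d ≤ G * n ^ (d - 1) := by
  refine csSup_le' ?_
  rintro _ ⟨P, hP, rfl⟩
  refine csSup_le' ?_
  rintro _ ⟨M, hM, rfl⟩
  exact_mod_cast h P hP n M hM

/-- With `m = ⌈k^(d/(d-1))⌉` (relevant for `d ≥ 2`),
`f(n,k,d) ≤ k^d (d m C(m+1,k))^(d-1) n^(d-1)`. -/
theorem stmt12 (d k n : ℕ) (hd : 1 ≤ d) (hk : 1 ≤ k) (hn : 1 ≤ n) :
    fK n k d ≤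
      k ^ d *
        (d * ⌈(k : ℝ) ^ ((d : ℝ) / ((d : ℝ) - 1))⌉₊ *
            Nat.choose (⌈(k : ℝ) ^ ((d : ℝ) / ((d : ℝ) - 1))⌉₊ + 1) k) ^ (d - 1) *
        n ^ (d - 1) := by
  obtain ⟨D, rfl⟩ : ∃ D, d = D + 1 := ⟨d - 1, by omega⟩
  refine fK_le_of_exBound (G := target k D) ?_
  rcases Nat.eq_zero_or_pos D with rfl | hD
  · have : target k 0 = k := by simp [target]
    rw [this]
    exact exBound_self_one
  rcases hk.eq_or_lt with rfl | hk2
  · exact (exBound_one_right _).mono (Nat.cast_nonneg _)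
  · exact exBound_target hk2 hD
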